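/- arXiv:2409.18230 — 11 statements merged into one kernel-verified Lean document; each statement's English description precedes it below -/
import Mathlib

section
/- There exists a Borel measure μ on ℝ, finite and positive on every bounded interval of positive length, such that for every integer n ≥ 2 there is a constant C(n) > 0 with μ(J₁) ≤ C(n)·μ(J₂) for all n-adic siblings J₁, J₂, yet μ is not doubling: for every C > 0 there exist adjacent intervals I₁, I₂ of equal positive length with μ(I₁) > C·μ(I₂). -/
open MeasureTheory Set
open scoped ENNReal

/-- The `n`-adic interval `[(k-1)/n^m, k/n^m)` (of length `n^{-m}`). -/
def nadicI (n : ℕ) (m k : ℤ) : Set ℝ :=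
  Set.Ico ((k - 1 : ℝ) / (n : ℝ) ^ m) ((k : ℝ) / (n : ℝ) ^ m)

/-- `J₁` and `J₂` are `n`-adic siblings: both are `n`-adic intervals of length
`n^{-(m+1)}` contained in a common `n`-adic interval of length `n^{-m}`. -/
def NAdicSiblings (n : ℕ) (J₁ J₂ : Set ℝ) : Prop :=
  ∃ m k₁ k₂ k : ℤ, J₁ = nadicI n (m + 1) k₁ ∧ J₂ = nadicI n (m + 1) k₂ ∧
    J₁ ⊆ nadicI n m k ∧ J₂ ⊆ nadicI n m k

/-- `I₁, I₂` are adjacent half-open intervals of equal positive length. -/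
def AdjacentPair (I₁ I₂ : Set ℝ) : Prop :=
  ∃ x l : ℝ, 0 < l ∧
    ((I₁ = Set.Ico (x - l) x ∧ I₂ = Set.Ico x (x + l)) ∨
     (I₂ = Set.Ico (x - l) x ∧ I₁ = Set.Ico x (x + l)))

/-- The function `x` on the negative half-line and `x ^ 2` on the positive one. -/
noncomputable def linearSq (x : ℝ) : ℝ := min x 0 + (max x 0) ^ 2

lemma linearSq_of_nonpos {x : ℝ} (hx : x ≤ 0) : linearSq x = x := by
  simp [linearSq, hx]

lemma linearSq_of_nonneg {x : ℝ} (hx : 0 ≤ x) : linearSq x = x ^ 2 := by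
  simp [linearSq, hx]

lemma linearSq_strictMono : StrictMono linearSq := by
  intro x y hxy
  rcases le_total y 0 with hy | hy
  · rwa [linearSq_of_nonpos hy, linearSq_of_nonpos (hxy.le.trans hy)]
  rcases le_total x 0 with hx | hx
  · rw [linearSq_of_nonneg hy, linearSq_of_nonpos hx]
    nlinarith [sq_nonneg y, sq_nonneg (y + x)]
  · rw [linearSq_of_nonneg hy, linearSq_of_nonneg hx]
    nlinarith

lemma continuous_linearSq : Continuous linearSq := by
  unfold linearSq
  fun_prop

/-- The measure with distribution function `linearSq`: Lebesgue measure on the negative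
half-line and density `2 * x` on the positive one. -/
noncomputable def linearSqMeasure : Measure ℝ :=
  StieltjesFunction.measure
    { toFun := linearSq
      mono' := linearSq_strictMono.monotone
      right_continuous' := fun _ => continuous_linearSq.continuousWithinAt }

lemma linearSqMeasure_Ico (x y : ℝ) :
    linearSqMeasure (Ico x y) = ENNReal.ofReal (linearSq y - linearSq x) := by
  have h (z : ℝ) : Function.leftLim linearSq z = linearSq z :=
    continuous_linearSq.continuousAt.continuousWithinAt.leftLim_eq
  simp only [linearSqMeasure, StieltjesFunction.measure_Ico]
  exact congrArg₂ (fun a b => ENNReal.ofReal (a - b)) (h y) (h x)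

lemma nadicI_subset_nadicI {n : ℕ} (hn : 2 ≤ n) {m k j : ℤ}
    (h : nadicI n (m + 1) j ⊆ nadicI n m k) : (k - 1) * n ≤ j - 1 ∧ j ≤ k * n := by
  have hn0 : (0 : ℝ) < n := by positivity
  have hN : (0 : ℝ) < (n : ℝ) ^ m := by positivity
  have hN' : (n : ℝ) ^ (m + 1) = (n : ℝ) ^ m * n := zpow_add_one₀ hn0.ne' m
  unfold nadicI at h
  rw [hN', Ico_subset_Ico_iff (by gcongr; linarith)] at h
  obtain ⟨h₁, h₂⟩ := h
  rw [div_le_div_iff₀ (by positivity) (by positivity)] at h₁ h₂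
  constructor
  · have : ((k : ℝ) - 1) * n ≤ j - 1 := by
      refine le_of_mul_le_mul_right ?_ hN
      linarith
    exact_mod_cast this
  · have : (j : ℝ) ≤ k * n := by
      refine le_of_mul_le_mul_right ?_ hN
      linarith
    exact_mod_cast this

/-- Two cells of the grid of step `1 / N` lying in the same `n`-adic parent have
comparable `linearSq`-increments. -/
lemma linearSq_sub_le {n : ℕ} (hn : 2 ≤ n) {N : ℝ} (hN : 0 < N) {k i j : ℤ}
    (hi : (k - 1) * n ≤ i - 1 ∧ i ≤ k * n) (hj : (k - 1) * n ≤ j - 1 ∧ j ≤ k * n) :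
    linearSq (i / N) - linearSq ((i - 1 : ℝ) / N) ≤
      2 * n * (linearSq (j / N) - linearSq ((j - 1 : ℝ) / N)) := by
  have hn' : (2 : ℝ) ≤ n := by exact_mod_cast hn
  rcases le_or_gt k 0 with hk | hk
  · have key {a : ℤ} (ha : a ≤ k * n) :
        linearSq (a / N) - linearSq ((a - 1 : ℝ) / N) = 1 / N := by
      have ha0 : (a : ℝ) ≤ 0 := by
        exact_mod_cast ha.trans (mul_nonpos_of_nonpos_of_nonneg hk (by positivity))
      rw [linearSq_of_nonpos (div_nonpos_of_nonpos_of_nonneg ha0 hN.le),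
        linearSq_of_nonpos (div_nonpos_of_nonpos_of_nonneg (by linarith) hN.le)]
      ring
    rw [key hi.2, key hj.2]
    exact le_mul_of_one_le_left (by positivity) (by linarith)
  · have key {a : ℤ} (ha : (k - 1) * n ≤ a - 1) :
        linearSq (a / N) - linearSq ((a - 1 : ℝ) / N) = (2 * a - 1) / N ^ 2 := by
      have ha0 : (0 : ℝ) ≤ a - 1 := by
        exact_mod_cast (mul_nonneg (by lia : 0 ≤ k - 1) (by positivity)).trans ha
      rw [linearSq_of_nonneg (div_nonneg (by linarith) hN.le),
        linearSq_of_nonneg (div_nonneg ha0 hN.le)]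
      ring
    rw [key hi.1, key hj.1, ← mul_div_assoc]
    gcongr
    have hi' : (i : ℝ) ≤ k * n := by exact_mod_cast hi.2
    have hj' : ((k : ℝ) - 1) * n ≤ j - 1 := by exact_mod_cast hj.1
    have hk' : (0 : ℝ) ≤ k - 1 := by
      rw [sub_nonneg]; exact_mod_cast hk
    have h₁ : 2 * (n : ℝ) * (2 * ((k - 1) * n) + 1) ≤ 2 * n * (2 * j - 1) := by
      gcongr
      linarith
    nlinarith [mul_nonneg (mul_nonneg hk' (by positivity : (0 : ℝ) ≤ n))
      (by linarith : (0 : ℝ) ≤ 2 * n - 1)]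

/-- There exists a Borel measure on `ℝ`, finite and positive on every bounded
interval of positive length, that is `n`-adic doubling for every `n ≥ 2` yet not doubling. -/
theorem exists_nadic_doubling_not_doubling_real :
    ∃ μ : Measure ℝ,
      (∀ x y : ℝ, x < y → 0 < μ (Set.Ico x y) ∧ μ (Set.Ico x y) < ⊤) ∧
      (∀ n : ℕ, 2 ≤ n → ∃ C : ℝ, 0 < C ∧
        ∀ J₁ J₂ : Set ℝ, NAdicSiblings n J₁ J₂ → μ J₁ ≤ ENNReal.ofReal C * μ J₂) ∧
      (∀ C : ℝ, 0 < C → ∃ I₁ I₂ : Set ℝ, AdjacentPair I₁ I₂ ∧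
        ENNReal.ofReal C * μ I₂ < μ I₁) := by
  refine ⟨linearSqMeasure, fun x y hxy => ?_, fun n hn => ?_, fun C hC => ?_⟩
  · rw [linearSqMeasure_Ico]
    exact ⟨ENNReal.ofReal_pos.2 (sub_pos.2 (linearSq_strictMono hxy)), ENNReal.ofReal_lt_top⟩
  · refine ⟨2 * n, by positivity, ?_⟩
    rintro _ _ ⟨m, i, j, k, rfl, rfl, hi, hj⟩
    have hN : (0 : ℝ) < (n : ℝ) ^ (m + 1) := by positivity
    simp only [nadicI, linearSqMeasure_Ico]
    rw [← ENNReal.ofReal_mul (by positivity)]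
    exact ENNReal.ofReal_le_ofReal
      (linearSq_sub_le hn hN (nadicI_subset_nadicI hn hi) (nadicI_subset_nadicI hn hj))
  · have hl : 0 < 1 / (C + 1) := by positivity
    refine ⟨Ico (0 - 1 / (C + 1)) 0, Ico 0 (0 + 1 / (C + 1)),
      ⟨0, 1 / (C + 1), hl, Or.inl ⟨rfl, rfl⟩⟩, ?_⟩
    rw [linearSqMeasure_Ico, linearSqMeasure_Ico, ← ENNReal.ofReal_mul hC.le, zero_add,
      linearSq_of_nonneg hl.le, linearSq_of_nonpos (le_refl (0 : ℝ)),
      linearSq_of_nonpos (by linarith : 0 - 1 / (C + 1) ≤ 0),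
      ENNReal.ofReal_lt_ofReal_iff (by linarith)]
    have hC1 : C * (1 / (C + 1)) < 1 := by
      rw [mul_one_div, div_lt_one (by positivity)]
      linarith
    nlinarith
end

section
/- There exists a Borel measure μ on [0,1), finite and positive on every interval of positive length contained in [0,1), such that for every integer n ≥ 2 there is a constant C(n) > 0 with μ(J₁) ≤ C(n)·μ(J₂) for all n-adic siblings J₁, J₂ ⊆ [0,1), yet μ is not doubling on [0,1): for every C > 0 there exist adjacent intervals I₁, I₂ ⊆ [0,1) of equal positive length with μ(I₁) > C·μ(I₂). -/
open MeasureTheory Set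
open scoped ENNReal

/-- Powers of the integers `2, …, N` return simultaneously to a small multiplicative window. -/
theorem exists_common_nadic_scale (N : ℕ) {ε B : ℝ} (hε : 0 < ε) (hB : 0 < B) :
    ∃ z : ℝ, 0 < z ∧ z < B ∧ ∀ n : ℕ, 2 ≤ n → n ≤ N →
      ∃ i : ℤ, z ≤ (n : ℝ) ^ (-i) ∧ (n : ℝ) ^ (-i) ≤ z * (1 + ε) := by
  set e := Real.log (1 + ε) with he
  have he0 : 0 < e := Real.log_pos (by linarith)
  have hcomp : IsCompact (Set.univ.pi fun _ : ℕ => Set.Icc (0 : ℝ) 1) :=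
    isCompact_univ_pi fun _ => isCompact_Icc
  obtain ⟨L, -, φ, hφ, hlim⟩ := hcomp.tendsto_subseq
    (x := fun (k : ℕ) (n : ℕ) => Int.fract ((k : ℝ) / Real.log n))
    (fun k n _ => ⟨Int.fract_nonneg _, (Int.fract_lt_one _).le⟩)
  rw [tendsto_pi_nhds] at hlim
  set δ := e / 4 / (Real.log (N + 1) + 1) with hδ
  have hlogN : 0 ≤ Real.log ((N : ℝ) + 1) := Real.log_nonneg (by simp)
  have hδ0 : 0 < δ := by positivity
  have hev : ∀ᶠ k in Filter.atTop, ∀ n ∈ Finset.range (N + 1),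
      |Int.fract ((φ k : ℝ) / Real.log n) - L n| < δ := by
    rw [Finset.eventually_all]
    intro n _
    simpa [Real.dist_eq] using (Metric.tendsto_nhds.1 (hlim n)) δ hδ0
  obtain ⟨a, ha⟩ := Filter.eventually_atTop.1 hev
  obtain ⟨M, hM⟩ := exists_nat_gt (-Real.log B)
  set b := φ a + M + a with hb
  have hφb : b ≤ φ b := hφ.id_le b
  have hD : M + (φ a : ℝ) ≤ φ b := by exact_mod_cast (by omega : M + φ a ≤ φ b)
  set D : ℝ := φ b - φ a with hDdef
  refine ⟨Real.exp (-D - e / 2), Real.exp_pos _, ?_, fun n hn2 hnN => ?_⟩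
  · rw [← Real.lt_log_iff_exp_lt hB]; linarith
  have hn0 : (0 : ℝ) < n := by positivity
  have hlog : 0 < Real.log n := Real.log_pos (by exact_mod_cast hn2)
  have hlog' : Real.log n ≤ Real.log (N + 1) :=
    Real.log_le_log hn0 (by exact_mod_cast (by omega : n ≤ N + 1))
  have h1 := ha a le_rfl n (Finset.mem_range.2 (by omega))
  have h2 := ha b (by omega) n (Finset.mem_range.2 (by omega))
  set i : ℤ := ⌊(φ b : ℝ) / Real.log n⌋ - ⌊(φ a : ℝ) / Real.log n⌋ with hi
  have hfr : Int.fract ((φ b : ℝ) / Real.log n) - Int.fract ((φ a : ℝ) / Real.log n)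
      = D / Real.log n - i := by
    simp only [Int.fract, hi, hDdef]; push_cast; ring
  have h3 : |D / Real.log n - i| < 2 * δ := by
    rw [← hfr]
    rw [abs_lt] at *
    constructor <;> linarith [h1.1, h1.2, h2.1, h2.2]
  have h4 : |D - i * Real.log n| ≤ e / 2 := by
    have : D - i * Real.log n = (D / Real.log n - i) * Real.log n := by field_simp
    rw [this, abs_mul, abs_of_pos hlog]
    calc _ ≤ 2 * δ * (Real.log (N + 1) + 1) :=
          mul_le_mul h3.le (by linarith) hlog.le (by positivity)
      _ = e / 2 := by rw [hδ]; field_simp; ring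
  have hpow : (n : ℝ) ^ (-i) = Real.exp (-(i * Real.log n)) := by
    rw [← Real.rpow_intCast, Real.rpow_def_of_pos hn0]; push_cast; ring_nf
  have hε' : 1 + ε = Real.exp e := (Real.exp_log (by linarith)).symm
  rw [abs_le] at h4
  refine ⟨i, ?_⟩
  rw [hpow, hε', ← Real.exp_add, Real.exp_le_exp, Real.exp_le_exp]
  constructor <;> linarith [h4.1, h4.2]

theorem lintegral_Ioo_sqrt_div_le {l m : ℝ} (h : l < m) :
    ∫⁻ t in Set.Ioo l m, ENNReal.ofReal (√((m - l) / (t - l))) ≤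
      ENNReal.ofReal (2 * (m - l)) := by
  have hint : IntervalIntegrable (fun t : ℝ => √(m - l) * (t - l) ^ (-(1 / 2) : ℝ)) volume l m := by
    have := (intervalIntegral.intervalIntegrable_rpow' (a := 0) (b := m - l)
      (r := (-(1 / 2) : ℝ)) (by norm_num)).comp_sub_right l
    simpa using this.const_mul (√(m - l))
  have heq : ∫ t in l..m, √(m - l) * (t - l) ^ (-(1 / 2) : ℝ) = 2 * (m - l) := by
    rw [intervalIntegral.integral_const_mul,
      intervalIntegral.integral_comp_sub_right (fun t => t ^ (-(1 / 2) : ℝ)) l, sub_self,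
      integral_rpow (Or.inl (by norm_num))]
    rw [Real.zero_rpow (by norm_num), show (-(1 / 2) + 1 : ℝ) = 1 / 2 by norm_num,
      ← Real.sqrt_eq_rpow]
    have := Real.mul_self_sqrt (show 0 ≤ m - l by linarith)
    linear_combination 2 * this
  rw [intervalIntegral.integral_of_le h.le] at heq
  rw [← heq, ofReal_integral_eq_lintegral_ofReal
    ((intervalIntegrable_iff_integrableOn_Ioc_of_le h.le).1 hint)]
  · refine (setLIntegral_mono' measurableSet_Ioo fun t ht => ?_).trans
      (lintegral_mono_set Set.Ioo_subset_Ioc_self)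
    have ht0 : 0 < t - l := by linarith [ht.1]
    rw [Real.rpow_neg ht0.le, ← Real.sqrt_eq_rpow, Real.sqrt_div (by linarith), div_eq_mul_inv]
  · refine (ae_restrict_iff' measurableSet_Ioc).2 (ae_of_all _ fun t ht => ?_)
    have ht0 : 0 < t - l := by linarith [ht.1]
    have := Real.rpow_nonneg ht0.le (-(1 / 2))
    simp only [Pi.zero_apply]
    positivity

/-- To the right of `l`, the function `f` varies at most like the square root of the
distance to `l`. -/
def SqrtTame (f : ℝ → ℝ) (l : ℝ) : Prop :=
  ∀ s t : ℝ, l < s → s ≤ t →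
    f s ≤ f t * √((t - l) / (s - l)) ∧ f t ≤ f s * √((t - l) / (s - l))

theorem SqrtTame.lintegral_le {f : ℝ → ℝ} {l m : ℝ} (hf : SqrtTame f l) (h : l < m)
    (h0 : 0 ≤ f m) :
    ∫⁻ t in Set.Ioo l m, ENNReal.ofReal (f t) ≤ ENNReal.ofReal (2 * f m * (m - l)) := by
  calc _ ≤ ∫⁻ t in Set.Ioo l m, ENNReal.ofReal (f m) * ENNReal.ofReal (√((m - l) / (t - l))) := by
        refine setLIntegral_mono' measurableSet_Ioo fun t ht => ?_
        rw [← ENNReal.ofReal_mul h0]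
        exact ENNReal.ofReal_le_ofReal (hf t m ht.1 ht.2.le).1
    _ = ENNReal.ofReal (f m) * ∫⁻ t in Set.Ioo l m, ENNReal.ofReal (√((m - l) / (t - l))) :=
        lintegral_const_mul' _ _ ENNReal.ofReal_ne_top
    _ ≤ ENNReal.ofReal (f m) * ENNReal.ofReal (2 * (m - l)) := by
        gcongr; exact lintegral_Ioo_sqrt_div_le h
    _ = _ := by rw [← ENNReal.ofReal_mul h0]; ring_nf

theorem lintegral_Ioo_le_of_le {F : ℝ → ℝ≥0∞} {a b C : ℝ} (hC : 0 ≤ C)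
    (h : ∀ t ∈ Set.Ioo a b, F t ≤ ENNReal.ofReal C) :
    ∫⁻ t in Set.Ioo a b, F t ≤ ENNReal.ofReal (C * (b - a)) := by
  refine (setLIntegral_mono' measurableSet_Ioo h).trans ?_
  rw [setLIntegral_const, Real.volume_Ioo, ENNReal.ofReal_mul hC]

theorem le_lintegral_Ioo_of_le {F : ℝ → ℝ≥0∞} {a b a' b' C : ℝ} (hC : 0 ≤ C)
    (ha : a ≤ a') (hb : b' ≤ b) (h : ∀ t ∈ Set.Ioo a' b', ENNReal.ofReal C ≤ F t) :
    ENNReal.ofReal (C * (b' - a')) ≤ ∫⁻ t in Set.Ioo a b, F t := by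
  refine le_trans ?_ ((setLIntegral_mono' measurableSet_Ioo h).trans
    (lintegral_mono_set (Set.Ioo_subset_Ioo ha hb)))
  rw [setLIntegral_const, Real.volume_Ioo, ENNReal.ofReal_mul hC]

theorem SqrtTame.lintegral_le_mul {f : ℝ → ℝ} {l c w n : ℝ} (hf : SqrtTame f l)
    (h0 : ∀ t, 0 ≤ f t) (hw : 0 < w) (hn : 1 ≤ n) (hlc : l ≤ c) (hc : c + w ≤ l + n * w) :
    ∫⁻ t in Set.Ioo l (l + n * w), ENNReal.ofReal (f t) ≤
      ENNReal.ofReal (32 * n ^ 2) * ∫⁻ t in Set.Ioo c (c + w), ENNReal.ofReal (f t) := by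
  set m := c + w / 2 with hm
  have hlm : l < m := by linarith
  have h1 := hf.lintegral_le hlm (h0 m)
  have h2 : ∫⁻ t in Set.Ico m (l + n * w), ENNReal.ofReal (f t) ≤
      ENNReal.ofReal (f m * (2 * n) * (l + n * w - m)) := by
    rw [setLIntegral_congr Ioo_ae_eq_Ico.symm]
    refine lintegral_Ioo_le_of_le (by have := h0 m; positivity) fun t ht => ?_
    refine ENNReal.ofReal_le_ofReal ((hf m t hlm ht.1.le).2.trans ?_)
    refine mul_le_mul_of_nonneg_left ?_ (h0 m)
    rw [Real.sqrt_le_left (by linarith), div_le_iff₀ (by linarith)]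
    have e1 : t - l ≤ n * w := by linarith [ht.2]
    have e2 : w / 2 ≤ m - l := by linarith
    nlinarith [mul_le_mul_of_nonneg_left e2 (show (0 : ℝ) ≤ (2 * n) ^ 2 by positivity),
      mul_le_mul_of_nonneg_right hn (mul_nonneg (by linarith : (0 : ℝ) ≤ n) hw.le)]
  have h3 : ENNReal.ofReal (f m / 2 * (c + w - m)) ≤
      ∫⁻ t in Set.Ioo c (c + w), ENNReal.ofReal (f t) := by
    refine le_lintegral_Ioo_of_le (by have := h0 m; positivity) (by linarith) le_rfl fun t ht => ?_
    refine ENNReal.ofReal_le_ofReal ?_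
    have e1 := (hf m t hlm ht.1.le).1
    have e2 : √((t - l) / (m - l)) ≤ 2 := by
      rw [Real.sqrt_le_left (by norm_num), div_le_iff₀ (by linarith)]
      linarith [ht.2]
    nlinarith [h0 t]
  have hsub : Set.Ioo l (l + n * w) ⊆ Set.Ioo l m ∪ Set.Ico m (l + n * w) := by
    intro t ht
    rcases lt_or_ge t m with h | h
    · exact Or.inl ⟨ht.1, h⟩
    · exact Or.inr ⟨h, ht.2⟩
  calc _ ≤ _ := lintegral_mono_set hsub
    _ ≤ _ := lintegral_union_le _ _ _
    _ ≤ _ := add_le_add h1 h2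
    _ = ENNReal.ofReal (2 * f m * (m - l) + f m * (2 * n) * (l + n * w - m)) := by
        rw [ENNReal.ofReal_add]
        · exact mul_nonneg (mul_nonneg zero_le_two (h0 m)) (by linarith)
        · exact mul_nonneg (mul_nonneg (h0 m) (by linarith)) (by linarith)
    _ ≤ ENNReal.ofReal (32 * n ^ 2 * (f m / 2 * (c + w - m))) := by
        refine ENNReal.ofReal_le_ofReal ?_
        have hcw : c + w - m = w / 2 := by rw [hm]; ring
        rw [hcw]
        have e1 : m - l ≤ n * w := by linarith
        have e2 : l + n * w - m ≤ n * w := by linarith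
        have e3 : 2 * (m - l) + 2 * n * (l + n * w - m) ≤ 8 * n ^ 2 * w := by
          nlinarith [mul_le_mul_of_nonneg_left e2 (show (0 : ℝ) ≤ 2 * n by linarith),
            mul_le_mul_of_nonneg_right hn (mul_nonneg (by linarith : (0 : ℝ) ≤ n) hw.le)]
        nlinarith [mul_le_mul_of_nonneg_left e3 (h0 m)]
    _ = _ := ENNReal.ofReal_mul (by positivity)
    _ ≤ _ := by gcongr

/-- A weight equal to `1` outside `(z, 2z)`, which dips to `√η` at the point `z + ηz`. -/
noncomputable def dip (z η t : ℝ) : ℝ :=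
  if t ≤ z then 1 else min 1 (max √(t / z - 1) (η / √(t / z - 1)))

section dip

variable {z η t : ℝ}

theorem dip_le_one : dip z η t ≤ 1 := by
  unfold dip; split_ifs
  · exact le_rfl
  · exact min_le_left _ _

theorem dip_of_le (h : t ≤ z) : dip z η t = 1 := if_pos h

theorem le_dip {c : ℝ} (hc : c ≤ 1) (h : z < t → c ≤ max √(t / z - 1) (η / √(t / z - 1))) :
    c ≤ dip z η t := by
  unfold dip; split_ifs with h'
  · exact hc
  · exact le_min hc (h (not_le.1 h'))

theorem div_sub_one_pos (hz : 0 < z) (h : z < t) : 0 < t / z - 1 := by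
  rw [sub_pos, lt_div_iff₀ hz]; linarith

theorem dip_of_two_mul_le (hz : 0 < z) (h : 2 * z ≤ t) : dip z η t = 1 := by
  refine le_antisymm dip_le_one (le_dip le_rfl fun _ => le_max_of_le_left ?_)
  rw [Real.one_le_sqrt, le_sub_iff_add_le, le_div_iff₀ hz]; linarith

theorem dip_of_le_one_add (hz : 0 < z) (hη : 0 ≤ η) (h : t ≤ z * (1 + η ^ 2)) :
    dip z η t = 1 := by
  refine le_antisymm dip_le_one (le_dip le_rfl fun ht => le_max_of_le_right ?_)
  have := div_sub_one_pos hz ht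
  rw [le_div_iff₀ (Real.sqrt_pos.2 this), one_mul, Real.sqrt_le_left hη, sub_le_iff_le_add,
    div_le_iff₀ hz]
  linarith

theorem sqrt_le_dip (hz : 0 < z) (hη : 0 ≤ η) (hη1 : η ≤ 1) : √η ≤ dip z η t := by
  refine le_dip (Real.sqrt_le_one.2 hη1) fun ht => ?_
  have hp := Real.sqrt_pos.2 (div_sub_one_pos hz ht)
  rw [le_max_iff]
  by_contra! hcon
  rw [div_lt_iff₀ hp] at hcon
  nlinarith [Real.mul_self_sqrt hη, Real.sqrt_nonneg η]

theorem dip_nonneg (hz : 0 < z) (hη : 0 ≤ η) (hη1 : η ≤ 1) : 0 ≤ dip z η t :=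
  (Real.sqrt_nonneg _).trans (sqrt_le_dip hz hη hη1)

theorem dip_at_bottom (hz : 0 < z) (hη : 0 < η) : dip z η (z + η * z) ≤ √η := by
  unfold dip
  rw [if_neg (by nlinarith), show (z + η * z) / z - 1 = η by field_simp; ring,
    Real.div_sqrt, max_self]
  exact min_le_right _ _

theorem dip_sqrtTame (hz : 0 < z) (hη : 0 ≤ η) (hη1 : η ≤ 1) {l : ℝ} (hl : z ≤ l) :
    SqrtTame (dip z η) l := by
  intro s t hs hst
  have hzs : z < s := hl.trans_lt hs
  have hzt : z < t := hzs.trans_le hst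
  have hle : √((t - z) / (s - z)) ≤ √((t - l) / (s - l)) := by
    apply Real.sqrt_le_sqrt
    rw [div_le_div_iff₀ (by linarith) (by linarith)]
    nlinarith [mul_nonneg (sub_nonneg.2 hst) (sub_nonneg.2 hl)]
  suffices h : dip z η s ≤ dip z η t * √((t - z) / (s - z)) ∧
      dip z η t ≤ dip z η s * √((t - z) / (s - z)) from
    ⟨h.1.trans (mul_le_mul_of_nonneg_left hle (dip_nonneg hz hη hη1)),
      h.2.trans (mul_le_mul_of_nonneg_left hle (dip_nonneg hz hη hη1))⟩
  set r := √((t - z) / (s - z)) with hr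
  have hr1 : 1 ≤ r := by
    rw [hr, Real.one_le_sqrt, le_div_iff₀ (by linarith)]; linarith
  have hrp : √(t / z - 1) = √(s / z - 1) * r := by
    rw [hr, ← Real.sqrt_mul (div_sub_one_pos hz hzs).le]
    congr 1
    have : s - z ≠ 0 := by linarith
    field_simp
  have hp := Real.sqrt_pos.2 (div_sub_one_pos hz hzs)
  unfold dip
  rw [if_neg hzs.not_ge, if_neg hzt.not_ge, hrp]
  set p := √(s / z - 1)
  have hr0 : 0 < r := by linarith
  have hd : η / (p * r) * r = η / p := by field_simp
  have hq : 0 ≤ η / p := by positivity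
  have hq' : 0 ≤ η / (p * r) := by positivity
  have hd' : η / (p * r) ≤ η / p := by nlinarith
  rw [min_mul_of_nonneg _ _ hr0.le, min_mul_of_nonneg _ _ hr0.le, max_mul_of_nonneg _ _ hr0.le,
    max_mul_of_nonneg _ _ hr0.le, hd, one_mul]
  refine ⟨min_le_min hr1 (max_le_max ?_ le_rfl), min_le_min hr1 (max_le_max le_rfl ?_)⟩
  · exact (le_mul_of_one_le_right hp.le hr1).trans
      (le_mul_of_one_le_right (mul_pos hp hr0).le hr1)
  · nlinarith

end dip

/-- The depth parameter of the `K`-th dip. -/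
noncomputable def dipDepth (K : ℕ) : ℝ := (1 / ((K : ℝ) + 1)) ^ 2

theorem dipDepth_pos (K : ℕ) : 0 < dipDepth K := by unfold dipDepth; positivity

theorem sqrt_dipDepth (K : ℕ) : √(dipDepth K) = 1 / ((K : ℝ) + 1) :=
  Real.sqrt_sq (by positivity)

theorem dipDepth_le_one (K : ℕ) : dipDepth K ≤ 1 := by
  unfold dipDepth
  refine pow_le_one₀ (by positivity) ?_
  rw [div_le_one (by positivity)]
  linarith [(Nat.cast_nonneg K : (0 : ℝ) ≤ K)]

/-- Dip locations: the `K`-th one is, for every `n ≤ K`, just to the left of a power of `n`. -/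
structure IsDipSeq (z : ℕ → ℝ) : Prop where
  pos : ∀ K, 0 < z K
  zero_le : z 0 ≤ 1 / 2
  succ_le : ∀ K, z (K + 1) ≤ z K / 4
  near : ∀ K n : ℕ, 2 ≤ n → n ≤ K →
    ∃ i : ℤ, z K ≤ (n : ℝ) ^ (-i) ∧ (n : ℝ) ^ (-i) ≤ z K * (1 + dipDepth K ^ 2)

theorem exists_isDipSeq : ∃ z, IsDipSeq z := by
  have hex : ∀ (K : ℕ) (B : ℝ), ∃ w : ℝ, 0 < B → 0 < w ∧ w < B ∧ ∀ n : ℕ, 2 ≤ n → n ≤ K →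
      ∃ i : ℤ, w ≤ (n : ℝ) ^ (-i) ∧ (n : ℝ) ^ (-i) ≤ w * (1 + dipDepth K ^ 2) := by
    intro K B
    by_cases hB : 0 < B
    · obtain ⟨w, hw⟩ := exists_common_nadic_scale K (pow_pos (dipDepth_pos K) 2) hB
      exact ⟨w, fun _ => hw⟩
    · exact ⟨0, fun h => absurd h hB⟩
  choose Z hZ using hex
  let z : ℕ → ℝ := fun K => Nat.rec (Z 0 (1 / 2)) (fun k w => Z (k + 1) (w / 4)) K
  have hz0 : z 0 = Z 0 (1 / 2) := rfl
  have hzs : ∀ K, z (K + 1) = Z (K + 1) (z K / 4) := fun _ => rfl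
  have hpos : ∀ K, 0 < z K := by
    intro K
    induction K with
    | zero => exact (hZ 0 _ (by norm_num)).1
    | succ K ih => rw [hzs]; exact (hZ _ _ (by linarith)).1
  refine ⟨z, hpos, (hZ 0 _ (by norm_num)).2.1.le, fun K => ?_, fun K => ?_⟩
  · rw [hzs]; exact (hZ _ _ (by linarith [hpos K])).2.1.le
  · cases K with
    | zero => exact (hZ 0 _ (by norm_num)).2.2
    | succ K => rw [hzs]; exact (hZ _ _ (by linarith [hpos K])).2.2

/-- The density with a dip at each of the locations `z K`. -/
noncomputable def dipDensity (z : ℕ → ℝ) (t : ℝ) : ℝ≥0∞ :=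
  ⨅ K, ENNReal.ofReal (dip (z K) (dipDepth K) t)

theorem dipDensity_le_one (z : ℕ → ℝ) (t : ℝ) : dipDensity z t ≤ 1 :=
  (iInf_le _ 0).trans (ENNReal.ofReal_le_one.2 dip_le_one)

namespace IsDipSeq

variable {z : ℕ → ℝ}

theorem le_div_of_lt (hz : IsDipSeq z) {K K' : ℕ} (h : K < K') : z K' ≤ z K / 4 := by
  have hanti : Antitone z := antitone_nat_of_succ_le fun K => by
    linarith [hz.succ_le K, hz.pos K]
  exact (hanti (Nat.succ_le_of_lt h)).trans (hz.succ_le K)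

theorem le_half (hz : IsDipSeq z) (K : ℕ) : z K ≤ 1 / 2 := by
  rcases Nat.eq_zero_or_pos K with rfl | h
  · exact hz.zero_le
  · linarith [hz.le_div_of_lt h, hz.zero_le]

theorem dip_nonneg (hz : IsDipSeq z) (K : ℕ) (t : ℝ) : 0 ≤ dip (z K) (dipDepth K) t :=
  _root_.dip_nonneg (hz.pos K) (dipDepth_pos K).le (dipDepth_le_one K)

theorem inv_le_dip (hz : IsDipSeq z) (K : ℕ) (t : ℝ) :
    1 / ((K : ℝ) + 1) ≤ dip (z K) (dipDepth K) t := by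
  rw [← sqrt_dipDepth]
  exact sqrt_le_dip (hz.pos K) (dipDepth_pos K).le (dipDepth_le_one K)

theorem dipDensity_eq_dip {K : ℕ} {t : ℝ}
    (h : ∀ K', K' ≠ K → dip (z K') (dipDepth K') t = 1) :
    dipDensity z t = ENNReal.ofReal (dip (z K) (dipDepth K) t) := by
  refine le_antisymm (iInf_le _ K) (le_iInf fun K' => ?_)
  rcases eq_or_ne K' K with rfl | hne
  · exact le_rfl
  · rw [h K' hne]
    exact ENNReal.ofReal_le_ofReal dip_le_one

theorem exists_dipDensity_eq (hz : IsDipSeq z) {a b : ℝ} (hb : b ≤ 2 * a) :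
    ∃ K, ∀ t ∈ Set.Ioo a b, dipDensity z t = ENNReal.ofReal (dip (z K) (dipDepth K) t) := by
  by_cases hex : ∃ K, ∃ s ∈ Set.Ioo a b, dip (z K) (dipDepth K) s ≠ 1
  · obtain ⟨K, s, hs, hne⟩ := hex
    have hs1 : z K < s := not_le.1 fun h => hne (dip_of_le h)
    have hs2 : s < 2 * z K := not_le.1 fun h => hne (dip_of_two_mul_le (hz.pos K) h)
    refine ⟨K, fun t ht => dipDensity_eq_dip fun K' hK' => ?_⟩
    rcases lt_or_gt_of_ne hK' with h | h
    · exact dip_of_le (by linarith [hz.le_div_of_lt h, ht.1, ht.2, hs.1, hs.2])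
    · exact dip_of_two_mul_le (hz.pos K')
        (by linarith [hz.le_div_of_lt h, ht.1, ht.2, hs.1, hs.2])
  · push Not at hex
    exact ⟨0, fun t ht => dipDensity_eq_dip fun K' _ => hex K' t ht⟩

/-- On a child of `[0, n ^ (-m))` the density is not small on a large part. -/
theorem le_lintegral_of_child (hz : IsDipSeq z) {n : ℕ} (hn : 2 ≤ n) (m : ℤ) {c : ℝ} (hc : 0 ≤ c)
    (hcm : c + (n : ℝ) ^ (-(m + 1)) ≤ (n : ℝ) ^ (-m)) :
    ENNReal.ofReal (1 / (4 * n) * ((n : ℝ) ^ (-(m + 1)) / 8)) ≤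
      ∫⁻ t in Set.Ioo c (c + (n : ℝ) ^ (-(m + 1))), dipDensity z t := by
  have hn2 : (2 : ℝ) ≤ n := by exact_mod_cast hn
  have hw : 0 < (n : ℝ) ^ (-(m + 1)) := by positivity
  have hinv : 1 / (4 * n : ℝ) ≤ 1 / 4 := by
    apply one_div_le_one_div_of_le <;> linarith
  suffices h : ∃ a, c + (n : ℝ) ^ (-(m + 1)) / 2 ≤ a ∧
      a + (n : ℝ) ^ (-(m + 1)) / 8 ≤ c + (n : ℝ) ^ (-(m + 1)) ∧
      ∀ t ∈ Set.Ioo a (a + (n : ℝ) ^ (-(m + 1)) / 8),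
        ENNReal.ofReal (1 / (4 * n)) ≤ dipDensity z t by
    obtain ⟨a, ha, hb, hD⟩ := h
    simpa using le_lintegral_Ioo_of_le (by positivity) (by linarith) hb hD
  set w := (n : ℝ) ^ (-(m + 1)) with hwdef
  obtain ⟨K, hK⟩ := hz.exists_dipDensity_eq (a := c + w / 2) (b := c + w) (by linarith)
  suffices h : ∃ a, c + w / 2 ≤ a ∧ a + w / 8 ≤ c + w ∧
      ∀ t ∈ Set.Ioo a (a + w / 8), 1 / (4 * n : ℝ) ≤ dip (z K) (dipDepth K) t by
    obtain ⟨a, ha, hb, hD⟩ := h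
    refine ⟨a, ha, hb, fun t ht => ?_⟩
    rw [hK t ⟨ha.trans_lt ht.1, ht.2.trans_le hb⟩]
    exact ENNReal.ofReal_le_ofReal (hD t ht)
  rcases lt_or_ge K n with hKn | hKn
  · refine ⟨c + w / 2, le_rfl, by linarith, fun t _ => le_trans ?_ (hz.inv_le_dip K t)⟩
    have : (K : ℝ) + 1 ≤ n := by exact_mod_cast hKn
    exact one_div_le_one_div_of_le (by positivity) (by linarith)
  obtain ⟨i, hi1, hi2⟩ := hz.near K n hn hKn
  rcases le_or_gt (m + 1) i with hmi | hmi
  · have hzw : z K ≤ w := hi1.trans (zpow_le_zpow_right₀ (by linarith) (by linarith))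
    rcases le_or_gt (c + 3 * w / 4) (z K) with h | h
    · refine ⟨c + w / 2, le_rfl, by linarith, fun t ht => ?_⟩
      rw [dip_of_le (by linarith [ht.2])]
      linarith
    · refine ⟨c + 7 * w / 8, by linarith, by linarith, fun t ht => ?_⟩
      refine hinv.trans (le_dip (by norm_num) fun _ => le_max_of_le_left ?_)
      apply Real.le_sqrt_of_sq_le
      rw [le_sub_iff_add_le, le_div_iff₀ (hz.pos K)]
      linarith [ht.1]
  · refine ⟨c + w / 2, le_rfl, by linarith, fun t ht => ?_⟩
    have : (n : ℝ) ^ (-m) ≤ (n : ℝ) ^ (-i) := zpow_le_zpow_right₀ (by linarith) (by linarith)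
    rw [dip_of_le_one_add (hz.pos K) (dipDepth_pos K).le (by linarith [ht.2])]
    linarith

theorem lintegral_parent_le (hz : IsDipSeq z) {n : ℕ} (hn : 2 ≤ n) (m k : ℤ) (hk : 0 ≤ k)
    {c : ℝ} (hlc : k * (n : ℝ) ^ (-m) ≤ c)
    (hcm : c + (n : ℝ) ^ (-(m + 1)) ≤ k * (n : ℝ) ^ (-m) + (n : ℝ) ^ (-m)) :
    ∫⁻ t in Set.Ioo (k * (n : ℝ) ^ (-m)) (k * (n : ℝ) ^ (-m) + (n : ℝ) ^ (-m)), dipDensity z t ≤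
      ENNReal.ofReal (32 * (n : ℝ) ^ 2) *
        ∫⁻ t in Set.Ioo c (c + (n : ℝ) ^ (-(m + 1))), dipDensity z t := by
  have hn2 : (2 : ℝ) ≤ n := by exact_mod_cast hn
  have hw : 0 < (n : ℝ) ^ (-(m + 1)) := by positivity
  have hnw : (n : ℝ) ^ (-m) = n * (n : ℝ) ^ (-(m + 1)) := by
    rw [← zpow_one_add₀ (by positivity)]; congr 1; ring
  have trivial_bound : ENNReal.ofReal (1 / (4 * n) * ((n : ℝ) ^ (-(m + 1)) / 8)) ≤
      ∫⁻ t in Set.Ioo c (c + (n : ℝ) ^ (-(m + 1))), dipDensity z t →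
      ∫⁻ t in Set.Ioo (k * (n : ℝ) ^ (-m)) (k * (n : ℝ) ^ (-m) + (n : ℝ) ^ (-m)), dipDensity z t ≤
      ENNReal.ofReal (32 * (n : ℝ) ^ 2) *
        ∫⁻ t in Set.Ioo c (c + (n : ℝ) ^ (-(m + 1))), dipDensity z t := by
    intro h
    calc _ ≤ ENNReal.ofReal
            (1 * (k * (n : ℝ) ^ (-m) + (n : ℝ) ^ (-m) - k * (n : ℝ) ^ (-m))) :=
          lintegral_Ioo_le_of_le zero_le_one fun t _ => by simpa using dipDensity_le_one z t
      _ = ENNReal.ofReal (32 * (n : ℝ) ^ 2 * (1 / (4 * n) * ((n : ℝ) ^ (-(m + 1)) / 8))) := by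
          rw [hnw]; congr 1; field_simp; ring
      _ = _ := ENNReal.ofReal_mul (by positivity)
      _ ≤ _ := by gcongr
  rcases hk.eq_or_lt with rfl | hk
  · exact trivial_bound (hz.le_lintegral_of_child hn m (by simpa using hlc) (by simpa using hcm))
  have hk1 : (1 : ℝ) ≤ k := by exact_mod_cast hk
  have hR : 0 < (n : ℝ) ^ (-m) := by positivity
  obtain ⟨K, hK⟩ := hz.exists_dipDensity_eq (a := k * (n : ℝ) ^ (-m))
    (b := k * (n : ℝ) ^ (-m) + (n : ℝ) ^ (-m)) (by nlinarith)
  have lower : (∀ t ∈ Set.Ioo c (c + (n : ℝ) ^ (-(m + 1))),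
      1 / (n : ℝ) ≤ dip (z K) (dipDepth K) t) →
      ENNReal.ofReal (1 / (4 * n) * ((n : ℝ) ^ (-(m + 1)) / 8)) ≤
      ∫⁻ t in Set.Ioo c (c + (n : ℝ) ^ (-(m + 1))), dipDensity z t := by
    intro h
    refine le_trans (ENNReal.ofReal_le_ofReal ?_)
      (le_lintegral_Ioo_of_le (C := 1 / n) (by positivity) le_rfl le_rfl fun t ht => ?_)
    · rw [add_sub_cancel_left]
      refine mul_le_mul (one_div_le_one_div_of_le (by linarith) (by linarith)) (by linarith)
        (by positivity) (by positivity)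
    · rw [hK t ⟨hlc.trans_lt ht.1, ht.2.trans_le hcm⟩]
      exact ENNReal.ofReal_le_ofReal (h t ht)
  rcases lt_or_ge K n with hKn | hKn
  · refine trivial_bound (lower fun t _ => le_trans ?_ (hz.inv_le_dip K t))
    have : (K : ℝ) + 1 ≤ n := by exact_mod_cast hKn
    exact one_div_le_one_div_of_le (by positivity) this
  obtain ⟨i, hi1, hi2⟩ := hz.near K n hn hKn
  have hside : (n : ℝ) ^ (-i) ≤ k * (n : ℝ) ^ (-m) ∨
      k * (n : ℝ) ^ (-m) + (n : ℝ) ^ (-m) ≤ (n : ℝ) ^ (-i) := by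
    rcases le_or_gt m i with hmi | hmi
    · left
      have : (n : ℝ) ^ (-i) ≤ (n : ℝ) ^ (-m) := zpow_le_zpow_right₀ (by linarith) (by linarith)
      nlinarith
    · obtain ⟨d, hd⟩ := Int.eq_ofNat_of_zero_le (sub_nonneg.2 hmi.le)
      have hq : (n : ℝ) ^ (-i) = ((n ^ d : ℕ) : ℤ) * (n : ℝ) ^ (-m) := by
        push_cast
        rw [← zpow_natCast, ← zpow_add₀ (by positivity)]; congr 1; omega
      rw [hq]
      rcases le_or_gt ((n ^ d : ℕ) : ℤ) k with h | h
      · left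
        exact mul_le_mul_of_nonneg_right (by exact_mod_cast h) hR.le
      · right
        have : ((k + 1 : ℤ) : ℝ) ≤ (((n ^ d : ℕ) : ℤ) : ℝ) := Int.cast_le.2 h
        push_cast at this ⊢
        nlinarith
  rcases hside with h | h
  · rw [setLIntegral_congr_fun measurableSet_Ioo hK, setLIntegral_congr_fun measurableSet_Ioo
      (fun t ht => hK t ⟨hlc.trans_lt ht.1, ht.2.trans_le hcm⟩)]
    rw [hnw] at hcm hlc h ⊢
    exact (dip_sqrtTame (hz.pos K) (dipDepth_pos K).le (dipDepth_le_one K)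
      (hi1.trans h)).lintegral_le_mul (hz.dip_nonneg K) hw (by linarith) hlc hcm
  · refine trivial_bound (lower fun t ht => ?_)
    rw [dip_of_le_one_add (hz.pos K) (dipDepth_pos K).le (by linarith [ht.2]),
      div_le_one (by linarith)]
    linarith

end IsDipSeq

theorem withDensity_Ico_eq_lintegral_Ioo (F : ℝ → ℝ≥0∞) (a b : ℝ) :
    (volume.withDensity F) (Set.Ico a b) = ∫⁻ t in Set.Ioo a b, F t := by
  rw [withDensity_apply _ measurableSet_Ico, setLIntegral_congr Ioo_ae_eq_Ico]

theorem nadicI_eq_Ico (n : ℕ) (m k : ℤ) :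
    nadicI n m k = Set.Ico ((k - 1 : ℤ) * (n : ℝ) ^ (-m))
      ((k - 1 : ℤ) * (n : ℝ) ^ (-m) + (n : ℝ) ^ (-m)) := by
  unfold nadicI
  rw [zpow_neg]
  congr 1 <;> push_cast <;> ring

/-- There exists a Borel measure on `[0,1)`, finite and positive on every
subinterval of positive length, that is `n`-adic doubling on `[0,1)` for every `n ≥ 2`
yet not doubling on `[0,1)`. -/
theorem exists_nadic_doubling_not_doubling_unitInterval :
    ∃ μ : Measure ℝ,
      (∀ x y : ℝ, 0 ≤ x → x < y → y ≤ 1 → 0 < μ (Set.Ico x y) ∧ μ (Set.Ico x y) < ⊤) ∧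
      (∀ n : ℕ, 2 ≤ n → ∃ C : ℝ, 0 < C ∧
        ∀ J₁ J₂ : Set ℝ, NAdicSiblings n J₁ J₂ → J₁ ⊆ Set.Ico 0 1 → J₂ ⊆ Set.Ico 0 1 →
          μ J₁ ≤ ENNReal.ofReal C * μ J₂) ∧
      (∀ C : ℝ, 0 < C → ∃ I₁ I₂ : Set ℝ, AdjacentPair I₁ I₂ ∧
        I₁ ⊆ Set.Ico 0 1 ∧ I₂ ⊆ Set.Ico 0 1 ∧ ENNReal.ofReal C * μ I₂ < μ I₁) := by
  obtain ⟨z, hz⟩ := exists_isDipSeq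
  refine ⟨volume.withDensity (dipDensity z), fun x y hx hxy hy => ?_, fun n hn => ?_,
    fun C hC => ?_⟩
  · rw [withDensity_Ico_eq_lintegral_Ioo]
    constructor
    · obtain ⟨K, hK⟩ := hz.exists_dipDensity_eq (a := (x + y) / 2) (b := y) (by linarith)
      refine lt_of_lt_of_le ?_ (le_lintegral_Ioo_of_le (C := 1 / ((K : ℝ) + 1))
        (a' := (x + y) / 2) (b' := y) (by positivity) (by linarith) le_rfl fun t ht => ?_)
      · rw [ENNReal.ofReal_pos]
        exact mul_pos (by positivity) (by linarith)
      · rw [hK t ht]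
        exact ENNReal.ofReal_le_ofReal (hz.inv_le_dip K t)
    · exact (lintegral_Ioo_le_of_le zero_le_one fun t _ => by
        simpa using dipDensity_le_one z t).trans_lt ENNReal.ofReal_lt_top
  · have hn2 : (2 : ℝ) ≤ n := by exact_mod_cast hn
    refine ⟨32 * (n : ℝ) ^ 2, by positivity, ?_⟩
    rintro _ _ ⟨m, k₁, k₂, k, rfl, rfl, h₁, h₂⟩ - h₂'
    have hw : 0 < (n : ℝ) ^ (-(m + 1)) := by positivity
    have hR : 0 < (n : ℝ) ^ (-m) := by positivity
    refine (measure_mono h₁).trans ?_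
    simp only [nadicI_eq_Ico] at h₂ h₂' ⊢
    obtain ⟨h3, h4⟩ := (Set.Ico_subset_Ico_iff (by linarith)).1 h₂
    obtain ⟨h5, -⟩ := (Set.Ico_subset_Ico_iff (by linarith)).1 h₂'
    have hk : 0 ≤ k - 1 := by
      have : (0 : ℝ) < ((k - 1 : ℤ) + 1) * (n : ℝ) ^ (-m) := by linarith
      have := pos_of_mul_pos_left this hR.le
      have : 0 < k - 1 + 1 := by exact_mod_cast this
      omega
    rw [withDensity_Ico_eq_lintegral_Ioo, withDensity_Ico_eq_lintegral_Ioo]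
    exact hz.lintegral_parent_le hn m (k - 1) hk h3 h4
  · obtain ⟨K, hK⟩ := exists_nat_gt (2 * C + 1)
    have hK1 : (1 : ℝ) ≤ K := by linarith
    set η := dipDepth K with hη
    have hη0 : 0 < η := dipDepth_pos K
    have hη1 : η ≤ 1 / 4 := by
      rw [hη, dipDepth, div_pow, one_pow]
      exact one_div_le_one_div_of_le (by norm_num) (by nlinarith)
    have hzK := hz.pos K
    have hzK' := hz.le_half K
    have hηz : 0 < η * z K := by positivity
    have hηz' : η * z K ≤ z K / 4 := by nlinarith
    have hsmall : (volume.withDensity (dipDensity z)) (Set.Ico (z K) (z K + η * z K)) ≤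
        ENNReal.ofReal (2 * √η * (η * z K)) := by
      rw [withDensity_Ico_eq_lintegral_Ioo]
      calc _ ≤ ∫⁻ t in Set.Ioo (z K) (z K + η * z K), ENNReal.ofReal (dip (z K) η t) :=
            lintegral_mono fun t => iInf_le _ K
        _ ≤ _ := (dip_sqrtTame hzK hη0.le (dipDepth_le_one K) le_rfl).lintegral_le (by linarith)
            (hz.dip_nonneg K _)
        _ ≤ _ := by
            refine ENNReal.ofReal_le_ofReal ?_
            rw [add_sub_cancel_left]
            have := dip_at_bottom hzK hη0
            gcongr
    have hlarge : ENNReal.ofReal (1 * (η * z K)) ≤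
        (volume.withDensity (dipDensity z)) (Set.Ico (z K - η * z K) (z K)) := by
      rw [withDensity_Ico_eq_lintegral_Ioo]
      have := le_lintegral_Ioo_of_le (F := dipDensity z) (a := z K - η * z K) (b := z K)
        zero_le_one le_rfl le_rfl fun t ht => le_iInf fun K' => by
          refine ENNReal.ofReal_le_ofReal (ge_of_eq ?_)
          rcases le_or_gt K' K with h | h
          · refine dip_of_le (ht.2.le.trans ?_)
            rcases h.eq_or_lt with rfl | h
            · exact le_rfl
            · linarith [hz.le_div_of_lt h, hz.pos K']
          · exact dip_of_two_mul_le (hz.pos K') (by linarith [hz.le_div_of_lt h, ht.1])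
      simpa using this
    refine ⟨Set.Ico (z K - η * z K) (z K), Set.Ico (z K) (z K + η * z K),
      ⟨z K, η * z K, hηz, Or.inl ⟨rfl, rfl⟩⟩, Set.Ico_subset_Ico (by linarith) (by linarith),
      Set.Ico_subset_Ico (by linarith) (by linarith), ?_⟩
    refine lt_of_lt_of_le (lt_of_le_of_lt (mul_le_mul_right hsmall _) ?_) hlarge
    rw [← ENNReal.ofReal_mul hC.le, ENNReal.ofReal_lt_ofReal_iff (by linarith), hη,
      sqrt_dipDepth, ← hη, ← mul_assoc]
    refine mul_lt_mul_of_pos_right ?_ hηz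
    rw [← mul_assoc, mul_one_div, div_lt_one (by positivity)]
    linarith
end

section
/- Let μ be a finite Borel measure on [0,1), positive on every interval of positive length contained in [0,1). Suppose there exist M > 0 and an infinite (unbounded) set S of integers n ≥ 2 such that for every n ∈ S, μ is n-adic doubling with constant M on [0,1). Then for any two intervals I₁, I₂ ⊆ [0,1) of equal positive length (not necessarily adjacent), μ(I₂) ≤ M·μ(I₁); in particular, μ is doubling on [0,1) with constant M. -/
open MeasureTheory Set
open scoped ENNReal

/-- The interval `[k/n, (k+1)/n)`. -/
def unitCell (n k : ℕ) : Set ℝ :=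
  Ico ((k : ℝ) / n) (((k + 1 : ℕ) : ℝ) / n)

lemma unitCell_eq_nadicI (n k : ℕ) : unitCell n k = nadicI n (0 + 1) (k + 1) := by
  simp [unitCell, nadicI]

lemma unitCell_subset_Ico {n k : ℕ} (hk : k < n) : unitCell n k ⊆ Ico 0 1 := by
  have hn : (0 : ℝ) < n := by exact_mod_cast (Nat.zero_le k).trans_lt hk
  refine Ico_subset_Ico (by positivity) ?_
  rw [div_le_one hn]
  exact_mod_cast hk

lemma nadicSiblings_unitCell {n j k : ℕ} (hj : j < n) (hk : k < n) :
    NAdicSiblings n (unitCell n j) (unitCell n k) := by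
  have h : nadicI n 0 1 = Ico 0 1 := by simp [nadicI]
  exact ⟨0, j + 1, k + 1, 1, unitCell_eq_nadicI n j, unitCell_eq_nadicI n k,
    h ▸ unitCell_subset_Ico hj, h ▸ unitCell_subset_Ico hk⟩

lemma unitCell_pairwise_disjoint (n : ℕ) : Pairwise (Function.onFun Disjoint (unitCell n)) := by
  have hmono : Monotone fun k : ℕ => (k : ℝ) / n := fun a b hab => by
    have : (a : ℝ) ≤ b := by exact_mod_cast hab
    dsimp only
    gcongr
  exact hmono.pairwise_disjoint_on_Ico_succ

/-- If all cells of the partition of `[0,1)` into `n` equal intervals have comparable measure,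
then so do a set covered by some of the cells and a set containing some of the cells. -/
lemma card_mul_measure_le {μ : Measure ℝ} {n : ℕ} {C : ℝ≥0∞}
    (h : ∀ j < n, ∀ k < n, μ (unitCell n j) ≤ C * μ (unitCell n k))
    {s t : Finset ℕ} (hs : ∀ k ∈ s, k < n) (ht : ∀ j ∈ t, j < n) {A B : Set ℝ}
    (hA : ∀ k ∈ s, unitCell n k ⊆ A) (hB : B ⊆ ⋃ j ∈ t, unitCell n j) :
    (s.card : ℝ≥0∞) * μ B ≤ t.card * (C * μ A) := by
  have hsum : ∑ k ∈ s, μ (unitCell n k) ≤ μ A := by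
    rw [← measure_biUnion_finset (fun i _ j _ hij => unitCell_pairwise_disjoint n hij)
      (fun _ _ => measurableSet_Ico)]
    exact measure_mono (iUnion₂_subset hA)
  calc (s.card : ℝ≥0∞) * μ B = ∑ k ∈ s, μ B := by rw [Finset.sum_const, nsmul_eq_mul]
    _ ≤ ∑ k ∈ s, t.card * (C * μ (unitCell n k)) := by
      refine Finset.sum_le_sum fun k hk => ?_
      calc μ B ≤ ∑ j ∈ t, μ (unitCell n j) :=
            (measure_mono hB).trans (measure_biUnion_finset_le _ _)
        _ ≤ ∑ j ∈ t, C * μ (unitCell n k) :=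
            Finset.sum_le_sum fun j hj => h j (ht j hj) k (hs k hk)
        _ = _ := by rw [Finset.sum_const, nsmul_eq_mul]
    _ = t.card * (C * ∑ k ∈ s, μ (unitCell n k)) := by simp only [Finset.mul_sum]
    _ ≤ _ := by gcongr

lemma unitCell_subset_of_mem_Ico {n k : ℕ} (hn : 0 < n) {x y : ℝ}
    (hk : k ∈ Finset.Ico ⌈n * x⌉₊ ⌊n * y⌋₊) : unitCell n k ⊆ Ico x y := by
  have hn' : (0 : ℝ) < n := by exact_mod_cast hn
  rw [Finset.mem_Ico] at hk
  refine Ico_subset_Ico ?_ ?_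
  · rw [le_div_iff₀ hn', mul_comm]
    exact Nat.ceil_le.1 hk.1
  · rw [div_le_iff₀ hn', mul_comm]
    exact (Nat.le_floor_iff' (Nat.succ_ne_zero k)).1 hk.2

lemma Ico_subset_iUnion_unitCell {n : ℕ} (hn : 0 < n) {x y : ℝ} (hx : 0 ≤ x) :
    Ico x y ⊆ ⋃ j ∈ Finset.Ico ⌊n * x⌋₊ ⌈n * y⌉₊, unitCell n j := by
  have hn' : (0 : ℝ) < n := by exact_mod_cast hn
  intro z hz
  have hz0 : 0 ≤ n * z := mul_nonneg hn'.le (hx.trans hz.1)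
  have hlt : n * z < n * y := by gcongr; exact hz.2
  refine mem_iUnion₂.2 ⟨⌊n * z⌋₊, Finset.mem_Ico.2 ⟨?_, ?_⟩, ?_, ?_⟩
  · exact Nat.floor_le_floor (by gcongr; exact hz.1)
  · exact Nat.lt_ceil.2 ((Nat.floor_le hz0).trans_lt hlt)
  · rw [div_le_iff₀ hn', mul_comm z]
    exact Nat.floor_le hz0
  · rw [lt_div_iff₀ hn', mul_comm z]
    exact_mod_cast Nat.lt_floor_add_one (n * z : ℝ)

lemma mul_measureReal_le {μ : Measure ℝ} (hfin : μ (Ico (0 : ℝ) 1) < ⊤) {n : ℕ} (hn : 0 < n)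
    {M : ℝ} (hM : 0 ≤ M)
    (h : ∀ j < n, ∀ k < n, μ (unitCell n j) ≤ ENNReal.ofReal M * μ (unitCell n k))
    {x₁ x₂ l : ℝ} (hl : 0 < l) (hx₁ : 0 ≤ x₁) (hy₁ : x₁ + l ≤ 1) (hx₂ : 0 ≤ x₂)
    (hy₂ : x₂ + l ≤ 1) :
    (n * l - 2) * μ.real (Ico x₂ (x₂ + l)) ≤ (n * l + 2) * (M * μ.real (Ico x₁ (x₁ + l))) := by
  have hn' : (0 : ℝ) < n := by exact_mod_cast hn
  have hle : ∀ y : ℝ, y ≤ 1 → n * y ≤ n := fun y hy => mul_le_of_le_one_right hn'.le hy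
  have key := card_mul_measure_le h (s := Finset.Ico ⌈n * x₁⌉₊ ⌊n * (x₁ + l)⌋₊)
    (t := Finset.Ico ⌊n * x₂⌋₊ ⌈n * (x₂ + l)⌉₊)
    (fun k hk => (Finset.mem_Ico.1 hk).2.trans_le (Nat.floor_le_of_le (hle _ hy₁)))
    (fun k hk => (Finset.mem_Ico.1 hk).2.trans_le (Nat.ceil_le.2 (hle _ hy₂)))
    (fun k hk => unitCell_subset_of_mem_Ico hn hk) (Ico_subset_iUnion_unitCell hn hx₂)
  have hA : μ (Ico x₁ (x₁ + l)) ≠ ⊤ := measure_ne_top_of_subset (Ico_subset_Ico hx₁ hy₁) hfin.ne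
  have key' := ENNReal.toReal_mono (by finiteness) key
  simp only [ENNReal.toReal_mul, ENNReal.toReal_natCast, ENNReal.toReal_ofReal hM,
    Nat.card_Ico] at key'
  refine le_trans ?_ (key'.trans ?_)
  · refine mul_le_mul_of_nonneg_right ?_ measureReal_nonneg
    have h1 := Nat.ceil_lt_add_one (mul_nonneg hn'.le hx₁)
    have h2 := Nat.lt_floor_add_one (n * (x₁ + l))
    have h3 : ((⌊n * (x₁ + l)⌋₊ : ℕ) : ℝ) ≤
        ((⌊n * (x₁ + l)⌋₊ - ⌈n * x₁⌉₊ : ℕ) : ℝ) + ⌈n * x₁⌉₊ := by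
      exact_mod_cast le_tsub_add
    linarith
  · refine mul_le_mul_of_nonneg_right ?_ (mul_nonneg hM measureReal_nonneg)
    have h1 := Nat.ceil_lt_add_one (mul_nonneg hn'.le (add_nonneg hx₂ hl.le))
    have h2 := Nat.lt_floor_add_one (n * x₂)
    have h3 : ⌊n * x₂⌋₊ ≤ ⌈n * (x₂ + l)⌉₊ :=
      (Nat.floor_le_ceil _).trans (Nat.ceil_le_ceil (by gcongr; linarith))
    rw [Nat.cast_sub h3]
    linarith

/-- A finite measure on `[0,1)`, positive on subintervals of positive length,
that is `n`-adic doubling with a uniform constant `M` for an infinite set of `n`, satisfies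
`μ(I₂) ≤ M·μ(I₁)` for any two subintervals of `[0,1)` of equal positive length. -/
theorem uniformly_nadic_doubling_implies_doubling_unitInterval
    (μ : Measure ℝ) (hfin : μ (Set.Ico (0:ℝ) 1) < ⊤)
    (hpos : ∀ x y : ℝ, 0 ≤ x → x < y → y ≤ 1 → 0 < μ (Set.Ico x y))
    (M : ℝ) (hM : 0 < M) (S : Set ℕ) (hS2 : ∀ n ∈ S, 2 ≤ n) (hSinf : S.Infinite)
    (hdoub : ∀ n ∈ S, ∀ J₁ J₂ : Set ℝ, NAdicSiblings n J₁ J₂ →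
      J₁ ⊆ Set.Ico 0 1 → J₂ ⊆ Set.Ico 0 1 → μ J₁ ≤ ENNReal.ofReal M * μ J₂) :
    ∀ x₁ x₂ l : ℝ, 0 < l → Set.Ico x₁ (x₁ + l) ⊆ Set.Ico (0:ℝ) 1 →
      Set.Ico x₂ (x₂ + l) ⊆ Set.Ico (0:ℝ) 1 →
      μ (Set.Ico x₂ (x₂ + l)) ≤ ENNReal.ofReal M * μ (Set.Ico x₁ (x₁ + l)) := by
  intro x₁ x₂ l hl h₁ h₂
  rw [Ico_subset_Ico_iff (by linarith)] at h₁ h₂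
  have hA := measure_ne_top_of_subset (Ico_subset_Ico h₁.1 h₁.2) hfin.ne
  have hB := measure_ne_top_of_subset (Ico_subset_Ico h₂.1 h₂.2) hfin.ne
  have hreal : μ.real (Ico x₂ (x₂ + l)) ≤ M * μ.real (Ico x₁ (x₁ + l)) := by
    set a := M * μ.real (Ico x₁ (x₁ + l))
    set b := μ.real (Ico x₂ (x₂ + l))
    by_contra! hab
    have hd : 0 < l * (b - a) := mul_pos hl (sub_pos.2 hab)
    obtain ⟨n, hnS, hn⟩ := hSinf.exists_gt ⌈(2 * b + 2 * a) / (l * (b - a))⌉₊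
    have hlt : 2 * b + 2 * a < n * (l * (b - a)) :=
      (div_lt_iff₀ hd).1 (Nat.lt_of_ceil_lt hn)
    have hle := mul_measureReal_le hfin (two_pos.trans_le (hS2 n hnS)) hM.le
      (fun j hj k hk => hdoub n hnS _ _ (nadicSiblings_unitCell hj hk)
        (unitCell_subset_Ico hj) (unitCell_subset_Ico hk)) hl h₁.1 h₁.2 h₂.1 h₂.2
    linarith
  rw [← ENNReal.toReal_le_toReal hB (by finiteness), ENNReal.toReal_mul,
    ENNReal.toReal_ofReal hM.le]
  exact hreal
end

section
/- Let μ be a Borel measure on ℝ, finite and positive on every bounded interval of positive length, with 0 < μ([−1,0)) < ∞ and 0 < μ([0,1)) < ∞. Suppose there exists M > 0 such that for every integer n ≥ 2, μ is n-adic doubling with constant M. Then μ is doubling: there exists C > 0 such that μ(I₁) ≤ C·μ(I₂) for every pair of adjacent intervals I₁, I₂ of equal positive length. -/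
open MeasureTheory Set
open scoped ENNReal

/-- The real mass of a half-open interval with endpoints on the grid `ℤ / n` is the sum of the
masses of the grid cells it contains. -/
lemma measureReal_Ico_grid (μ : Measure ℝ) [IsLocallyFiniteMeasure μ] {n : ℕ} (hn : 0 < n)
    (p : ℤ) (d : ℕ) :
    μ.real (Ico ((p : ℝ) / n) ((p + d) / n)) =
      ∑ i ∈ Finset.range d, μ.real (Ico ((p + i : ℝ) / n) ((p + i + 1) / n)) := by
  have hn' : (0 : ℝ) < n := by exact_mod_cast hn
  induction d with
  | zero => simp
  | succ d ih =>
    rw [Finset.sum_range_succ, ← ih, ← measureReal_union _ measurableSet_Ico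
      measure_Ico_lt_top.ne measure_Ico_lt_top.ne, Ico_union_Ico_eq_Ico]
    · push_cast
      rw [add_assoc]
    · gcongr
      simp
    · gcongr ?_ / _
      linarith
    · exact Set.disjoint_left.2 fun x hx hx' => absurd hx.2 (not_lt.2 hx'.1)

/-- If `n ≥ 2`, the grid cells of length `1 / n` in a common unit interval `[j, j + 1)` have
comparable mass, hence each has mass comparable to `1 / n` times that of `[j, j + 1)`. -/
lemma measureReal_cell_bounds {μ : Measure ℝ} [IsLocallyFiniteMeasure μ] {M : ℝ}
    (hdoub : ∀ n : ℕ, 2 ≤ n → ∀ J₁ J₂ : Set ℝ, NAdicSiblings n J₁ J₂ →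
      μ.real J₁ ≤ M * μ.real J₂) {n : ℕ} (hn : 2 ≤ n) (k : ℤ) :
    n * μ.real (Ico ((k : ℝ) / n) ((k + 1) / n)) ≤
        M * μ.real (Ico ((k / (n : ℤ) : ℤ) : ℝ) ((k / (n : ℤ) : ℤ) + 1)) ∧
      μ.real (Ico ((k / (n : ℤ) : ℤ) : ℝ) ((k / (n : ℤ) : ℤ) + 1)) ≤
        M * (n * μ.real (Ico ((k : ℝ) / n) ((k + 1) / n))) := by
  have hn0 : 0 < n := by omega
  have hn' : (0 : ℝ) < n := by exact_mod_cast hn0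
  set j : ℤ := k / (n : ℤ) with hj
  have hcell (l : ℤ) : nadicI n (0 + 1) (l + 1) = Ico ((l : ℝ) / n) ((l + 1) / n) := by
    simp [nadicI]
  have hsub (l : ℤ) (h1 : j * n ≤ l) (h2 : l + 1 ≤ (j + 1) * n) :
      nadicI n (0 + 1) (l + 1) ⊆ nadicI n 0 (j + 1) := by
    rw [hcell]
    have h1' : (j : ℝ) * n ≤ l := by exact_mod_cast h1
    have h2' : (l + 1 : ℝ) ≤ (j + 1) * n := by exact_mod_cast h2
    simp only [nadicI, zpow_zero, div_one]
    push_cast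
    rw [add_sub_cancel_right]
    exact Ico_subset_Ico ((le_div_iff₀ hn').2 h1') ((div_le_iff₀ hn').2 h2')
  have hk := hsub k (Int.ediv_mul_le _ (by omega))
    (Int.lt_ediv_add_one_mul_self k (by omega : (0 : ℤ) < n))
  have hi (i : ℕ) (hi : i ∈ Finset.range n) :
      nadicI n (0 + 1) (j * n + i + 1) ⊆ nadicI n 0 (j + 1) := by
    rw [Finset.mem_range] at hi
    refine hsub _ (by omega) ?_
    rw [add_mul]
    omega
  have hsum := measureReal_Ico_grid μ hn0 (j * n) n
  have hl : (((j * n : ℤ) : ℝ) / n) = j := by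
    push_cast
    field_simp
  have hr : (((j * n : ℤ) : ℝ) + n) / n = j + 1 := by
    push_cast
    field_simp
  rw [hl, hr] at hsum
  have hcell' (i : ℕ) : Ico ((((j * n : ℤ) : ℝ) + i) / n) ((((j * n : ℤ) : ℝ) + i + 1) / n) =
      nadicI n (0 + 1) (j * n + i + 1) := by
    rw [hcell]
    push_cast
    rfl
  simp_rw [hcell'] at hsum
  rw [hsum, ← hcell, Finset.mul_sum]
  constructor
  · simpa using Finset.card_nsmul_le_sum (Finset.range n) _ _
      fun i hmem => hdoub n hn _ _ ⟨0, _, _, _, rfl, rfl, hk, hi i hmem⟩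
  · rw [mul_left_comm]
    simpa using Finset.sum_le_card_nsmul (Finset.range n) _ _
      fun i hmem => hdoub n hn _ _ ⟨0, _, _, _, rfl, rfl, hi i hmem, hk⟩

/-- Unit intervals on the same side of the origin have comparable mass. -/
lemma measureReal_unit_le {μ : Measure ℝ} {M : ℝ}
    (hdoub : ∀ n : ℕ, 2 ≤ n → ∀ J₁ J₂ : Set ℝ, NAdicSiblings n J₁ J₂ →
      μ.real J₁ ≤ M * μ.real J₂) (j k : ℤ) (hjk : 0 ≤ j ∧ 0 ≤ k ∨ j < 0 ∧ k < 0) :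
    μ.real (Ico (j : ℝ) (j + 1)) ≤ M * μ.real (Ico (k : ℝ) (k + 1)) := by
  obtain ⟨n, hn⟩ : ∃ n : ℕ, n = j.natAbs + k.natAbs + 2 := ⟨_, rfl⟩
  have hunit (l : ℤ) : Ico (l : ℝ) (l + 1) = nadicI n (-1 + 1) (l + 1) := by
    simp [nadicI]
  refine hdoub n (by omega) _ _ ?_
  rcases hjk with ⟨hj, hk⟩ | ⟨hj, hk⟩
  · have hsub (l : ℤ) (h1 : 0 ≤ l) (h2 : l + 1 ≤ n) : Ico (l : ℝ) (l + 1) ⊆ nadicI n (-1) 1 := by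
      simp only [nadicI, zpow_neg, zpow_one, div_inv_eq_mul]
      refine Ico_subset_Ico ?_ ?_
      · simpa using h1
      · push_cast
        rw [one_mul]
        exact_mod_cast h2
    exact ⟨-1, _, _, 1, hunit j, hunit k, hsub j hj (by omega), hsub k hk (by omega)⟩
  · have hsub (l : ℤ) (h1 : l < 0) (h2 : -n ≤ l) : Ico (l : ℝ) (l + 1) ⊆ nadicI n (-1) 0 := by
      simp only [nadicI, zpow_neg, zpow_one, div_inv_eq_mul]
      refine Ico_subset_Ico ?_ ?_
      · push_cast
        rw [zero_sub, neg_one_mul]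
        exact_mod_cast h2
      · simp only [Int.cast_zero, zero_mul]
        exact_mod_cast h1
    exact ⟨-1, _, _, 0, hunit j, hunit k, hsub j hj (by omega), hsub k hk (by omega)⟩

/-- A measure whose grid cells of length `1 / n` have mass between `A / n` and `B / n` for all
`n ≥ 2` is comparable to Lebesgue measure on all intervals. -/
lemma measureReal_Ico_bounds {μ : Measure ℝ} [IsLocallyFiniteMeasure μ] {A B : ℝ} (hA : 0 ≤ A)
    (hB : 0 ≤ B)
    (hcell : ∀ n : ℕ, 2 ≤ n → ∀ k : ℤ, A / n ≤ μ.real (Ico ((k : ℝ) / n) ((k + 1) / n)) ∧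
      μ.real (Ico ((k : ℝ) / n) ((k + 1) / n)) ≤ B / n) (x : ℝ) {l : ℝ} (hl : 0 < l) :
    A * (l / 2) ≤ μ.real (Ico x (x + l)) ∧ μ.real (Ico x (x + l)) ≤ B * (2 * l) := by
  obtain ⟨n, hn⟩ := exists_nat_ge (max 2 (4 / l))
  have hn2 : 2 ≤ n := by exact_mod_cast (le_max_left _ _).trans hn
  have hn' : (0 : ℝ) < n := by exact_mod_cast (show 0 < n by omega)
  have hnl : 4 ≤ n * l := (div_le_iff₀ hl).1 ((le_max_right _ _).trans hn)
  have hgrid (p : ℤ) (d : ℕ) : d * (A / n) ≤ μ.real (Ico ((p : ℝ) / n) ((p + d) / n)) ∧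
      μ.real (Ico ((p : ℝ) / n) ((p + d) / n)) ≤ d * (B / n) := by
    rw [measureReal_Ico_grid μ (by omega)]
    have h (i : ℕ) := hcell n hn2 (p + i)
    push_cast at h
    constructor
    · simpa using Finset.card_nsmul_le_sum (Finset.range d) _ _ fun i _ => (h i).1
    · simpa using Finset.sum_le_card_nsmul (Finset.range d) _ _ fun i _ => (h i).2
  constructor
  · have hp := Int.ceil_lt_add_one (x * n)
    have hp' := Int.le_ceil (x * n)
    have hq := Int.lt_floor_add_one ((x + l) * n)
    have hq' := Int.floor_le ((x + l) * n)
    set p := ⌈x * n⌉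
    set q := ⌊(x + l) * n⌋
    have hpq : p ≤ q := by
      have : (p : ℝ) ≤ q := by nlinarith
      exact_mod_cast this
    obtain ⟨d, hd⟩ := Int.eq_ofNat_of_zero_le (sub_nonneg.2 hpq)
    have hd' : (q : ℝ) = p + d := by
      have : q = p + d := by omega
      exact_mod_cast this
    calc A * (l / 2) ≤ A * (d / n) := by
          refine mul_le_mul_of_nonneg_left ?_ hA
          rw [le_div_iff₀ hn']
          nlinarith
      _ = d * (A / n) := by ring
      _ ≤ _ := (hgrid p d).1
      _ ≤ _ := by
          refine measureReal_mono (Ico_subset_Ico ?_ ?_) measure_Ico_lt_top.ne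
          · rwa [le_div_iff₀ hn']
          · rwa [div_le_iff₀ hn', ← hd']
  · have hp := Int.lt_floor_add_one (x * n)
    have hp' := Int.floor_le (x * n)
    have hq := Int.ceil_lt_add_one ((x + l) * n)
    have hq' := Int.le_ceil ((x + l) * n)
    set p := ⌊x * n⌋
    set q := ⌈(x + l) * n⌉
    have hpq : p ≤ q := by
      have : (p : ℝ) ≤ q := by nlinarith
      exact_mod_cast this
    obtain ⟨d, hd⟩ := Int.eq_ofNat_of_zero_le (sub_nonneg.2 hpq)
    have hd' : (q : ℝ) = p + d := by
      have : q = p + d := by omega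
      exact_mod_cast this
    calc μ.real (Ico x (x + l)) ≤ μ.real (Ico ((p : ℝ) / n) ((p + d) / n)) := by
          refine measureReal_mono (Ico_subset_Ico ?_ ?_) measure_Ico_lt_top.ne
          · rwa [div_le_iff₀ hn']
          · rwa [le_div_iff₀ hn', ← hd']
      _ ≤ d * (B / n) := (hgrid p d).2
      _ = B * (d / n) := by ring
      _ ≤ B * (2 * l) := by
          gcongr
          rw [div_le_iff₀ hn']
          nlinarith

/-- A measure on `ℝ`, finite and positive on bounded intervals of positive
length, with `0 < μ([-1,0)) < ∞` and `0 < μ([0,1)) < ∞`, that is `n`-adic doubling with a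
uniform constant `M` for every `n ≥ 2`, is doubling. -/
theorem uniformly_nadic_doubling_implies_doubling_real
    (μ : Measure ℝ)
    (hfin : ∀ x y : ℝ, x < y → 0 < μ (Set.Ico x y) ∧ μ (Set.Ico x y) < ⊤)
    (h1 : 0 < μ (Set.Ico (-1:ℝ) 0)) (h1' : μ (Set.Ico (-1:ℝ) 0) < ⊤)
    (h2 : 0 < μ (Set.Ico (0:ℝ) 1)) (h2' : μ (Set.Ico (0:ℝ) 1) < ⊤)
    (M : ℝ) (hM : 0 < M)
    (hdoub : ∀ n : ℕ, 2 ≤ n → ∀ J₁ J₂ : Set ℝ, NAdicSiblings n J₁ J₂ →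
      μ J₁ ≤ ENNReal.ofReal M * μ J₂) :
    ∃ C : ℝ, 0 < C ∧ ∀ I₁ I₂ : Set ℝ, AdjacentPair I₁ I₂ →
      μ I₁ ≤ ENNReal.ofReal C * μ I₂ := by
  have : IsLocallyFiniteMeasure μ := ⟨fun x => ⟨Ico (x - 1) (x + 1),
    Ico_mem_nhds (by linarith) (by linarith), (hfin _ _ (by linarith)).2⟩⟩
  have hreal (n : ℕ) (hn : 2 ≤ n) (J₁ J₂ : Set ℝ) (h : NAdicSiblings n J₁ J₂) :
      μ.real J₁ ≤ M * μ.real J₂ := by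
    have hJ : μ J₂ ≠ ⊤ := by
      obtain ⟨m, k₁, k₂, k, -, rfl, -, -⟩ := h
      exact measure_Ico_lt_top.ne
    have := ENNReal.toReal_mono (ENNReal.mul_ne_top ENNReal.ofReal_ne_top hJ) (hdoub n hn _ _ h)
    rwa [ENNReal.toReal_mul, ENNReal.toReal_ofReal hM.le] at this
  have hneg : 0 < μ.real (Ico (-1 : ℝ) 0) := ENNReal.toReal_pos h1.ne' h1'.ne
  have hpos : 0 < μ.real (Ico (0 : ℝ) 1) := ENNReal.toReal_pos h2.ne' h2'.ne
  set a := μ.real (Ico (-1 : ℝ) 0) with ha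
  set b := μ.real (Ico (0 : ℝ) 1) with hb
  have hunit (j : ℤ) : min a b ≤ M * μ.real (Ico (j : ℝ) (j + 1)) ∧
      μ.real (Ico (j : ℝ) (j + 1)) ≤ M * max a b := by
    rcases lt_or_ge j 0 with hj | hj
    · have h := measureReal_unit_le hreal j (-1) (Or.inr ⟨hj, by norm_num⟩)
      have h' := measureReal_unit_le hreal (-1) j (Or.inr ⟨by norm_num, hj⟩)
      norm_num [← ha] at h h'
      exact ⟨(min_le_left _ _).trans h', h.trans (by gcongr; exact le_max_left _ _)⟩
    · have h := measureReal_unit_le hreal j 0 (Or.inl ⟨hj, le_rfl⟩)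
      have h' := measureReal_unit_le hreal 0 j (Or.inl ⟨le_rfl, hj⟩)
      norm_num [← hb] at h h'
      exact ⟨(min_le_right _ _).trans h', h.trans (by gcongr; exact le_max_right _ _)⟩
  have hmin : 0 < min a b := lt_min hneg hpos
  have hmax : 0 < max a b := lt_max_of_lt_left hneg
  obtain ⟨A, hA⟩ : ∃ A, A = min a b / M ^ 2 := ⟨_, rfl⟩
  obtain ⟨B, hB⟩ : ∃ B, B = M ^ 2 * max a b := ⟨_, rfl⟩
  have hA0 : 0 < A := by rw [hA]; positivity
  have hB0 : 0 < B := by rw [hB]; positivity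
  have hcell (n : ℕ) (hn : 2 ≤ n) (k : ℤ) :
      A / n ≤ μ.real (Ico ((k : ℝ) / n) ((k + 1) / n)) ∧
        μ.real (Ico ((k : ℝ) / n) ((k + 1) / n)) ≤ B / n := by
    have hn' : (0 : ℝ) < n := by exact_mod_cast (show 0 < n by omega)
    obtain ⟨h3, h4⟩ := measureReal_cell_bounds hreal hn k
    obtain ⟨h5, h6⟩ := hunit (k / (n : ℤ))
    constructor
    · rw [div_le_iff₀' hn', hA, div_le_iff₀' (by positivity)]
      calc min a b ≤ _ := h5
        _ ≤ M * (M * _) := mul_le_mul_of_nonneg_left h4 hM.le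
        _ = _ := by ring
    · rw [le_div_iff₀' hn', hB]
      calc _ ≤ _ := h3
        _ ≤ M * (M * max a b) := mul_le_mul_of_nonneg_left h6 hM.le
        _ = _ := by ring
  have hlen (x : ℝ) {l : ℝ} (hl : 0 < l) := measureReal_Ico_bounds hA0.le hB0.le hcell x hl
  have hcomp (x y l : ℝ) (hl : 0 < l) :
      μ (Ico x (x + l)) ≤ ENNReal.ofReal (4 * B / A) * μ (Ico y (y + l)) := by
    rw [← ENNReal.toReal_le_toReal measure_Ico_lt_top.ne
      (ENNReal.mul_ne_top ENNReal.ofReal_ne_top measure_Ico_lt_top.ne), ENNReal.toReal_mul,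
      ENNReal.toReal_ofReal (by positivity)]
    calc μ.real (Ico x (x + l)) ≤ B * (2 * l) := (hlen x hl).2
      _ = 4 * B / A * (A * (l / 2)) := by field_simp; norm_num
      _ ≤ 4 * B / A * μ.real (Ico y (y + l)) := by
          gcongr
          exact (hlen y hl).1
  refine ⟨4 * B / A, by positivity, ?_⟩
  rintro I₁ I₂ ⟨x, l, hl, ⟨rfl, rfl⟩ | ⟨rfl, rfl⟩⟩
  · simpa using hcomp (x - l) x l hl
  · simpa using hcomp x (x - l) l hl
end

section
/- Let μ be a finite Borel measure on [0,1) with μ([0,1)) > 0. Suppose there exist M > 0 and an infinite (unbounded) set S of integers n ≥ 2 such that for every n ∈ S, μ is n-adic doubling with constant M on [0,1). Then μ is absolutely continuous with respect to Lebesgue measure on [0,1), and its density f satisfies essSup f ≤ M · essInf f on [0,1); in particular f is essentially bounded above and essentially bounded away from zero. -/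
open MeasureTheory Set
open scoped ENNReal

open Filter Topology Metric

lemma nadicI_one (n : ℕ) (k : ℤ) : nadicI n 1 k = Ico ((k - 1 : ℝ) / n) (k / n) := by
  simp [nadicI]

lemma nadicI_zero_one (n : ℕ) : nadicI n 0 1 = Ico 0 1 := by
  simp [nadicI]

lemma nadicI_one_subset {n : ℕ} (hn : 0 < n) {k : ℤ} (hk : k ∈ Finset.Icc 1 (n : ℤ)) :
    nadicI n 1 k ⊆ Ico 0 1 := by
  obtain ⟨h1, h2⟩ := Finset.mem_Icc.1 hk
  have h1' : (1 : ℝ) ≤ k := by exact_mod_cast h1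
  have h2' : (k : ℝ) ≤ n := by exact_mod_cast h2
  rw [nadicI_one]
  refine Ico_subset_Ico (div_nonneg (by linarith) (by positivity)) ?_
  exact div_le_one_of_le₀ h2' (by positivity)

lemma mem_nadicI_one_iff {n : ℕ} (hn : 0 < n) {k : ℤ} {y : ℝ} :
    y ∈ nadicI n 1 k ↔ ⌊n * y⌋ = k - 1 := by
  have hn' : (0 : ℝ) < n := by exact_mod_cast hn
  rw [nadicI_one, mem_Ico, div_le_iff₀ hn', lt_div_iff₀ hn', Int.floor_eq_iff, mul_comm y]
  push_cast
  rw [sub_add_cancel]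

lemma volume_nadicI_one {n : ℕ} (hn : 0 < n) (k : ℤ) : n * volume (nadicI n 1 k) = 1 := by
  have hn' : (0 : ℝ) < n := by exact_mod_cast hn
  have h : (k : ℝ) / n - (k - 1) / n = (n : ℝ)⁻¹ := by field_simp; ring
  rw [nadicI_one, Real.volume_Ico, h, ENNReal.ofReal_inv_of_pos hn', ENNReal.ofReal_natCast,
    ENNReal.mul_inv_cancel (by simpa using hn.ne') (by simp)]

lemma nAdicSiblings_one {n : ℕ} (hn : 0 < n) {i j : ℤ} (hi : i ∈ Finset.Icc 1 (n : ℤ))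
    (hj : j ∈ Finset.Icc 1 (n : ℤ)) : NAdicSiblings n (nadicI n 1 i) (nadicI n 1 j) :=
  ⟨0, i, j, 1, by simp, by simp, by simpa [nadicI_zero_one] using nadicI_one_subset hn hi,
    by simpa [nadicI_zero_one] using nadicI_one_subset hn hj⟩

/-- A comparison of two measures on the grid of mesh `1 / n` passes to balls,
up to enlarging the radius by the mesh. -/
lemma restrict_closedBall_le_of_nadicI_le {n : ℕ} (hn : 0 < n) {ρ ν : Measure ℝ}
    (h : ∀ k ∈ Finset.Icc 1 (n : ℤ), ρ (nadicI n 1 k) ≤ ν (nadicI n 1 k)) (x r : ℝ) :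
    ρ.restrict (Ico 0 1) (closedBall x r) ≤
      ν.restrict (Ico 0 1) (closedBall x (r + (n : ℝ)⁻¹)) := by
  classical
  have hn' : (0 : ℝ) < n := by exact_mod_cast hn
  rw [Measure.restrict_apply measurableSet_closedBall,
    Measure.restrict_apply measurableSet_closedBall]
  set T := {k ∈ Finset.Icc 1 (n : ℤ) | (nadicI n 1 k ∩ closedBall x r).Nonempty} with hT
  calc
    ρ (closedBall x r ∩ Ico 0 1) ≤ ρ (⋃ k ∈ T, nadicI n 1 k) := by
      refine measure_mono fun y hy ↦ ?_
      obtain ⟨hyb, hy0, hy1⟩ := hy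
      have hmem : y ∈ nadicI n 1 (⌊n * y⌋ + 1) := by simp [mem_nadicI_one_iff hn]
      have h0 : 0 ≤ ⌊n * y⌋ := Int.floor_nonneg.2 (by positivity)
      have h1 : ⌊n * y⌋ < n := Int.floor_lt.2 (by push_cast; nlinarith)
      refine mem_biUnion (x := ⌊n * y⌋ + 1) ?_ hmem
      simp only [hT, Finset.coe_filter, mem_ofPred_eq, Finset.mem_Icc]
      exact ⟨by omega, y, hmem, hyb⟩
    _ ≤ ∑ k ∈ T, ρ (nadicI n 1 k) := measure_biUnion_finset_le _ _
    _ ≤ ∑ k ∈ T, ν (nadicI n 1 k) :=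
      Finset.sum_le_sum fun k hk ↦ h k (Finset.mem_filter.1 hk).1
    _ = ν (⋃ k ∈ T, nadicI n 1 k) := by
      refine (measure_biUnion_finset ?_ fun k _ ↦ by
        rw [nadicI_one]; exact measurableSet_Ico).symm
      intro i _ j _ hij
      refine Set.disjoint_left.2 fun y hi hj ↦ hij ?_
      rw [mem_nadicI_one_iff hn] at hi hj
      omega
    _ ≤ _ := by
      refine measure_mono (iUnion₂_subset fun k hk y hy ↦ ?_)
      obtain ⟨hk, z, hz, hzx⟩ := Finset.mem_filter.1 hk
      refine ⟨?_, nadicI_one_subset hn hk hy⟩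
      rw [nadicI_one] at hy hz
      have hlen : (k : ℝ) / n = (k - 1) / n + (n : ℝ)⁻¹ := by field_simp; ring
      rw [hlen] at hy hz
      rw [mem_closedBall, Real.dist_eq, abs_le] at hzx ⊢
      constructor <;> linarith [hy.1, hy.2, hz.1, hz.2, hzx.1, hzx.2]

/-- By the Besicovitch covering theorem, measures are compared by their values on balls. -/
lemma measure_le_of_closedBall_le {ρ ν : Measure ℝ} [SFinite ρ] [IsLocallyFiniteMeasure ν]
    (h : ∀ x r, 0 < r → ρ (closedBall x r) ≤ ν (closedBall x r)) : ρ ≤ ν := by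
  refine Measure.le_iff'.2 fun s ↦ (Besicovitch.vitaliFamily ρ).measure_le_of_frequently_le ν
    Measure.AbsolutelyContinuous.rfl s fun x _ ↦ ?_
  refine (VitaliFamily.frequently_filterAt_iff _).2 fun ε hε ↦ ?_
  exact ⟨closedBall x ε, mem_image_of_mem _ hε, Subset.rfl, h x ε hε⟩

lemma tendsto_measure_closedBall_add (ν : Measure ℝ) [IsFiniteMeasure ν] (x : ℝ) {r : ℝ}
    (hr : 0 < r) {u : ℕ → ℝ} (hu : Tendsto u atTop (𝓝 0)) (hu0 : ∀ i, 0 ≤ u i) :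
    Tendsto (fun i ↦ ν (closedBall x (r + u i))) atTop (𝓝 (ν (closedBall x r))) := by
  have h := (tendsto_measure_cthickening_of_isClosed (μ := ν) (s := closedBall x r)
    ⟨1, one_pos, measure_ne_top _ _⟩ isClosed_closedBall).comp hu
  refine h.congr fun i ↦ ?_
  simp [cthickening_closedBall (hu0 i) hr.le, add_comm]

/-- If for infinitely many `n` the averages of `μ` over the cells of mesh `1 / n` all agree up to
the factor `C`, then `μ` is comparable to a multiple of Lebesgue measure with constant `C`. -/
lemma exists_smul_volume_le_le (μ : Measure ℝ) (hfin : μ (Ico 0 1) < ⊤) (C : ℝ≥0∞) (hC : C ≠ ⊤)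
    (S : Set ℕ) (hS : ∀ n ∈ S, 0 < n) (hSinf : S.Infinite)
    (h : ∀ n ∈ S, ∀ i ∈ Finset.Icc 1 (n : ℤ), ∀ j ∈ Finset.Icc 1 (n : ℤ),
      μ (nadicI n 1 i) ≤ C * μ (nadicI n 1 j)) :
    ∃ a : ℝ≥0∞, a ≠ ⊤ ∧
      a • volume.restrict (Ico (0 : ℝ) 1) ≤ μ.restrict (Ico 0 1) ∧
      μ.restrict (Ico 0 1) ≤ (C * a) • volume.restrict (Ico (0 : ℝ) 1) := by
  have : IsFiniteMeasure (μ.restrict (Ico 0 1)) := ⟨by simpa using hfin⟩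
  have hgrid : ∀ n ∈ S, ∃ a : ℝ≥0∞, ∀ k ∈ Finset.Icc 1 (n : ℤ),
      (a • volume) (nadicI n 1 k) ≤ μ (nadicI n 1 k) ∧
      μ (nadicI n 1 k) ≤ ((C * a) • volume) (nadicI n 1 k) := by
    intro n hn
    obtain ⟨j, hj, hmin⟩ := (Finset.Icc 1 (n : ℤ)).exists_min_image (fun k ↦ μ (nadicI n 1 k))
      ⟨1, by have := hS n hn; simp; omega⟩
    have hvol : ∀ k, μ (nadicI n 1 j) * n * volume (nadicI n 1 k) = μ (nadicI n 1 j) := fun k ↦ by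
      rw [mul_assoc, volume_nadicI_one (hS n hn), mul_one]
    refine ⟨μ (nadicI n 1 j) * n, fun k hk ↦ ?_⟩
    simp only [Measure.smul_apply, smul_eq_mul, mul_assoc C, hvol]
    exact ⟨hmin k hk, h n hn k hk j hj⟩
  have hmem : ∀ i, Nat.nth (· ∈ S) i ∈ S := fun i ↦ Nat.nth_mem_of_infinite hSinf i
  choose b hb using fun i ↦ hgrid _ (hmem i)
  obtain ⟨a, φ, hφ, hlim⟩ := CompactSpace.tendsto_subseq b
  have hu : Tendsto (fun i ↦ ((Nat.nth (· ∈ S) (φ i) : ℕ) : ℝ)⁻¹) atTop (𝓝 0) :=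
    tendsto_inv_atTop_zero.comp (tendsto_natCast_atTop_atTop.comp
      ((Nat.nth_strictMono hSinf).comp hφ).tendsto_atTop)
  have hu0 : ∀ i, 0 ≤ ((Nat.nth (· ∈ S) (φ i) : ℕ) : ℝ)⁻¹ := fun i ↦ by positivity
  have hlower := fun i ↦ restrict_closedBall_le_of_nadicI_le (hS _ (hmem (φ i)))
    fun k hk ↦ (hb (φ i) k hk).1
  have hupper := fun i ↦ restrict_closedBall_le_of_nadicI_le (hS _ (hmem (φ i)))
    fun k hk ↦ (hb (φ i) k hk).2
  simp only [Measure.restrict_smul, Measure.smul_apply, smul_eq_mul] at hlower hupper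
  have ha : a ≠ ⊤ := by
    refine ne_top_of_le_ne_top hfin.ne (le_of_tendsto hlim (Eventually.of_forall fun i ↦ ?_))
    have hball : volume.restrict (Ico (0 : ℝ) 1) (closedBall 0 1) = 1 := by
      rw [Measure.restrict_apply measurableSet_closedBall, inter_eq_right.2]
      · simp
      · rw [Real.closedBall_eq_Icc]
        exact Ico_subset_Icc_self.trans (Icc_subset_Icc (by norm_num) (by norm_num))
    have := (hlower i 0 1).trans (measure_mono (subset_univ _))
    simpa [hball] using this
  have := Measure.smul_finite (volume.restrict (Ico (0 : ℝ) 1)) ha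
  have := Measure.smul_finite (volume.restrict (Ico (0 : ℝ) 1)) (ENNReal.mul_ne_top hC ha)
  refine ⟨a, ha, measure_le_of_closedBall_le fun x r hr ↦ ?_,
    measure_le_of_closedBall_le fun x r hr ↦ ?_⟩
  · exact le_of_tendsto_of_tendsto' (ENNReal.Tendsto.mul_const hlim (Or.inr (measure_ne_top _ _)))
      (tendsto_measure_closedBall_add _ x hr hu hu0) fun i ↦ hlower i x r
  · refine ge_of_tendsto' (ENNReal.Tendsto.mul (ENNReal.Tendsto.const_mul hlim (Or.inr hC))
      (Or.inr (measure_ne_top _ _)) (tendsto_measure_closedBall_add _ x hr hu hu0)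
      (Or.inr (ENNReal.mul_ne_top hC ha))) fun i ↦ hupper i x r

/-- A finite positive measure on `[0,1)` that is `n`-adic doubling with a
uniform constant `M` for an infinite set of `n` is absolutely continuous with respect to
Lebesgue measure, with density `f` satisfying `essSup f ≤ M · essInf f`; in particular `f`
is essentially bounded above and away from zero. -/
theorem uniformly_nadic_doubling_absolutely_continuous
    (μ : Measure ℝ) (hfin : μ (Set.Ico (0:ℝ) 1) < ⊤) (hpos : 0 < μ (Set.Ico (0:ℝ) 1))
    (M : ℝ) (hM : 0 < M) (S : Set ℕ) (hS2 : ∀ n ∈ S, 2 ≤ n) (hSinf : S.Infinite)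
    (hdoub : ∀ n ∈ S, ∀ J₁ J₂ : Set ℝ, NAdicSiblings n J₁ J₂ →
      J₁ ⊆ Set.Ico 0 1 → J₂ ⊆ Set.Ico 0 1 → μ J₁ ≤ ENNReal.ofReal M * μ J₂) :
    μ.restrict (Set.Ico 0 1) ≪ volume.restrict (Set.Ico 0 1) ∧
    ∃ f : ℝ → ℝ≥0∞, Measurable f ∧
      μ.restrict (Set.Ico 0 1) = (volume.restrict (Set.Ico 0 1)).withDensity f ∧
      essSup f (volume.restrict (Set.Ico 0 1)) ≤
        ENNReal.ofReal M * essInf f (volume.restrict (Set.Ico 0 1)) ∧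
      0 < essInf f (volume.restrict (Set.Ico 0 1)) ∧
      essSup f (volume.restrict (Set.Ico 0 1)) < ⊤ := by
  obtain ⟨a, ha, hlower, hupper⟩ := exists_smul_volume_le_le μ hfin _ ENNReal.ofReal_ne_top S
    (fun n hn ↦ two_pos.trans_le (hS2 n hn)) hSinf fun n hn i hi j hj ↦
      have hn0 : 0 < n := two_pos.trans_le (hS2 n hn)
      hdoub n hn _ _ (nAdicSiblings_one hn0 hi hj) (nadicI_one_subset hn0 hi)
        (nadicI_one_subset hn0 hj)
  have : IsFiniteMeasure (μ.restrict (Ico 0 1)) := ⟨by simpa using hfin⟩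
  have hac : μ.restrict (Ico 0 1) ≪ volume.restrict (Ico 0 1) :=
    (Measure.absolutelyContinuous_of_le hupper).trans Measure.smul_absolutelyContinuous
  set f := (μ.restrict (Ico 0 1)).rnDeriv (volume.restrict (Ico 0 1)) with hf
  have hfm : Measurable f := Measure.measurable_rnDeriv _ _
  have hd : (volume.restrict (Ico 0 1)).withDensity f = μ.restrict (Ico 0 1) :=
    Measure.withDensity_rnDeriv_eq _ _ hac
  have hsup : essSup f (volume.restrict (Ico 0 1)) ≤ ENNReal.ofReal M * a := by
    refine essSup_le_of_ae_le _ (ae_le_of_forall_setLIntegral_le_of_sigmaFinite hfm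
      fun s hs _ ↦ ?_)
    rw [← withDensity_apply _ hs, hd, setLIntegral_const]
    exact hupper s
  have hinf : a ≤ essInf f (volume.restrict (Ico 0 1)) := by
    refine le_essInf_of_ae_le _ (ae_le_of_forall_setLIntegral_le_of_sigmaFinite measurable_const
      fun s hs _ ↦ ?_)
    rw [← withDensity_apply f hs, hd, setLIntegral_const]
    exact hlower s
  have ha0 : 0 < a := by
    refine pos_of_ne_zero fun h0 ↦ hpos.ne' ?_
    simpa [h0] using hupper univ
  exact ⟨hac, f, hfm, hd.symm, hsup.trans (by gcongr), ha0.trans_le hinf,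
    hsup.trans_lt (ENNReal.mul_lt_top ENNReal.ofReal_lt_top ha.lt_top)⟩
end

section
/- Let n₁, …, n_k be integers with n_i ≥ 2 for each i, let α ≥ 1 be a natural number, and set ε = 2^{−100α}. Then there exist infinitely many x ∈ ℕ such that for every 1 ≤ i ≤ k, |1/2^x − 1/n_i^{[x·log_{n_i} 2]}| < ε/2^x, where [t] denotes a nearest integer to the real number t. -/
open Real

open Filter Topology in
/-- Simultaneous homogeneous Diophantine approximation: the multiples of a real vector return
arbitrarily close to the integer lattice for arbitrarily large multipliers. -/
theorem frequently_forall_abs_sub_round_lt {ι : Type*} [Finite ι] (v : ι → ℝ) {δ : ℝ}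
    (hδ : 0 < δ) :
    ∃ᶠ x : ℕ in atTop, ∀ i, |(x : ℝ) * v i - round ((x : ℝ) * v i)| < δ := by
  have hU : ∀ᶠ w : ι → UnitAddCircle in 𝓝 0, ∀ i, ‖w i‖ < δ := by
    rw [eventually_all]
    intro i
    have hc : Continuous fun w : ι → UnitAddCircle => ‖w i‖ := by fun_prop
    exact hc.continuousAt.eventually_lt continuousAt_const (by simpa using hδ)
  have h := (mapClusterPt_zero_atTop_nsmul fun i => (v i : UnitAddCircle)).frequently hU
  refine h.mono fun x hx i => ?_
  have := hx i
  rwa [Pi.smul_apply, ← AddCircle.coe_nsmul, UnitAddCircle.norm_eq, nsmul_eq_mul] at this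

/-- Write `2 ^ x` as a real power of `n`: the error in replacing it by an integral power `n ^ m` is
controlled by the deviation of `n ^ (x * log_n 2 - m)` from `1`. -/
theorem abs_one_div_two_pow_sub_one_div_zpow {n : ℕ} (hn : 2 ≤ n) (x : ℕ) (m : ℤ) :
    |1 / (2 : ℝ) ^ x - 1 / (n : ℝ) ^ m| =
      |(n : ℝ) ^ ((x : ℝ) * Real.logb n 2 - m) - 1| / 2 ^ x := by
  have hn1 : (1 : ℝ) < n := by exact_mod_cast hn
  have hn0 : (0 : ℝ) < n := by positivity
  have h2 : (n : ℝ) ^ ((x : ℝ) * Real.logb n 2) = 2 ^ x := by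
    rw [mul_comm, Real.rpow_mul hn0.le, Real.rpow_logb hn0 hn1.ne' two_pos, Real.rpow_natCast]
  have hx : (0 : ℝ) < 2 ^ x := by positivity
  have hm : (n : ℝ) ^ m ≠ 0 := by positivity
  rw [Real.rpow_sub hn0, h2, Real.rpow_intCast, abs_sub_comm, ← abs_of_pos hx, ← abs_div,
    abs_of_pos hx]
  congr 1
  field_simp

open Filter Topology in
/-- Lemma 4 of the paper: For integers `n₁,…,n_k ≥ 2`, `α ≥ 1` and
`ε = 2^{-100α}`, there are infinitely many `x ∈ ℕ` with
`|1/2^x − 1/nᵢ^{[x·log_{nᵢ} 2]}| < ε/2^x` for all `i`, where `[·]` is the nearest integer. -/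
theorem infinitely_many_simultaneous_close_scales
    (k : ℕ) (ns : Fin k → ℕ) (hns : ∀ i, 2 ≤ ns i) (α : ℕ) (hα : 1 ≤ α) :
    {x : ℕ | ∀ i : Fin k,
      |1 / (2:ℝ) ^ x - 1 / (ns i : ℝ) ^ (round ((x : ℝ) * Real.logb (ns i) 2))| <
        (2:ℝ) ^ (-(100 * α : ℤ)) / 2 ^ x}.Infinite := by
  have hε : ∀ᶠ t : ℝ in 𝓝 0, ∀ i, |(ns i : ℝ) ^ t - 1| < (2 : ℝ) ^ (-(100 * α : ℤ)) := by
    rw [eventually_all]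
    intro i
    have hi : (ns i : ℝ) ≠ 0 := by have := hns i; positivity
    have hc : ContinuousAt (fun t : ℝ => |(ns i : ℝ) ^ t - 1|) 0 :=
      ((Real.continuousAt_const_rpow hi).sub continuousAt_const).abs
    exact hc.eventually_lt continuousAt_const (by simp; positivity)
  obtain ⟨δ, hδ, hball⟩ := Metric.eventually_nhds_iff.1 hε
  rw [← Nat.frequently_atTop_iff_infinite]
  refine (frequently_forall_abs_sub_round_lt (fun i => Real.logb (ns i) 2) hδ).mono
    fun x hx i => ?_
  rw [abs_one_div_two_pow_sub_one_div_zpow (hns i)]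
  gcongr
  exact hball (by simpa [Real.dist_eq] using hx i) i
end

section
/- For every prime p and every ε > 0, there exist infinitely many m ∈ ℕ such that |1/2^m − 1/p^{[m·log_p 2]}| < ε/2^m, where [t] denotes a nearest integer to the real number t. -/
open Real

/-- The distance from `m * ξ` to the nearest integer is arbitrarily small for arbitrarily
large `m`. -/
theorem exists_gt_abs_mul_sub_round_lt (ξ : ℝ) {δ : ℝ} (hδ : 0 < δ) (N : ℕ) :
    ∃ m : ℕ, N < m ∧ |(m : ℝ) * ξ - round ((m : ℝ) * ξ)| < δ := by
  obtain ⟨n, hn⟩ := exists_nat_one_div_lt hδ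
  obtain ⟨k, hk, -, h⟩ :=
    Real.exists_nat_abs_mul_sub_round_le (((N + 1 : ℕ) : ℝ) * ξ) n.succ_pos
  refine ⟨k * (N + 1), by nlinarith, ?_⟩
  rw [← mul_assoc, ← Nat.cast_mul] at h
  refine (h.trans ?_).trans_lt hn
  apply one_div_le_one_div_of_le <;> push_cast <;> linarith [n.cast_nonneg (α := ℝ)]

/-- For every prime `p` and every `ε > 0` there are infinitely many `m ∈ ℕ`
with `|1/2^m − 1/p^{[m·log_p 2]}| < ε/2^m`, where `[·]` is the nearest integer. -/
theorem infinitely_many_close_scales_prime (p : ℕ) (hp : p.Prime) (ε : ℝ) (hε : 0 < ε) :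
    {m : ℕ |
      |1 / (2:ℝ) ^ m - 1 / (p : ℝ) ^ (round ((m : ℝ) * Real.logb p 2))| <
        ε / 2 ^ m}.Infinite := by
  have hp0 : (0 : ℝ) < p := by exact_mod_cast hp.pos
  have hp1 : (p : ℝ) ≠ 1 := by exact_mod_cast hp.ne_one
  obtain ⟨δ, hδ, hcont⟩ := Metric.continuousAt_iff.mp
    (Real.continuousAt_const_rpow (b := 0) hp0.ne') ε hε
  refine Set.infinite_of_forall_exists_gt fun N ↦ ?_
  obtain ⟨m, hm, h⟩ := exists_gt_abs_mul_sub_round_lt (Real.logb p 2) hδ N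
  refine ⟨m, ?_, hm⟩
  rw [Set.mem_ofPred_eq]
  set r := round ((m : ℝ) * Real.logb p 2)
  have hclose : |(p : ℝ) ^ ((m : ℝ) * Real.logb p 2 - r) - 1| < ε := by
    simpa [Real.dist_eq] using hcont (x := (m : ℝ) * Real.logb p 2 - r) (by simpa using h)
  have hpow : (p : ℝ) ^ ((m : ℝ) * Real.logb p 2 - r) = 2 ^ m / (p : ℝ) ^ r := by
    rw [Real.rpow_sub hp0, Real.rpow_intCast, mul_comm, Real.rpow_mul hp0.le,
      Real.rpow_logb hp0 hp1 two_pos, Real.rpow_natCast]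
  rw [hpow, abs_sub_comm] at hclose
  have hfactor : 1 / (2 : ℝ) ^ m - 1 / (p : ℝ) ^ r = (1 - 2 ^ m / (p : ℝ) ^ r) / 2 ^ m := by
    field_simp
  rw [hfactor, abs_div, abs_of_pos (show (0 : ℝ) < 2 ^ m by positivity)]
  gcongr
end

section
/- There exists a Borel measure μ on (0,∞), finite and positive on every bounded interval of positive length contained in (0,∞), such that for every integer n ≥ 2 there is a constant C(n) > 0 with μ(J₁) ≤ C(n)·μ(J₂) for all n-adic siblings J₁, J₂ ⊆ (0,∞), yet μ is not doubling on (0,∞): for every C > 0 there exist adjacent intervals I₁, I₂ ⊆ (0,∞) of equal positive length with μ(I₁) > C·μ(I₂). -/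
open MeasureTheory Set
open scoped ENNReal

/-- The left endpoint of the `j`-th bump, divisible by high powers of all `n ≤ j`. -/
def bumpStart (j : ℕ) : ℕ := (2 * (j + 1).factorial) ^ (j + 1)

lemma two_pow_succ_le_bumpStart (j : ℕ) : 2 ^ (j + 1) ≤ bumpStart j :=
  Nat.pow_le_pow_left (Nat.le_mul_of_pos_right 2 (Nat.factorial_pos _)) _

lemma two_mul_bumpStart_le (j : ℕ) : 2 * bumpStart j ≤ bumpStart (j + 1) := by
  unfold bumpStart
  calc 2 * (2 * (j + 1).factorial) ^ (j + 1)
      ≤ (2 * (j + 1).factorial) * (2 * (j + 1).factorial) ^ (j + 1) :=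
        Nat.mul_le_mul_right _ (Nat.le_mul_of_pos_right 2 (Nat.factorial_pos _))
    _ = (2 * (j + 1).factorial) ^ (j + 1 + 1) := by ring
    _ ≤ _ := Nat.pow_le_pow_left
        (Nat.mul_le_mul_left _ (Nat.factorial_le (by omega))) _

lemma bumpStart_add_lt {i j : ℕ} (h : i < j) : bumpStart i + 2 ^ i + 1 ≤ bumpStart j := by
  have hmono : Monotone bumpStart :=
    monotone_nat_of_le_succ fun k => by have := two_mul_bumpStart_le k; omega
  have h₁ := two_pow_succ_le_bumpStart i
  have h₂ := two_mul_bumpStart_le i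
  have h₃ : bumpStart (i + 1) ≤ bumpStart j := hmono h
  have h₄ := Nat.one_le_two_pow (n := i)
  rw [pow_succ] at h₁
  omega

lemma le_bumpStart (j : ℕ) : j ≤ bumpStart j :=
  (Nat.lt_two_pow_self.le.trans (Nat.pow_le_pow_right two_pos j.le_succ)).trans
    (two_pow_succ_le_bumpStart j)

lemma pow_dvd_bumpStart {n j t : ℕ} (hn : 2 ≤ n) (hj : n ≤ j) (ht : n ^ t < n * 2 ^ j) :
    n ^ t ∣ bumpStart j := by
  have h : n ^ t < n ^ (j + 1) := by
    calc n ^ t < n * 2 ^ j := ht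
      _ ≤ n * n ^ j := Nat.mul_le_mul_left _ (Nat.pow_le_pow_left hn _)
      _ = n ^ (j + 1) := by ring
  have ht' : t ≤ j + 1 := ((Nat.pow_lt_pow_iff_right hn).1 h).le
  refine (pow_dvd_pow n ht').trans (pow_dvd_pow_of_dvd ?_ _)
  exact dvd_mul_of_dvd_right (Nat.dvd_factorial (by omega) (by omega)) _

lemma exists_bumpStart_eq_mul_zpow {n j : ℕ} {m : ℤ} (hn : 2 ≤ n) (hj : n ≤ j)
    (h : ((n : ℝ) ^ m)⁻¹ < n * 2 ^ j) : ∃ d : ℤ, (bumpStart j : ℝ) = d / (n : ℝ) ^ m := by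
  have hn0 : (n : ℝ) ≠ 0 := by positivity
  rcases Int.eq_nat_or_neg m with ⟨t, rfl | rfl⟩
  · refine ⟨bumpStart j * n ^ t, ?_⟩
    push_cast
    rw [zpow_natCast]
    field_simp
  · rw [zpow_neg, inv_inv, zpow_natCast] at h
    obtain ⟨d, hd⟩ := pow_dvd_bumpStart hn hj (t := t) (by exact_mod_cast h)
    refine ⟨d, ?_⟩
    rw [hd, zpow_neg, zpow_natCast]
    push_cast
    field_simp

/-- The `i`-th layer of the `j`-th bump. -/
def bumpLayer (j i : ℕ) : Set ℝ := Ico (bumpStart j : ℝ) (bumpStart j + 2 ^ i)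

/-- The `j`-th bump: the sum of Lebesgue measure on its first `j` layers. -/
noncomputable def bump (j : ℕ) : Measure ℝ :=
  ∑ i ∈ Finset.range j, volume.restrict (bumpLayer j i)

/-- Lebesgue measure plus all the bumps. -/
noncomputable def bumpyMeasure : Measure ℝ := volume + Measure.sum bump

lemma bump_apply (j : ℕ) {J : Set ℝ} (hJ : MeasurableSet J) :
    bump j J = ∑ i ∈ Finset.range j, volume (J ∩ bumpLayer j i) := by
  simp [bump, Measure.restrict_apply hJ]

lemma bumpyMeasure_apply {J : Set ℝ} (hJ : MeasurableSet J) :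
    bumpyMeasure J = volume J + ∑' j, bump j J := by
  simp [bumpyMeasure, Measure.sum_apply _ hJ]

lemma volume_bumpLayer (j i : ℕ) : volume (bumpLayer j i) = 2 ^ i := by
  rw [bumpLayer, Real.volume_Ico, add_sub_cancel_left, ENNReal.ofReal_pow (by norm_num)]
  simp

lemma sum_two_pow_le (N : ℕ) : ∑ i ∈ Finset.range N, (2 : ℝ≥0∞) ^ i ≤ 2 ^ N := by
  induction N with
  | zero => simp
  | succ N ih =>
    rw [Finset.sum_range_succ, pow_succ, mul_two]
    gcongr

lemma bump_le_two_pow (j : ℕ) {J : Set ℝ} (hJ : MeasurableSet J) : bump j J ≤ 2 ^ j := by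
  rw [bump_apply j hJ]
  refine (Finset.sum_le_sum fun i _ => ?_).trans (sum_two_pow_le j)
  exact (measure_mono inter_subset_right).trans_eq (volume_bumpLayer j i)

lemma bump_le_mul_volume (j : ℕ) {J : Set ℝ} (hJ : MeasurableSet J) :
    bump j J ≤ j * volume J := by
  rw [bump_apply j hJ]
  refine (Finset.sum_le_sum fun i _ => measure_mono inter_subset_left).trans ?_
  simp

lemma bump_eq_zero {j : ℕ} {u v : ℝ}
    (h : v ≤ bumpStart j ∨ (bumpStart j : ℝ) + 2 ^ j ≤ u) : bump j (Ico u v) = 0 := by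
  rw [bump_apply j measurableSet_Ico]
  refine Finset.sum_eq_zero fun i hi => ?_
  have hle : (2 : ℝ) ^ i ≤ 2 ^ j :=
    pow_le_pow_right₀ (by norm_num) (Finset.mem_range.1 hi).le
  suffices Ico u v ∩ bumpLayer j i = ∅ by rw [this, measure_empty]
  ext t
  simp only [bumpLayer, mem_inter_iff, mem_Ico, mem_empty_iff_false, iff_false]
  rintro ⟨⟨h₁, h₂⟩, h₃, h₄⟩
  rcases h with h | h <;> linarith

lemma sum_two_pow_of_le (ℓ : ℝ≥0∞) (N : ℕ) :
    ∑ i ∈ Finset.range N, (if (2 : ℝ≥0∞) ^ i ≤ ℓ then (2 : ℝ≥0∞) ^ i else 0) ≤ 2 * ℓ := by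
  induction N with
  | zero => simp
  | succ N ih =>
    by_cases h : (2 : ℝ≥0∞) ^ N ≤ ℓ
    · calc _ ≤ ∑ i ∈ Finset.range (N + 1), (2 : ℝ≥0∞) ^ i :=
            Finset.sum_le_sum fun i _ => by split_ifs <;> simp
        _ ≤ 2 ^ (N + 1) := sum_two_pow_le _
        _ = 2 * 2 ^ N := pow_succ' _ _
        _ ≤ 2 * ℓ := by gcongr
    · rw [Finset.sum_range_succ, if_neg h, add_zero]
      exact ih

lemma card_filter_two_pow_between_le {A B : ℝ} {n : ℕ} (hAB : B ≤ 2 ^ n * A) (N : ℕ) :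
    ((Finset.range N).filter fun i => A < 2 ^ i ∧ (2 : ℝ) ^ i < B).card ≤ n := by
  set s := (Finset.range N).filter fun i => A < 2 ^ i ∧ (2 : ℝ) ^ i < B with hs
  rcases s.eq_empty_or_nonempty with h | h
  · simp [h]
  · have hmin := (Finset.mem_filter.1 (s.min'_mem h)).2
    have hsub : s ⊆ Finset.Ico (s.min' h) (s.min' h + n) := by
      intro i hi
      refine Finset.mem_Ico.2 ⟨s.min'_le i hi, ?_⟩
      have hi' := (Finset.mem_filter.1 hi).2
      have : (2 : ℝ) ^ i < 2 ^ (s.min' h + n) := by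
        calc (2 : ℝ) ^ i < B := hi'.2
          _ ≤ 2 ^ n * A := hAB
          _ ≤ 2 ^ n * 2 ^ s.min' h := by gcongr; exact hmin.1.le
          _ = _ := by ring
      exact (pow_lt_pow_iff_right₀ (by norm_num)).1 this
    simpa using Finset.card_le_card hsub

lemma bump_le_bump_add {n j : ℕ} {a l p q : ℝ} (hl : 0 < l) (ha : bumpStart j ≤ a)
    (hp : a ≤ p) (hq : a ≤ q) (hq' : q + l ≤ a + n * l) :
    bump j (Ico p (p + l)) ≤
      bump j (Ico q (q + l)) + (n + 2) * ENNReal.ofReal l := by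
  set ℓ := ENNReal.ofReal l with hℓ
  set x : ℝ := (bumpStart j : ℝ)
  set A := max l (a - x)
  have hvol : ∀ u, volume (Ico u (u + l)) = ℓ := fun u => by simp [hℓ]
  have key : ∀ i ∈ Finset.range j, volume (Ico p (p + l) ∩ bumpLayer j i) ≤
      volume (Ico q (q + l) ∩ bumpLayer j i) +
        ((if (2 : ℝ≥0∞) ^ i ≤ ℓ then (2 : ℝ≥0∞) ^ i else 0) +
          if A < 2 ^ i ∧ (2 : ℝ) ^ i < a - x + n * l then ℓ else 0) := by
    intro i _
    by_cases h₁ : (2 : ℝ≥0∞) ^ i ≤ ℓ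
    · rw [if_pos h₁]
      calc _ ≤ volume (bumpLayer j i) := measure_mono inter_subset_right
        _ = 2 ^ i := volume_bumpLayer j i
        _ ≤ _ := le_add_left (le_add_right le_rfl)
    by_cases h₂ : A < 2 ^ i ∧ (2 : ℝ) ^ i < a - x + n * l
    · rw [if_pos h₂]
      calc _ ≤ volume (Ico p (p + l)) := measure_mono inter_subset_left
        _ = ℓ := hvol p
        _ ≤ _ := le_add_left (le_add_left le_rfl)
    refine le_add_right ?_
    by_cases h₃ : a - x + n * l ≤ 2 ^ i
    · have hsub : Ico q (q + l) ⊆ bumpLayer j i :=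
        Ico_subset_Ico (ha.trans hq) (by linarith)
      rw [inter_eq_left.2 hsub, hvol, ← hvol p]
      exact measure_mono inter_subset_left
    · have h₄ : l < 2 ^ i := by
        by_contra! h
        apply h₁
        have := ENNReal.ofReal_le_ofReal h
        rwa [ENNReal.ofReal_pow (by norm_num), ENNReal.ofReal_ofNat] at this
      have h₅ : (2 : ℝ) ^ i ≤ a - x := by
        by_contra! h
        exact h₂ ⟨max_lt h₄ h, not_le.1 h₃⟩
      have hempty : Ico p (p + l) ∩ bumpLayer j i = ∅ := by
        ext t
        simp only [bumpLayer, mem_inter_iff, mem_Ico, mem_empty_iff_false, iff_false]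
        rintro ⟨⟨_, _⟩, _, h⟩
        change t < x + 2 ^ i at h
        linarith
      simp [hempty]
  have hAB : a - x + n * l ≤ 2 ^ n * A := by
    have h₁ : l ≤ A := le_max_left _ _
    have h₂ : a - x ≤ A := le_max_right _ _
    have h₃ : (n : ℝ) + 1 ≤ 2 ^ n := by exact_mod_cast Nat.lt_two_pow_self (n := n)
    nlinarith [Nat.cast_nonneg (α := ℝ) n]
  rw [bump_apply j measurableSet_Ico, bump_apply j measurableSet_Ico]
  refine (Finset.sum_le_sum key).trans ?_
  rw [Finset.sum_add_distrib, Finset.sum_add_distrib, add_comm (n : ℝ≥0∞), add_mul]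
  gcongr
  · exact sum_two_pow_of_le ℓ j
  · rw [← Finset.sum_filter, Finset.sum_const, nsmul_eq_mul]
    gcongr
    exact card_filter_two_pow_between_le hAB j

lemma tsum_ite_le_of_subsingleton {S : Set ℕ} [DecidablePred (· ∈ S)] (hS : S.Subsingleton)
    (c : ℝ≥0∞) : ∑' j, (if j ∈ S then c else 0) ≤ c := by
  rcases hS.eq_empty_or_singleton with rfl | ⟨j, rfl⟩
  · simp
  · simp [tsum_ite_eq]

lemma tsum_bump_le {n : ℕ} {m c : ℤ} {p q l : ℝ} (hn : 2 ≤ n)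
    (hl : ((n : ℝ) ^ m)⁻¹ = n * l) (hl0 : 0 < l)
    (hp : c / (n : ℝ) ^ m ≤ p) (hp' : p + l ≤ (c + 1) / (n : ℝ) ^ m)
    (hq : c / (n : ℝ) ^ m ≤ q) (hq' : q + l ≤ (c + 1) / (n : ℝ) ^ m) :
    ∑' j, bump j (Ico p (p + l)) ≤
      ∑' j, bump j (Ico q (q + l)) + (n ^ 2 + n + 4) * ENNReal.ofReal l := by
  classical
  set ℓ := ENNReal.ofReal l with hℓ
  set a : ℝ := c / (n : ℝ) ^ m with ha
  have hend : (c + 1) / (n : ℝ) ^ m = a + n * l := by rw [← hl, ha, add_div, one_div]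
  rw [hend] at hp' hq'
  have hvol : ∀ u, volume (Ico u (u + l)) = ℓ := fun u => by simp [hℓ]
  let S : Set ℕ := {j | (bumpStart j : ℝ) ≤ a ∧ a < bumpStart j + 2 ^ j}
  have hlt : ∀ i j, i < j → i ∈ S → j ∉ S := by
    rintro i j hij ⟨_, h₁⟩ ⟨h₂, _⟩
    have : (bumpStart i : ℝ) + 2 ^ i + 1 ≤ bumpStart j := by
      exact_mod_cast bumpStart_add_lt hij
    linarith
  have hS : S.Subsingleton := fun i hi j hj => by
    rcases lt_trichotomy i j with h | h | h
    · exact (hlt i j h hi hj).elim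
    · exact h
    · exact (hlt j i h hj hi).elim
  have key : ∀ j, bump j (Ico p (p + l)) ≤ bump j (Ico q (q + l)) +
      ((if (2 : ℝ≥0∞) ^ j ≤ ℓ then (2 : ℝ≥0∞) ^ j else 0) +
        ((if j ∈ Finset.range n then n * ℓ else 0) +
          if j ∈ S then (n + 2) * ℓ else 0)) := by
    intro j
    by_cases h₁ : (2 : ℝ≥0∞) ^ j ≤ ℓ
    · rw [if_pos h₁]
      exact (bump_le_two_pow j measurableSet_Ico).trans (le_add_left (le_add_right le_rfl))
    by_cases h₂ : j < n
    · rw [if_pos (Finset.mem_range.2 h₂)]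
      calc bump j (Ico p (p + l)) ≤ j * ℓ :=
            hvol p ▸ bump_le_mul_volume j measurableSet_Ico
        _ ≤ n * ℓ := by gcongr
        _ ≤ _ := le_add_left (le_add_left (le_add_right le_rfl))
    have h₃ : l < 2 ^ j := by
      by_contra! h
      apply h₁
      have := ENNReal.ofReal_le_ofReal h
      rwa [ENNReal.ofReal_pow (by norm_num), ENNReal.ofReal_ofNat] at this
    have hn0 : (0 : ℝ) < n := by positivity
    obtain ⟨d, hd⟩ := exists_bumpStart_eq_mul_zpow (j := j) (m := m) hn (not_lt.1 h₂)
      (by rw [hl]; gcongr)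
    rcases le_or_gt d c with hdc | hdc
    · have hxa : (bumpStart j : ℝ) ≤ a := by
        rw [hd, ha]
        gcongr
      by_cases hj : j ∈ S
      · rw [if_pos hj]
        refine (bump_le_bump_add hl0 hxa hp hq hq').trans ?_
        gcongr
        exact le_add_left (le_add_left le_rfl)
      · have : (bumpStart j : ℝ) + 2 ^ j ≤ a := by
          by_contra! h
          exact hj ⟨hxa, h⟩
        simp [bump_eq_zero (Or.inr (this.trans hp))]
    · have : a + n * l ≤ bumpStart j := by
        rw [← hend, hd]
        gcongr
        exact_mod_cast hdc
      simp [bump_eq_zero (Or.inl (hp'.trans this))]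
  refine (ENNReal.tsum_le_tsum key).trans ?_
  rw [ENNReal.tsum_add, ENNReal.tsum_add, ENNReal.tsum_add]
  gcongr
  calc _ ≤ 2 * ℓ + (n * (n * ℓ) + (n + 2) * ℓ) := by
        gcongr
        · exact ENNReal.tsum_le_of_sum_range_le (sum_two_pow_of_le ℓ)
        · rw [tsum_eq_sum (s := Finset.range n) fun j hj => if_neg hj,
            Finset.sum_congr rfl fun j hj => if_pos hj]
          simp
        · exact tsum_ite_le_of_subsingleton hS _
    _ = (n ^ 2 + n + 4) * ℓ := by ring

lemma bumpyMeasure_Ico_lt_top (x y : ℝ) : bumpyMeasure (Ico x y) < ⊤ := by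
  rw [bumpyMeasure_apply measurableSet_Ico]
  obtain ⟨N, hN⟩ := exists_nat_ge y
  rw [tsum_eq_sum (s := Finset.range N)]
  · refine ENNReal.add_lt_top.2 ⟨by simp, ENNReal.sum_lt_top.2 fun j _ => ?_⟩
    exact (bump_le_two_pow j measurableSet_Ico).trans_lt (by simp)
  · intro j hj
    refine bump_eq_zero (Or.inl (hN.trans ?_))
    rw [Finset.mem_range, not_lt] at hj
    exact_mod_cast hj.trans (le_bumpStart j)

lemma bumpyMeasure_siblings_le {n : ℕ} (hn : 2 ≤ n) {J₁ J₂ : Set ℝ}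
    (h : NAdicSiblings n J₁ J₂) :
    bumpyMeasure J₁ ≤ ENNReal.ofReal (n ^ 2 + n + 5) * bumpyMeasure J₂ := by
  obtain ⟨m, k₁, k₂, k, rfl, rfl, h₁, h₂⟩ := h
  have hn0 : (0 : ℝ) < n := by positivity
  set l : ℝ := ((n : ℝ) ^ (m + 1))⁻¹ with hl
  have hl0 : 0 < l := by positivity
  have hI : ∀ k : ℤ, nadicI n (m + 1) k =
      Ico ((k - 1 : ℝ) / (n : ℝ) ^ (m + 1)) ((k - 1 : ℝ) / (n : ℝ) ^ (m + 1) + l) := by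
    intro k
    rw [nadicI]
    congr 1
    rw [hl]
    ring
  have hln : ((n : ℝ) ^ m)⁻¹ = n * l := by
    rw [hl, zpow_add₀ hn0.ne', zpow_one]
    field_simp
  rw [hI] at h₁ h₂ ⊢
  rw [hI]
  rw [nadicI, Ico_subset_Ico_iff (by linarith)] at h₁ h₂
  rw [bumpyMeasure_apply measurableSet_Ico, bumpyMeasure_apply measurableSet_Ico]
  have := tsum_bump_le (c := k - 1) hn hln hl0 (by exact_mod_cast h₁.1)
    (by simpa using h₁.2) (by exact_mod_cast h₂.1) (by simpa using h₂.2)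
  push_cast at this
  have hC : ENNReal.ofReal ((n : ℝ) ^ 2 + n + 5) = 1 + (n ^ 2 + n + 4) := by
    rw [show (n : ℝ) ^ 2 + n + 5 = ((1 + (n ^ 2 + n + 4) : ℕ) : ℝ) by push_cast; ring,
      ENNReal.ofReal_natCast]
    push_cast
    rfl
  rw [hC, Real.volume_Ico, Real.volume_Ico, add_sub_cancel_left, add_sub_cancel_left]
  set F := ∑' j, bump j (Ico ((k₂ - 1 : ℝ) / (n : ℝ) ^ (m + 1))
    ((k₂ - 1 : ℝ) / (n : ℝ) ^ (m + 1) + l))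
  calc _ ≤ ENNReal.ofReal l + (F + (n ^ 2 + n + 4) * ENNReal.ofReal l) := by gcongr
    _ ≤ (ENNReal.ofReal l + F) + (n ^ 2 + n + 4) * (ENNReal.ofReal l + F) := by
        rw [← add_assoc]
        gcongr
        exact le_self_add
    _ = _ := by ring

lemma bumpyMeasure_left_of_bumpStart (j : ℕ) :
    bumpyMeasure (Ico (bumpStart j - 1 : ℝ) (bumpStart j)) = 1 := by
  rw [bumpyMeasure_apply measurableSet_Ico, ENNReal.tsum_eq_zero.2]
  · simp
  · intro i
    apply bump_eq_zero
    rcases lt_or_ge i j with h | h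
    · right
      have : (bumpStart i : ℝ) + 2 ^ i + 1 ≤ bumpStart j := by
        exact_mod_cast bumpStart_add_lt h
      linarith
    · left
      rcases h.eq_or_lt with rfl | h
      · exact le_rfl
      · have := bumpStart_add_lt h
        exact_mod_cast (by lia : bumpStart j ≤ bumpStart i)

lemma le_bumpyMeasure_right_of_bumpStart (j : ℕ) :
    (j : ℝ≥0∞) + 1 ≤ bumpyMeasure (Ico (bumpStart j : ℝ) (bumpStart j + 1)) := by
  have hj : bump j (Ico (bumpStart j : ℝ) (bumpStart j + 1)) = j := by
    rw [bump_apply j measurableSet_Ico]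
    have : ∀ i ∈ Finset.range j, volume (Ico (bumpStart j : ℝ) (bumpStart j + 1) ∩
        bumpLayer j i) = 1 := by
      intro i _
      have hsub : Ico (bumpStart j : ℝ) (bumpStart j + 1) ⊆ bumpLayer j i :=
        Ico_subset_Ico_right (by gcongr; exact one_le_pow₀ (by norm_num))
      rw [inter_eq_left.2 hsub]
      simp
    rw [Finset.sum_congr rfl this]
    simp
  rw [bumpyMeasure_apply measurableSet_Ico, add_comm]
  gcongr
  · simp
  · exact hj.symm.le.trans (ENNReal.le_tsum j)

/-- Theorem 4.3 of the paper: There exists a measure on `(0,∞)`, finite and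
positive on bounded subintervals of positive length, that is `n`-adic doubling on `(0,∞)`
for every `n ≥ 2` yet not doubling on `(0,∞)`. -/
theorem exists_nadic_doubling_not_doubling_halfline :
    ∃ μ : Measure ℝ,
      (∀ x y : ℝ, 0 < x → x < y → 0 < μ (Set.Ico x y) ∧ μ (Set.Ico x y) < ⊤) ∧
      (∀ n : ℕ, 2 ≤ n → ∃ C : ℝ, 0 < C ∧
        ∀ J₁ J₂ : Set ℝ, NAdicSiblings n J₁ J₂ → J₁ ⊆ Set.Ioi 0 → J₂ ⊆ Set.Ioi 0 →
          μ J₁ ≤ ENNReal.ofReal C * μ J₂) ∧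
      (∀ C : ℝ, 0 < C → ∃ I₁ I₂ : Set ℝ, AdjacentPair I₁ I₂ ∧
        I₁ ⊆ Set.Ioi 0 ∧ I₂ ⊆ Set.Ioi 0 ∧ ENNReal.ofReal C * μ I₂ < μ I₁) := by
  refine ⟨bumpyMeasure, fun x y _ hxy => ⟨?_, bumpyMeasure_Ico_lt_top x y⟩,
    fun n hn => ⟨n ^ 2 + n + 5, by positivity,
      fun J₁ J₂ h _ _ => bumpyMeasure_siblings_le hn h⟩, fun C _ => ?_⟩
  · rw [bumpyMeasure_apply measurableSet_Ico]
    exact lt_of_lt_of_le (by simpa using hxy) le_self_add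
  · obtain ⟨j, hj⟩ := exists_nat_ge C
    have hx : (2 : ℝ) ≤ bumpStart j := by
      have h := two_pow_succ_le_bumpStart j
      have h' := Nat.one_le_two_pow (n := j)
      rw [pow_succ] at h
      exact_mod_cast (by omega : 2 ≤ bumpStart j)
    refine ⟨Ico (bumpStart j : ℝ) (bumpStart j + 1), Ico (bumpStart j - 1 : ℝ) (bumpStart j),
      ⟨bumpStart j, 1, one_pos, Or.inr ⟨rfl, rfl⟩⟩, fun t ht => ?_, fun t ht => ?_, ?_⟩
    · exact mem_Ioi.2 (by linarith [ht.1])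
    · exact mem_Ioi.2 (by linarith [ht.1])
    · rw [bumpyMeasure_left_of_bumpStart, mul_one]
      refine lt_of_lt_of_le ?_ (le_bumpyMeasure_right_of_bumpStart j)
      calc ENNReal.ofReal C ≤ ENNReal.ofReal j := ENNReal.ofReal_le_ofReal hj
        _ = j := ENNReal.ofReal_natCast j
        _ < j + 1 := ENNReal.lt_add_right (by simp) one_ne_zero
end

section
/- Let f : ℕ → ℝ be an increasing unbounded function with f(n) > 1.01 for every n. Then there exists a Borel measure μ on [0,1), finite and positive on every interval of positive length contained in [0,1), such that for every integer n ≥ 2, μ is n-adic doubling on [0,1) with constant at most f(n), yet μ is not doubling on [0,1): for every C > 0 there exist adjacent intervals I₁, I₂ ⊆ [0,1) of equal positive length with μ(I₁) > C·μ(I₂). -/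
open MeasureTheory Set
open scoped ENNReal

/-- Increment over `[α, β]` of the function with slope `1` on `[a, b]` and `0` elsewhere. -/
theorem max_sub_max_increment {a b α β : ℝ} (hab : a ≤ b) (h : α ≤ β) :
    0 ≤ (max β a - max β b) - (max α a - max α b) ∧
    (max β a - max β b) - (max α a - max α b) ≤ β - α ∧
    (max β a - max β b) - (max α a - max α b) ≤ b - a := by
  rcases max_cases β a with h1 | h1 <;> rcases max_cases β b with h2 | h2 <;>
  rcases max_cases α a with h3 | h3 <;> rcases max_cases α b with h4 | h4 <;>
  refine ⟨?_, ?_, ?_⟩ <;> linarith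

/-- Simultaneous Dirichlet approximation with a bound on the multiplier that is uniform in the
approximated numbers. -/
theorem exists_uniform_simultaneous_approx (N Q : ℕ) (hQ : 0 < Q) :
    ∃ T : ℕ, ∀ a : ℕ → ℝ, ∃ t : ℕ, 1 ≤ t ∧ t ≤ T ∧
      ∀ n ≤ N, ∃ z : ℤ, |t * a n - z| ≤ 1 / Q := by
  refine ⟨Fintype.card (Fin (N + 1) → Fin Q), fun a => ?_⟩
  have hQ' : (0 : ℝ) < Q := by exact_mod_cast hQ
  have hlt (x : ℝ) : ⌊Int.fract x * Q⌋₊ < Q := by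
    rw [Nat.floor_lt (mul_nonneg (Int.fract_nonneg x) hQ'.le)]
    nlinarith [Int.fract_lt_one x]
  let box : Fin (Fintype.card (Fin (N + 1) → Fin Q) + 1) → (Fin (N + 1) → Fin Q) :=
    fun t n => ⟨⌊Int.fract (t * a n) * Q⌋₊, hlt _⟩
  obtain ⟨i, j, hij, hbox⟩ := Fintype.exists_ne_map_eq_of_card_lt box (by simp)
  wlog hlt' : i < j generalizing i j
  · exact this j i hij.symm hbox.symm (lt_of_le_of_ne (not_lt.mp hlt') hij.symm)
  have hval : (i : ℕ) < j := hlt'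
  refine ⟨j - i, by omega, by omega, fun n hn => ?_⟩
  have hn' := congrArg Fin.val (congrFun hbox ⟨n, by omega⟩)
  simp only [box] at hn'
  refine ⟨⌊(j : ℝ) * a n⌋ - ⌊(i : ℝ) * a n⌋, ?_⟩
  have h1 := Nat.floor_le (mul_nonneg (Int.fract_nonneg ((i : ℝ) * a n)) hQ'.le)
  have h2 := Nat.lt_floor_add_one (Int.fract ((i : ℝ) * a n) * Q)
  have h3 := Nat.floor_le (mul_nonneg (Int.fract_nonneg ((j : ℝ) * a n)) hQ'.le)
  have h4 := Nat.lt_floor_add_one (Int.fract ((j : ℝ) * a n) * Q)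
  rw [← hn'] at h3 h4
  push_cast [Nat.cast_sub hval.le]
  have e : ((j : ℝ) - i) * a n - (⌊(j : ℝ) * a n⌋ - ⌊(i : ℝ) * a n⌋) =
      Int.fract ((j : ℝ) * a n) - Int.fract ((i : ℝ) * a n) := by
    simp only [Int.fract]; ring
  rw [e, abs_le, le_div_iff₀ hQ', ← neg_div, div_le_iff₀ hQ']
  constructor <;> nlinarith

/-- If the breakpoints `p - u j` are lacunary towards `p` and `p` is, at their scale,
indistinguishable from a point `q` outside the interior of `[A, A + n * h)`, then two subintervals
of length `h` meet the half-lines `[p - u j, ∞)` in almost the same lengths. -/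
theorem sum_abs_increment_sub_le {p q A h α₁ α₂ ρ : ℝ} {u : ℕ → ℝ} {n N K : ℕ}
    (hK : 0 < K) (hN : 0 < N) (hnN : n ≤ N) (hh : 0 < h)
    (hρ : ρ = 1 + 4 * K * N) (hu : ∀ i j, i < j → ρ * u j ≤ u i)
    (hq : ∀ j < 2 * K, |p - q| ≤ u j) (hqA : A + n * h ≤ q ∨ q ≤ A)
    (h₁ : A ≤ α₁) (h₁' : α₁ + h ≤ A + n * h) (h₂ : A ≤ α₂) (h₂' : α₂ + h ≤ A + n * h) :
    ∑ j ∈ Finset.range (2 * K), |(max (α₁ + h) (p - u j) - max α₁ (p - u j)) -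
      (max (α₂ + h) (p - u j) - max α₂ (p - u j))| ≤ 2 * h := by
  have hK' : (0 : ℝ) < K := by exact_mod_cast hK
  have hN' : (0 : ℝ) < N := by exact_mod_cast hN
  have hnN' : (n : ℝ) ≤ N := by exact_mod_cast hnN
  have hX (α c : ℝ) : 0 ≤ max (α + h) c - max α c ∧ max (α + h) c - max α c ≤ h := by
    rcases max_cases (α + h) c with h1 | h1 <;> rcases max_cases α c with h2 | h2 <;>
      constructor <;> linarith
  have hout (j : ℕ) (hj : ¬ (A < p - u j ∧ p - u j < A + n * h)) :
      |(max (α₁ + h) (p - u j) - max α₁ (p - u j)) -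
      (max (α₂ + h) (p - u j) - max α₂ (p - u j))| = 0 := by
    rcases le_or_gt (p - u j) A with hA | hA
    · rw [max_eq_left (by linarith), max_eq_left (by linarith), max_eq_left (by linarith),
        max_eq_left (by linarith)]
      simp
    · have hA' : A + n * h ≤ p - u j := not_lt.mp fun h' => hj ⟨hA, h'⟩
      rw [max_eq_right (by linarith), max_eq_right (by linarith), max_eq_right (by linarith),
        max_eq_right (by linarith)]
      simp
  by_cases hM : ∃ j, j < 2 * K ∧ A < p - u j ∧ p - u j < A + n * h
  · classical
    obtain ⟨hk, hkA, hkB⟩ := Nat.find_spec hM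
    have hmin := fun i => Nat.find_min (m := i) hM
    generalize Nat.find hM = k at hk hkA hkB hmin
    have hterm : ∀ j ∈ Finset.range (2 * K),
        |(max (α₁ + h) (p - u j) - max α₁ (p - u j)) -
          (max (α₂ + h) (p - u j) - max α₂ (p - u j))| ≤
        (if j = k then h else 0) + h / (2 * K) := by
      intro j hj
      rw [Finset.mem_range] at hj
      have hpos : 0 < h / (2 * K) := by positivity
      by_cases hin : A < p - u j ∧ p - u j < A + n * h
      swap
      · rw [hout j hin]; split_ifs <;> positivity
      rcases lt_trichotomy j k with hjk | rfl | hjk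
      · exact absurd ⟨hj, hin⟩ (hmin j hjk)
      · have a1 := hX α₁ (p - u j)
        have a2 := hX α₂ (p - u j)
        simp only [if_true]
        rw [abs_le]; constructor <;> linarith
      · rw [if_neg hjk.ne', zero_add]
        have hq' := hq j hj
        have hqp := abs_le.mp hq'
        have hAq : A + n * h ≤ q := by
          rcases hqA with hqA | hqA
          · exact hqA
          · linarith
        have b1 : ρ * u j ≤ u k := hu k j hjk
        have b2 : 4 * K * N * u j ≤ N * h := by
          have : n * h ≤ N * h := by gcongr
          rw [hρ] at b1
          linarith
        have b3 : 2 * u j ≤ h / (2 * K) := by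
          rw [le_div_iff₀ (by positivity)]
          refine le_of_mul_le_mul_left ?_ hN'
          linarith
        have hY (α : ℝ) (hα : α + h ≤ A + n * h) :
            max (α + h) (p - u j) - max α (p - u j) ≤ 2 * u j := by
          have : max (α + h) (p - u j) ≤ q ⊔ (p - u j) := by gcongr; linarith
          rcases max_cases q (p - u j) with h1 | h1 <;>
            linarith [le_max_right α (p - u j)]
        rw [abs_le]
        constructor <;> linarith [hX α₁ (p - u j), hX α₂ (p - u j), hY α₁ h₁', hY α₂ h₂']
    refine (Finset.sum_le_sum hterm).trans ?_
    rw [Finset.sum_add_distrib, Finset.sum_ite_eq', if_pos (Finset.mem_range.mpr hk)]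
    simp only [Finset.sum_const, Finset.card_range, nsmul_eq_mul]
    push_cast
    have : 2 * (K : ℝ) * (h / (2 * K)) = h := by field_simp
    linarith
  · push Not at hM
    rw [Finset.sum_eq_zero fun j hj => hout j fun hj' =>
      absurd (hM j (Finset.mem_range.mp hj) hj'.1) (not_le.mpr hj'.2)]
    positivity

/-- The distribution function of the density which is `1` plus `1 / 200` for each `i < K` with
`p - u i < x < p - u (K + i)`. -/
noncomputable def spike (p : ℝ) (u : ℕ → ℝ) (K : ℕ) (x : ℝ) : ℝ :=
  x + 1 / 200 * ∑ i ∈ Finset.range K, (max x (p - u i) - max x (p - u (K + i)))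

theorem continuous_spike (p : ℝ) (u : ℕ → ℝ) (K : ℕ) : Continuous (spike p u K) := by
  unfold spike
  fun_prop

theorem spike_sub (p : ℝ) (u : ℕ → ℝ) (K : ℕ) (α β : ℝ) :
    spike p u K β - spike p u K α = (β - α) + 1 / 200 * ∑ i ∈ Finset.range K,
      ((max β (p - u i) - max β (p - u (K + i))) -
        (max α (p - u i) - max α (p - u (K + i)))) := by
  rw [Finset.sum_sub_distrib, spike, spike]
  ring

theorem spike_increment_bounds {p : ℝ} {u : ℕ → ℝ} {K : ℕ} (hu : Antitone u) (hu' : ∀ i, 0 ≤ u i)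
    {α β : ℝ} (h : α ≤ β) :
    β - α ≤ spike p u K β - spike p u K α ∧
    spike p u K β - spike p u K α ≤ (1 + K / 200) * (β - α) ∧
    spike p u K β - spike p u K α ≤ (β - α) + K * u 0 / 200 := by
  have hi (i : ℕ) := max_sub_max_increment (a := p - u i) (b := p - u (K + i))
    (by linarith [hu (show i ≤ K + i by omega)]) h
  have h0 := Finset.sum_nonneg fun i (_ : i ∈ Finset.range K) => (hi i).1
  have h1 := Finset.sum_le_card_nsmul (Finset.range K) _ _ fun i _ => (hi i).2.1
  have h2 := Finset.sum_le_card_nsmul (Finset.range K) _ (u 0) fun i _ =>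
    (hi i).2.2.trans (by linarith [hu (Nat.zero_le i), hu' (K + i)])
  simp only [Finset.card_range, nsmul_eq_mul] at h1 h2
  rw [spike_sub]
  refine ⟨?_, ?_, ?_⟩ <;> linarith

theorem spike_right {p l : ℝ} {u : ℕ → ℝ} {K : ℕ} (hu' : ∀ i, 0 ≤ u i) (hl : 0 ≤ l) :
    spike p u K (p + l) - spike p u K p = l := by
  rw [spike_sub, Finset.sum_eq_zero]
  · ring
  · intro i _
    have := hu' i
    have := hu' (K + i)
    rw [max_eq_left (by linarith), max_eq_left (by linarith), max_eq_left (by linarith),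
      max_eq_left (by linarith)]
    ring

theorem spike_left {p l : ℝ} {u : ℕ → ℝ} {K : ℕ} (hu' : ∀ i, 0 ≤ u i)
    (hl : 0 ≤ l) (hlu : ∀ i < K, l ≤ u i) (hul : ∀ i, 2 * u (K + i) ≤ l) :
    K / 400 * l ≤ spike p u K p - spike p u K (p - l) := by
  have h1 := Finset.card_nsmul_le_sum (Finset.range K) (fun i =>
    (max p (p - u i) - max p (p - u (K + i))) -
        (max (p - l) (p - u i) - max (p - l) (p - u (K + i)))) (l / 2) (by
    intro i hi
    have := hu' i
    have := hu' (K + i)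
    have := hlu i (Finset.mem_range.mp hi)
    have := hul i
    rw [max_eq_left (by linarith), max_eq_left (by linarith), max_eq_left (by linarith),
      max_eq_right (by linarith)]
    linarith)
  simp only [Finset.card_range, nsmul_eq_mul] at h1
  rw [spike_sub]
  linarith

theorem spike_increment_sub_le_sum (p : ℝ) (u : ℕ → ℝ) (K : ℕ) (α₁ α₂ h : ℝ) :
    (spike p u K (α₁ + h) - spike p u K α₁) - (spike p u K (α₂ + h) - spike p u K α₂) ≤
      1 / 200 * ∑ j ∈ Finset.range (2 * K), |(max (α₁ + h) (p - u j) - max α₁ (p - u j)) -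
      (max (α₂ + h) (p - u j) - max α₂ (p - u j))| := by
  rw [spike_sub, spike_sub, two_mul, Finset.sum_range_add, ← Finset.sum_add_distrib]
  have : ∀ a b c d : ℝ, ((a + h - a) + 1 / 200 * b) - ((c + h - c) + 1 / 200 * d) =
    1 / 200 * (b - d) := by intros; ring
  rw [this, ← Finset.sum_sub_distrib]
  gcongr with i
  refine le_trans ?_ (add_le_add (le_abs_self _) (neg_le_abs _))
  linarith

/-- An `n`-adic interval of generation at least `m` does not contain a point of `n^{-m} ℤ` in its
interior. -/
theorem nadic_not_straddle {n m : ℕ} (hn : 0 < n) {m' : ℤ} (hm : (m : ℤ) ≤ m') (k z : ℤ) :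
    (k : ℝ) / (n : ℝ) ^ m' ≤ z / (n : ℝ) ^ m ∨ (z : ℝ) / (n : ℝ) ^ m ≤ (k - 1) / (n : ℝ) ^ m' := by
  obtain ⟨d, rfl⟩ := Int.le.dest hm
  have hn' : (0 : ℝ) < n := by exact_mod_cast hn
  rw [zpow_add₀ hn'.ne', zpow_natCast, zpow_natCast]
  have e : (z : ℝ) / (n : ℝ) ^ m = (z * n ^ d : ℤ) / ((n : ℝ) ^ m * (n : ℝ) ^ d) := by
    push_cast; field_simp
  rw [e]
  rcases le_or_gt k (z * n ^ d) with h | h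
  · left
    gcongr
  · right
    gcongr
    rw [le_sub_iff_add_le]
    exact_mod_cast h

theorem exists_spike (f : ℕ → ℝ) (hmono : Monotone f) (hunb : ∀ B : ℝ, ∃ n, B < f n)
    (hgt : ∀ n, 1.01 < f n) (H : ℝ) :
    ∃ (Φ : ℝ → ℝ) (x l B : ℝ), Continuous Φ ∧ 0 ≤ B ∧
      (∀ a b, a ≤ b → b - a ≤ Φ b - Φ a ∧ Φ b - Φ a ≤ B * (b - a)) ∧ Φ 1 - Φ 0 ≤ 2 ∧
      0 < l ∧ 0 ≤ x - l ∧ x + l ≤ 1 ∧ Φ (x + l) - Φ x ≤ l ∧ H * l ≤ Φ x - Φ (x - l) ∧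
      ∀ (n : ℕ) (A h α₁ α₂ : ℝ) (m k : ℤ), 2 ≤ n → h = 1 / (n : ℝ) ^ (m + 1) →
        A = (k - 1) / (n : ℝ) ^ m → A ≤ α₁ → α₁ + h ≤ A + n * h → A ≤ α₂ → α₂ + h ≤ A + n * h →
        Φ (α₁ + h) - Φ α₁ ≤ f n * (Φ (α₂ + h) - Φ α₂) := by
  obtain ⟨K, hK⟩ := exists_nat_ge (max 1 (400 * H))
  have hK1 : (1 : ℝ) ≤ K := (le_max_left _ _).trans hK
  have hKH : 400 * H ≤ K := (le_max_right _ _).trans hK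
  have hK0 : 0 < K := by exact_mod_cast (zero_lt_one.trans_le hK1)
  obtain ⟨N', hN'⟩ := hunb (1 + K / 200)
  set N := N' + 1
  have hfN : 1 + K / 200 ≤ f N := hN'.le.trans (hmono (Nat.le_succ _))
  have hN1 : (1 : ℝ) ≤ N := by simp [N]
  obtain ⟨ρ, hρ⟩ : ∃ ρ : ℝ, ρ = 1 + 4 * K * N := ⟨_, rfl⟩
  have hρ2 : 2 ≤ ρ := by nlinarith
  obtain ⟨Q, hQ⟩ := exists_nat_ge (K * N * ρ ^ (2 * K))
  have hQ0 : (0 : ℝ) < Q := lt_of_lt_of_le (by positivity) hQ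
  obtain ⟨T, hT⟩ := exists_uniform_simultaneous_approx N Q (by exact_mod_cast hQ0)
  obtain ⟨s, hs⟩ : ∃ s : ℝ, s = 1 / (T + 1) := ⟨_, rfl⟩
  have hs0 : 0 < s := by rw [hs]; positivity
  have hTs : (T + 1) * s = 1 := by rw [hs]; field_simp
  obtain ⟨t, ht1, htT, happrox⟩ := hT fun n => s * (n : ℝ) ^ (Nat.log n (T + 1))
  have ht1' : (1 : ℝ) ≤ t := by exact_mod_cast ht1
  have htT' : (t : ℝ) ≤ T := by exact_mod_cast htT
  obtain ⟨p, hp⟩ : ∃ p : ℝ, p = t * s := ⟨_, rfl⟩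
  have hsp : s ≤ p := by rw [hp]; nlinarith
  have hps : p ≤ 1 - s := by rw [hp]; nlinarith
  obtain ⟨u, hu⟩ : ∃ u : ℕ → ℝ, u = fun j => s / K / ρ ^ j := ⟨_, rfl⟩
  have hu0 (j : ℕ) : 0 < u j := by rw [hu]; positivity
  have hanti : Antitone u := by
    intro i j hij
    simp only [hu]
    gcongr
    linarith
  have hsucc (j : ℕ) : ρ * u (j + 1) = u j := by
    simp only [hu, pow_succ]; field_simp
  have hlac (i j : ℕ) (hij : i < j) : ρ * u j ≤ u i := by
    rw [← hsucc i]
    exact mul_le_mul_of_nonneg_left (hanti hij) (by linarith)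
  have hKu : K * u 0 = s := by simp only [hu, pow_zero]; field_simp
  have hu0s : u 0 ≤ s := by nlinarith [hu0 0]
  have hs1 : s ≤ 1 := by linarith
  have hinc {α β : ℝ} (h : α ≤ β) := spike_increment_bounds (p := p) (K := K) hanti
    (fun i => (hu0 i).le) h
  have hl : u (K - 1) ≤ s := (hanti (Nat.zero_le _)).trans hu0s
  refine ⟨spike p u K, p, u (K - 1), 1 + K / 200, continuous_spike _ _ _, by positivity,
    fun a b hab => ⟨(hinc hab).1, (hinc hab).2.1⟩, ?_, hu0 _, by linarith, by linarith,
    (spike_right (fun i => (hu0 i).le) (hu0 _).le).le, ?_, ?_⟩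
  · have := (hinc zero_le_one).2.2
    rw [hKu] at this
    linarith
  · refine le_trans ?_ (spike_left (fun i => (hu0 i).le) (hu0 _).le
      (fun i hi => hanti (by omega)) fun i => ?_)
    · have := hu0 (K - 1)
      gcongr
      linarith
    · refine le_trans ?_ (hlac (K - 1) (K + i) (by omega))
      have := hu0 (K + i)
      gcongr
  · intro n A h α₁ α₂ m k hn hh hA h1 h1' h2 h2'
    have hn0 : (0 : ℝ) < n := by exact_mod_cast (by omega : 0 < n)
    have hh0 : 0 < h := by rw [hh]; positivity
    have e1 := hinc (show α₁ ≤ α₁ + h by linarith)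
    have e2 := hinc (show α₂ ≤ α₂ + h by linarith)
    simp only [add_sub_cancel_left] at e1 e2
    rcases le_or_gt N n with hNn | hnN
    · have hfn := hfN.trans (hmono hNn)
      calc _ ≤ (1 + (K : ℝ) / 200) * h := e1.2.1
        _ ≤ f n * h := by gcongr
        _ ≤ _ := by gcongr; linarith [hgt n]; exact e2.1
    suffices hd : (spike p u K (α₁ + h) - spike p u K α₁) -
        (spike p u K (α₂ + h) - spike p u K α₂) ≤ h / 100 by
      have := hgt n
      norm_num at this
      nlinarith
    obtain ⟨r, hr⟩ : ∃ r, r = Nat.log n (T + 1) := ⟨_, rfl⟩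
    have hr1 : (n : ℝ) ^ r ≤ T + 1 := by
      rw [hr]
      exact_mod_cast Nat.pow_log_le_self n (Nat.succ_ne_zero T)
    have hr2 : (T + 1 : ℝ) ≤ n * n ^ r := by
      rw [hr, mul_comm, ← pow_succ]
      exact_mod_cast (Nat.lt_pow_succ_log_self (by omega) (T + 1)).le
    rcases lt_or_ge m r with hmr | hmr
    · have hsh : s ≤ h := by
        rw [hs, hh]
        refine one_div_le_one_div_of_le (by positivity) (le_trans ?_ hr1)
        rw [← zpow_natCast]
        exact zpow_le_zpow_right₀ (by exact_mod_cast (by omega : 1 ≤ n)) hmr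
      have := e1.2.2
      rw [hKu] at this
      linarith
    · obtain ⟨z, hz⟩ := happrox n hnN.le
      rw [← hr, ← mul_assoc, ← hp] at hz
      have hpq : |p - z / (n : ℝ) ^ r| ≤ u (2 * K) := by
        have : p - z / (n : ℝ) ^ r = (p * n ^ r - z) / n ^ r := by field_simp
        rw [this, abs_div, abs_of_pos (show (0 : ℝ) < n ^ r by positivity),
          div_le_iff₀ (by positivity)]
        refine hz.trans ?_
        have hnN' : (n : ℝ) ≤ N := by exact_mod_cast hnN.le
        have h5 : 1 ≤ N * (s * n ^ r) := by
          calc (1 : ℝ) = s * (T + 1) := by linarith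
            _ ≤ s * (n * n ^ r) := by gcongr
            _ ≤ s * (N * n ^ r) := by gcongr
            _ = _ := by ring
        rw [div_le_iff₀ hQ0]
        simp only [hu]
        have h6 : s / K / ρ ^ (2 * K) * n ^ r * (K * N * ρ ^ (2 * K)) = N * (s * n ^ r) := by
          field_simp
        calc (1 : ℝ) ≤ _ := h5
          _ = _ := h6.symm
          _ ≤ _ := by gcongr
      have hAh : A + n * h = k / (n : ℝ) ^ m := by
        rw [hA, hh, zpow_add_one₀ hn0.ne']
        field_simp
        ring
      have hcore := sum_abs_increment_sub_le (q := z / (n : ℝ) ^ r) hK0 (Nat.succ_pos N') hnN.le hh0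
        hρ hlac (fun j hj => hpq.trans (hanti hj.le)) (by
          rw [hAh, hA]
          exact nadic_not_straddle (by omega) hmr k z) h1 h1' h2 h2'
      have := spike_increment_sub_le_sum p u K α₁ α₂ h
      linarith

theorem exists_measure_Ico_eq {Φ : ℝ → ℝ} (hc : Continuous Φ) (hm : Monotone Φ) :
    ∃ ν : Measure ℝ, ∀ a b, ν (Ico a b) = ENNReal.ofReal (Φ b - Φ a) := by
  refine ⟨(StieltjesFunction.mk Φ hm fun x => hc.continuousWithinAt).measure, fun a b => ?_⟩
  rw [StieltjesFunction.measure_Ico]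
  have h (x : ℝ) : Function.leftLim Φ x = Φ x := hc.continuousAt.continuousWithinAt.leftLim_eq
  exact congrArg₂ (fun y z => ENNReal.ofReal (y - z)) (h b) (h a)

theorem exists_spike_measure (f : ℕ → ℝ) (hmono : Monotone f) (hunb : ∀ B : ℝ, ∃ n, B < f n)
    (hgt : ∀ n, 1.01 < f n) (H : ℝ) :
    ∃ (ν : Measure ℝ) (x l B : ℝ), 0 ≤ B ∧
      (∀ a b, ENNReal.ofReal (b - a) ≤ ν (Ico a b)) ∧
      (∀ a b, a ≤ b → ν (Ico a b) ≤ ENNReal.ofReal (B * (b - a))) ∧ ν (Ico 0 1) ≤ 2 ∧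
      0 < l ∧ 0 ≤ x - l ∧ x + l ≤ 1 ∧ ν (Ico x (x + l)) ≤ ENNReal.ofReal l ∧
      ENNReal.ofReal (H * l) ≤ ν (Ico (x - l) x) ∧
      ∀ n : ℕ, 2 ≤ n → ∀ J₁ J₂ : Set ℝ, NAdicSiblings n J₁ J₂ →
        ν J₁ ≤ ENNReal.ofReal (f n) * ν J₂ := by
  obtain ⟨Φ, x, l, B, hc, hB, hΦ, hΦ1, hl, hxl, hlx, hI₂, hI₁, hdoub⟩ :=
    exists_spike f hmono hunb hgt H
  obtain ⟨ν, hν⟩ := exists_measure_Ico_eq hc fun a b hab => by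
    linarith [(hΦ a b hab).1]
  refine ⟨ν, x, l, B, hB, fun a b => ?_, fun a b hab => ?_, ?_, hl, hxl, hlx, ?_, ?_, ?_⟩
  · rcases le_or_gt a b with hab | hab
    · rw [hν]
      exact ENNReal.ofReal_le_ofReal (hΦ a b hab).1
    · rw [ENNReal.ofReal_of_nonpos (by linarith)]
      exact zero_le
  · rw [hν]
    exact ENNReal.ofReal_le_ofReal (hΦ a b hab).2
  · rw [hν]
    exact (ENNReal.ofReal_le_ofReal hΦ1).trans (by simp)
  · rw [hν]
    exact ENNReal.ofReal_le_ofReal hI₂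
  · rw [hν]
    exact ENNReal.ofReal_le_ofReal hI₁
  · rintro n hn J₁ J₂ ⟨m, k₁, k₂, k, rfl, rfl, h₁, h₂⟩
    have hn0 : (0 : ℝ) < n := by exact_mod_cast (by omega : 0 < n)
    have hpos (j : ℤ) : (0 : ℝ) < (n : ℝ) ^ j := zpow_pos hn0 j
    have hlt (j : ℤ) : ((j : ℝ) - 1) / (n : ℝ) ^ (m + 1) < j / (n : ℝ) ^ (m + 1) :=
      div_lt_div_of_pos_right (by linarith) (hpos _)
    have hend (j : ℤ) : (j : ℝ) / (n : ℝ) ^ (m + 1) =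
        (j - 1) / (n : ℝ) ^ (m + 1) + 1 / (n : ℝ) ^ (m + 1) := by ring
    have hpar : (k : ℝ) / (n : ℝ) ^ m =
        (k - 1) / (n : ℝ) ^ m + n * (1 / (n : ℝ) ^ (m + 1)) := by
      have := (hpos m).ne'
      rw [zpow_add_one₀ hn0.ne']
      field_simp
      ring
    unfold nadicI at h₁ h₂ ⊢
    rw [Ico_subset_Ico_iff (hlt _), hend, hpar] at h₁ h₂
    rw [hν, hν, ← ENNReal.ofReal_mul (by linarith [hgt n]), hend, hend k₂]
    exact ENNReal.ofReal_le_ofReal (hdoub n _ _ _ _ m k hn rfl rfl h₁.1 h₁.2 h₂.1 h₂.2)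

/-- The tail of a series of measures with geometrically small weights. -/
theorem tsum_ofReal_mul_le {l : ℝ} (hl : 0 ≤ l) {c : ℕ → ℝ} (hc : ∀ i, c i ≤ l / 4 * (1 / 2) ^ i)
    {v : ℕ → ℝ≥0∞} (hv : ∀ i, v i ≤ 2) :
    ∑' i, ENNReal.ofReal (c i) * v i ≤ ENNReal.ofReal l := by
  calc ∑' i, ENNReal.ofReal (c i) * v i
      ≤ ∑' i : ℕ, ENNReal.ofReal (l / 4 * (1 / 2) ^ i) * 2 := by
        gcongr with i
        · exact hc i
        · exact hv i
    _ = ENNReal.ofReal l := by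
        rw [ENNReal.tsum_mul_right, ← ENNReal.ofReal_tsum_of_nonneg (fun i => by positivity)
          (summable_geometric_two.mul_left _), tsum_mul_left, tsum_geometric_two,
          ← ENNReal.ofReal_ofNat 2, ← ENNReal.ofReal_mul (by positivity)]
        congr 1
        ring

/-- Theorem 4.4 of the paper: for any increasing unbounded `f` with
`f(n) > 1.01`, there is a measure on `[0,1)` that is `n`-adic doubling with constant at
most `f(n)` for every `n ≥ 2`, yet not doubling on `[0,1)`. -/
theorem exists_measure_with_prescribed_nadic_constants
    (f : ℕ → ℝ) (hmono : Monotone f) (hunb : ∀ B : ℝ, ∃ n, B < f n)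
    (hgt : ∀ n, 1.01 < f n) :
    ∃ μ : Measure ℝ,
      (∀ x y : ℝ, 0 ≤ x → x < y → y ≤ 1 → 0 < μ (Set.Ico x y) ∧ μ (Set.Ico x y) < ⊤) ∧
      (∀ n : ℕ, 2 ≤ n → ∀ J₁ J₂ : Set ℝ, NAdicSiblings n J₁ J₂ →
        J₁ ⊆ Set.Ico 0 1 → J₂ ⊆ Set.Ico 0 1 → μ J₁ ≤ ENNReal.ofReal (f n) * μ J₂) ∧
      (∀ C : ℝ, 0 < C → ∃ I₁ I₂ : Set ℝ, AdjacentPair I₁ I₂ ∧ I₁ ⊆ Set.Ico 0 1 ∧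
        I₂ ⊆ Set.Ico 0 1 ∧ ENNReal.ofReal C * μ I₂ < μ I₁) := by
  choose ν x l B hB hlow hupp hmass hl hxl hlx hI₂ hI₁ hdoub using
    exists_spike_measure f hmono hunb hgt
  -- The state `(c, b)` records a weight `c` and a bound `b` on the density built so far; the next
  -- spike is chosen so tall that it dominates this density even after multiplication by `c`.
  let height : ℝ × ℝ → ℝ := fun S => (S.2 + 2) ^ 2 / S.1
  let step : ℝ × ℝ → ℝ × ℝ := fun S =>
    (min S.1 (l (height S)) / 4, S.2 + 1 + S.1 * B (height S))
  let S : ℕ → ℝ × ℝ := fun k => step^[k] (1 / 4, 0)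
  obtain ⟨c, hc⟩ : ∃ c : ℕ → ℝ, c = fun k => (S k).1 := ⟨_, rfl⟩
  obtain ⟨b, hb⟩ : ∃ b : ℕ → ℝ, b = fun k => (S k).2 := ⟨_, rfl⟩
  obtain ⟨H, hH⟩ : ∃ H : ℕ → ℝ, H = fun k => (b k + 2) ^ 2 / c k := ⟨_, rfl⟩
  have hstep (k : ℕ) : S (k + 1) = step (S k) := Function.iterate_succ_apply' _ _ _
  have hc0 : c 0 = 1 / 4 := by rw [hc]; rfl
  have hb0 : b 0 = 0 := by rw [hb]; rfl
  have hcs (k : ℕ) : c (k + 1) = min (c k) (l (H k)) / 4 := by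
    subst hH hc hb; exact congrArg Prod.fst (hstep k)
  have hbs (k : ℕ) : b (k + 1) = b k + 1 + c k * B (H k) := by
    subst hH hc hb; exact congrArg Prod.snd (hstep k)
  clear_value S
  have hcpos (k : ℕ) : 0 < c k := by
    induction k with
    | zero => rw [hc0]; norm_num
    | succ k ih => rw [hcs]; have := hl (H k); positivity
  have hcle (k i : ℕ) : c (k + i) ≤ c k * (1 / 2) ^ i := by
    induction i with
    | zero => simp
    | succ i ih =>
      have := min_le_left (c (k + i)) (l (H (k + i)))
      have := hcpos (k + i)
      rw [← add_assoc, hcs, pow_succ]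
      linarith
  have hkb (k : ℕ) : (k : ℝ) ≤ b k := by
    induction k with
    | zero => simp [hb0]
    | succ k ih =>
      have := mul_nonneg (hcpos k).le (hB (H k))
      rw [hbs]; push_cast; linarith
  have hb_nonneg (k : ℕ) : 0 ≤ b k := (Nat.cast_nonneg k).trans (hkb k)
  have hhead (k : ℕ) {α β : ℝ} (h : α ≤ β) :
      ∑ j ∈ Finset.range k, ENNReal.ofReal (c j) * ν (H j) (Ico α β) ≤
        ENNReal.ofReal (b k * (β - α)) := by
    induction k with
    | zero => simp
    | succ k ih =>
      have h1 : 0 ≤ β - α := sub_nonneg.mpr h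
      rw [Finset.sum_range_succ, hbs]
      refine (add_le_add ih (mul_le_mul_right (hupp _ _ _ h) _)).trans ?_
      rw [← ENNReal.ofReal_mul (hcpos k).le, ← ENNReal.ofReal_add
        (mul_nonneg (hb_nonneg k) h1)
        (mul_nonneg (hcpos k).le (mul_nonneg (hB _) h1))]
      apply ENNReal.ofReal_le_ofReal
      linarith
  let μ : Measure ℝ := Measure.sum fun k => ENNReal.ofReal (c k) • ν (H k)
  have hμ {s : Set ℝ} (hs : MeasurableSet s) :
      μ s = ∑' k, ENNReal.ofReal (c k) * ν (H k) s := by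
    simp [μ, Measure.sum_apply _ hs]
  have hmass' (k : ℕ) {α β : ℝ} (hα : 0 ≤ α) (hβ : β ≤ 1) : ν (H k) (Ico α β) ≤ 2 :=
    (measure_mono (Ico_subset_Ico hα hβ)).trans (hmass _)
  refine ⟨μ, fun α β hα hαβ hβ => ⟨?_, ?_⟩, ?_, ?_⟩
  · rw [hμ measurableSet_Ico]
    refine lt_of_lt_of_le ?_ (ENNReal.le_tsum 0)
    refine ENNReal.mul_pos (ENNReal.ofReal_pos.mpr (hcpos 0)).ne' ?_
    exact ((ENNReal.ofReal_pos.mpr (sub_pos.mpr hαβ)).trans_le (hlow _ _ _)).ne'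
  · rw [hμ measurableSet_Ico]
    refine (tsum_ofReal_mul_le zero_le_one (fun i => ?_) fun i => hmass' i hα hβ).trans_lt
      ENNReal.ofReal_lt_top
    simpa [hc0] using hcle 0 i
  · intro n hn J₁ J₂ hJ _ _
    have hmeas : MeasurableSet J₁ ∧ MeasurableSet J₂ := by
      obtain ⟨m, k₁, k₂, k, rfl, rfl, -⟩ := hJ
      exact ⟨measurableSet_Ico, measurableSet_Ico⟩
    rw [hμ hmeas.1, hμ hmeas.2, ← ENNReal.tsum_mul_left]
    refine ENNReal.tsum_le_tsum fun k => ?_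
    rw [mul_left_comm]
    gcongr
    exact hdoub _ n hn J₁ J₂ hJ
  · intro C hC
    obtain ⟨k, hk⟩ := exists_nat_gt C
    have hlk := hl (H k)
    have hbk := hb_nonneg k
    have hCb : C < b k + 2 := by linarith [hkb k]
    refine ⟨Ico (x (H k) - l (H k)) (x (H k)), Ico (x (H k)) (x (H k) + l (H k)),
      ⟨x (H k), l (H k), hlk, Or.inl ⟨rfl, rfl⟩⟩,
      Ico_subset_Ico (hxl _) (by linarith [hlx (H k)]),
      Ico_subset_Ico (by linarith [hxl (H k)]) (hlx _), ?_⟩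
    have hhigh : ENNReal.ofReal ((b k + 2) ^ 2 * l (H k)) ≤
        μ (Ico (x (H k) - l (H k)) (x (H k))) := by
      rw [hμ measurableSet_Ico]
      refine le_trans ?_ (ENNReal.le_tsum k)
      refine le_trans ?_ (mul_le_mul_right (hI₁ (H k)) _)
      rw [← ENNReal.ofReal_mul (hcpos k).le]
      apply ENNReal.ofReal_le_ofReal
      have : c k * H k = (b k + 2) ^ 2 := by
        rw [hH]
        have := (hcpos k).ne'
        field_simp
      rw [← mul_assoc, this]
    have hck : c k ≤ 1 := by
      have h1 := hcle 0 k
      have h2 : (1 / 2 : ℝ) ^ k ≤ 1 := pow_le_one₀ (by norm_num) (by norm_num)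
      rw [zero_add, hc0] at h1
      linarith
    have hlowside : μ (Ico (x (H k)) (x (H k) + l (H k))) ≤
        ENNReal.ofReal ((b k + 2) * l (H k)) := by
      rw [hμ measurableSet_Ico, ← ENNReal.summable.sum_add_tsum_nat_add' (k := k + 1),
        Finset.sum_range_succ]
      have h1 := hhead k (show x (H k) ≤ x (H k) + l (H k) by linarith)
      have h2 : ENNReal.ofReal (c k) * ν (H k) (Ico (x (H k)) (x (H k) + l (H k))) ≤
          ENNReal.ofReal (l (H k)) :=
        (mul_le_of_le_one_left zero_le (ENNReal.ofReal_le_one.mpr hck)).trans (hI₂ _)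
      have h3 := tsum_ofReal_mul_le hlk.le (c := fun i => c (i + (k + 1)))
        (v := fun i => ν (H (i + (k + 1))) (Ico (x (H k)) (x (H k) + l (H k)))) (fun i => by
          rw [add_comm]
          refine (hcle (k + 1) i).trans ?_
          gcongr
          rw [hcs]
          gcongr
          exact min_le_right _ _)
        (fun i => hmass' _ (by linarith [hxl (H k)]) (hlx _))
      refine (add_le_add (add_le_add h1 h2) h3).trans ?_
      rw [← ENNReal.ofReal_add (by rw [add_sub_cancel_left]; positivity) hlk.le,
        ← ENNReal.ofReal_add (by rw [add_sub_cancel_left]; positivity) hlk.le]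
      apply ENNReal.ofReal_le_ofReal
      linarith
    refine lt_of_le_of_lt (mul_le_mul_right hlowside _) (lt_of_lt_of_le ?_ hhigh)
    rw [← ENNReal.ofReal_mul hC.le]
    refine (ENNReal.ofReal_lt_ofReal_iff (by positivity)).mpr ?_
    rw [← mul_assoc, pow_two]
    gcongr
end

section
/- Let r > 1, let I ⊆ ℝ be a bounded interval partitioned into finitely many pairwise disjoint intervals I₁, …, I_m of positive length with I = I₁ ∪ ⋯ ∪ I_m, and let f : I → [0,∞) be measurable with f^r integrable on I. Suppose that for each j there is C_j ≥ 0 with (⨍_{I_j} f^r)^{1/r} ≤ C_j · (⨍_{I_j} f). Then (⨍_I f^r)^{1/r} ≤ m^{1/r} · max_j [ C_j · (|I|/|I_j|)^{1 − 1/r} ] · (⨍_I f), and consequently (⨍_I f^r)^{1/r} ≤ (max_j C_j) · (max_j |I|/|I_j|) · (⨍_I f). -/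
open MeasureTheory Set

/-- Superadditivity of `x ↦ x ^ r` on nonnegative reals for `1 < r`, over a finite sum. -/
theorem sum_rpow_le_rpow_sum {ι : Type*} (s : Finset ι) {r : ℝ} (hr : 1 < r) (x : ι → ℝ)
    (hx : ∀ i ∈ s, 0 ≤ x i) : ∑ i ∈ s, x i ^ r ≤ (∑ i ∈ s, x i) ^ r := by
  have split : ∀ y : ℝ, 0 ≤ y → y ^ r = y * y ^ (r - 1) := fun y hy => by
    rw [← Real.rpow_one_add' hy (by linarith)]
    congr 1
    ring
  rw [split _ (Finset.sum_nonneg hx), Finset.sum_mul]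
  refine Finset.sum_le_sum fun i hi => ?_
  rw [split _ (hx i hi)]
  exact mul_le_mul_of_nonneg_left (Real.rpow_le_rpow (hx i hi)
    (Finset.single_le_sum hx hi) (by linarith)) (hx i hi)

/-- On a set of finite measure, a nonnegative measurable function with integrable `r`-th power,
`1 < r`, is integrable. -/
theorem integrableOn_of_integrableOn_rpow {α : Type*} [MeasurableSpace α] {μ : Measure α}
    {s : Set α} (hs : MeasurableSet s) (hμ : μ s ≠ ⊤) {r : ℝ} (hr : 1 < r) {f : α → ℝ}
    (hf : Measurable f) (hf0 : ∀ x ∈ s, 0 ≤ f x) (hint : IntegrableOn (fun x => f x ^ r) s μ) :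
    IntegrableOn f s μ := by
  refine Integrable.mono' ((integrableOn_const (C := (1 : ℝ)) hμ).add hint)
    hf.aestronglyMeasurable ?_
  filter_upwards [ae_restrict_mem hs] with x hx
  have h0 := hf0 x hx
  rw [Real.norm_of_nonneg h0, Pi.add_apply]
  rcases le_total (f x) 1 with h | h
  · linarith [Real.rpow_nonneg h0 r]
  · linarith [Real.self_le_rpow_of_one_le h hr.le]

/-- The numerical core of the combination of reverse Hölder inequalities: `A j` and `F j` are the
integrals of `f ^ r` and `f` over the piece of length `l j`, and `L` is the total length. -/
theorem rpow_sum_div_le {ι : Type*} (s : Finset ι) {r : ℝ} (hr : 1 < r) {L K : ℝ} (hL : 0 < L)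
    (hK : 0 ≤ K) (l A F C : ι → ℝ) (hl : ∀ j, 0 < l j) (hA : ∀ j, 0 ≤ A j) (hF : ∀ j, 0 ≤ F j)
    (hRH : ∀ j, (A j / l j) ^ (1 / r) ≤ C j * (F j / l j))
    (hCK : ∀ j, C j * (L / l j) ^ (1 - 1 / r) ≤ K) :
    ((∑ j ∈ s, A j) / L) ^ (1 / r) ≤ K * ((∑ j ∈ s, F j) / L) := by
  have hr0 : 0 < r := by linarith
  have piece : ∀ j, A j / L ≤ (K * (F j / L)) ^ r := fun j => by
    have hlj := hl j
    have hq : 0 < L / l j := by positivity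
    rw [← Real.rpow_inv_le_iff_of_pos (div_nonneg (hA j) hL.le)
      (mul_nonneg hK (div_nonneg (hF j) hL.le)) hr0, ← one_div]
    have hAL : A j / L = (A j / l j) / (L / l j) := by field_simp
    have hFL : F j / l j = (L / l j) * (F j / L) := by field_simp
    calc (A j / L) ^ (1 / r) = (A j / l j) ^ (1 / r) / (L / l j) ^ (1 / r) := by
          rw [hAL, Real.div_rpow (div_nonneg (hA j) hlj.le) hq.le]
      _ ≤ C j * (F j / l j) / (L / l j) ^ (1 / r) := by gcongr; exact hRH j
      _ = C j * (L / l j) ^ (1 - 1 / r) * (F j / L) := by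
          rw [Real.rpow_sub hq, Real.rpow_one, hFL]
          ring
      _ ≤ K * (F j / L) := mul_le_mul_of_nonneg_right (hCK j) (div_nonneg (hF j) hL.le)
  have hnn : ∀ j, 0 ≤ K * (F j / L) := fun j => mul_nonneg hK (div_nonneg (hF j) hL.le)
  rw [one_div, Real.rpow_inv_le_iff_of_pos
    (div_nonneg (Finset.sum_nonneg fun j _ => hA j) hL.le)
    (mul_nonneg hK (div_nonneg (Finset.sum_nonneg fun j _ => hF j) hL.le)) hr0,
    Finset.sum_div, Finset.sum_div, Finset.mul_sum]
  exact (Finset.sum_le_sum fun j _ => piece j).trans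
    (sum_rpow_le_rpow_sum s hr _ fun j _ => hnn j)

theorem setAverage_Ico_eq_div (g : ℝ → ℝ) {c d : ℝ} (h : c ≤ d) :
    ⨍ x in Set.Ico c d, g x = (∫ x in Set.Ico c d, g x) / (d - c) := by
  rw [setAverage_eq, Real.volume_real_Ico_of_le h, smul_eq_mul, inv_mul_eq_div]

/-- Lemma 5.1, first part: combining reverse Hölder constants over a
finite partition of an interval. -/
theorem reverseHolder_of_partition
    (r : ℝ) (hr : 1 < r) (u v : ℝ) (huv : u < v)
    (m : ℕ) (hm : 0 < m) (a b : Fin m → ℝ) (hab : ∀ j, a j < b j)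
    (hdisj : ∀ i j, i ≠ j → Disjoint (Set.Ico (a i) (b i)) (Set.Ico (a j) (b j)))
    (hcover : (⋃ j, Set.Ico (a j) (b j)) = Set.Ico u v)
    (f : ℝ → ℝ) (hf : Measurable f) (hf0 : ∀ x ∈ Set.Ico u v, 0 ≤ f x)
    (hint : IntegrableOn (fun x => f x ^ r) (Set.Ico u v))
    (C : Fin m → ℝ) (hC : ∀ j, 0 ≤ C j)
    (hRH : ∀ j, (⨍ x in Set.Ico (a j) (b j), f x ^ r) ^ (1 / r) ≤
      C j * ⨍ x in Set.Ico (a j) (b j), f x) :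
    (⨍ x in Set.Ico u v, f x ^ r) ^ (1 / r) ≤
      (m : ℝ) ^ ((1:ℝ) / r) * (⨆ j, C j * ((v - u) / (b j - a j)) ^ (1 - 1 / r)) *
        ⨍ x in Set.Ico u v, f x ∧
    (⨍ x in Set.Ico u v, f x ^ r) ^ (1 / r) ≤
      (⨆ j, C j) * (⨆ j, (v - u) / (b j - a j)) * ⨍ x in Set.Ico u v, f x := by
  have hr0 : 0 < r := by linarith
  have hL : 0 < v - u := sub_pos.2 huv
  have hl : ∀ j, 0 < b j - a j := fun j => sub_pos.2 (hab j)
  have hsub : ∀ j, Set.Ico (a j) (b j) ⊆ Set.Ico u v := fun j => by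
    rw [← hcover]
    exact Set.subset_iUnion (fun j => Set.Ico (a j) (b j)) j
  have hratio : ∀ j, 1 ≤ (v - u) / (b j - a j) := fun j => by
    obtain ⟨h₁, h₂⟩ := (Set.Ico_subset_Ico_iff (hab j)).1 (hsub j)
    rw [one_le_div (hl j)]
    linarith
  have hfint : IntegrableOn f (Set.Ico u v) :=
    integrableOn_of_integrableOn_rpow measurableSet_Ico (by simp) hr hf hf0 hint
  have hsum : ∀ g : ℝ → ℝ, IntegrableOn g (Set.Ico u v) →
      ∫ x in Set.Ico u v, g x = ∑ j, ∫ x in Set.Ico (a j) (b j), g x := fun g hg => by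
    rw [← hcover]
    exact integral_iUnion_fintype (fun _ => measurableSet_Ico) (fun i j hij => hdisj i j hij)
      fun j => hg.mono_set (hsub j)
  have hF : ∀ j, 0 ≤ ∫ x in Set.Ico (a j) (b j), f x := fun j =>
    setIntegral_nonneg measurableSet_Ico fun x hx => hf0 x (hsub j hx)
  have hA : ∀ j, 0 ≤ ∫ x in Set.Ico (a j) (b j), f x ^ r := fun j =>
    setIntegral_nonneg measurableSet_Ico fun x hx => Real.rpow_nonneg (hf0 x (hsub j hx)) r
  have hav : 0 ≤ ⨍ x in Set.Ico u v, f x := by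
    rw [setAverage_Ico_eq_div _ huv.le]
    exact div_nonneg (setIntegral_nonneg measurableSet_Ico hf0) hL.le
  have hRH' : ∀ j, ((∫ x in Set.Ico (a j) (b j), f x ^ r) / (b j - a j)) ^ (1 / r) ≤
      C j * ((∫ x in Set.Ico (a j) (b j), f x) / (b j - a j)) := fun j => by
    simpa only [setAverage_Ico_eq_div _ (hab j).le] using hRH j
  set K := ⨆ j, C j * ((v - u) / (b j - a j)) ^ (1 - 1 / r)
  have hCK : ∀ j, C j * ((v - u) / (b j - a j)) ^ (1 - 1 / r) ≤ K := fun j =>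
    le_ciSup (f := fun j => C j * ((v - u) / (b j - a j)) ^ (1 - 1 / r))
      (Set.finite_range _).bddAbove j
  have hK : 0 ≤ K := Real.iSup_nonneg fun j =>
    mul_nonneg (hC j) (Real.rpow_nonneg (by linarith [hratio j]) _)
  have key : (⨍ x in Set.Ico u v, f x ^ r) ^ (1 / r) ≤ K * ⨍ x in Set.Ico u v, f x := by
    rw [setAverage_Ico_eq_div _ huv.le, setAverage_Ico_eq_div _ huv.le, hsum _ hint, hsum _ hfint]
    exact rpow_sum_div_le Finset.univ hr hL hK _ _ _ C hl hA hF hRH' hCK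
  refine ⟨key.trans (mul_le_mul_of_nonneg_right ?_ hav),
    key.trans (mul_le_mul_of_nonneg_right ?_ hav)⟩
  · exact le_mul_of_one_le_left hK
      (Real.one_le_rpow (by exact_mod_cast hm) (by positivity))
  · have : Nonempty (Fin m) := ⟨⟨0, hm⟩⟩
    refine ciSup_le fun j => ?_
    refine mul_le_mul (le_ciSup (Set.finite_range C).bddAbove j) ?_
      (Real.rpow_nonneg (by linarith [hratio j]) _) (Real.iSup_nonneg hC)
    refine le_trans ?_ (le_ciSup (f := fun j => (v - u) / (b j - a j))
      (Set.finite_range _).bddAbove j)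
    exact Real.rpow_le_self_of_one_le (hratio j) (sub_le_self _ (by positivity))
end

section
/- For every r with 1 < r < ∞, there exists a measurable weight w : [0,1) → (0,∞), with w and w^r integrable on [0,1), such that for every integer n ≥ 2 there is a constant C(n) with (⨍_J w^r)^{1/r} ≤ C(n) · (⨍_J w) for every n-adic interval J ⊆ [0,1), yet there is no constant C such that (⨍_I w^r)^{1/r} ≤ C · (⨍_I w) holds for all intervals I ⊆ [0,1) of positive length. -/
open MeasureTheory Set
open scoped ENNReal

/-- The function equal to `1` on `(-∞, 1/2]` and to `(x - 1/2) ^ (-s)` on `(1/2, ∞)`. -/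
noncomputable def halfPow (s x : ℝ) : ℝ :=
  if x ≤ 1 / 2 then 1 else (x - 1 / 2) ^ (-s)

lemma measurable_halfPow (s : ℝ) : Measurable (halfPow s) :=
  Measurable.ite measurableSet_Iic measurable_const
    ((measurable_id.sub_const _).pow_const _)

lemma halfPow_pos (s x : ℝ) : 0 < halfPow s x := by
  unfold halfPow
  split_ifs with h
  · exact one_pos
  · exact Real.rpow_pos_of_pos (by linarith) _

lemma halfPow_rpow (s r x : ℝ) : halfPow s x ^ r = halfPow (s * r) x := by
  unfold halfPow
  split_ifs with h
  · exact Real.one_rpow r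
  · rw [← Real.rpow_mul (by linarith)]
    congr 1
    ring

lemma halfPow_eqOn_left {s u v : ℝ} (huv : u ≤ v) (hv : v ≤ 1 / 2) :
    EqOn (fun _ => 1) (halfPow s) (uIoc u v) := by
  intro x hx
  rw [uIoc_of_le huv] at hx
  simp only [halfPow]
  rw [if_pos (hx.2.trans hv)]

lemma halfPow_eqOn_right {s u v : ℝ} (hu : 1 / 2 ≤ u) (huv : u ≤ v) :
    EqOn (fun x => (x - 1 / 2) ^ (-s)) (halfPow s) (uIoc u v) := by
  intro x hx
  rw [uIoc_of_le huv] at hx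
  simp only [halfPow]
  rw [if_neg (by linarith [hx.1])]

lemma integral_halfPow_left {s u v : ℝ} (huv : u ≤ v) (hv : v ≤ 1 / 2) :
    ∫ x in u..v, halfPow s x = v - u := by
  rw [← intervalIntegral.integral_congr_ae
    (Filter.Eventually.of_forall (halfPow_eqOn_left huv hv))]
  simp

lemma integral_halfPow_right {s u v : ℝ} (hs : s < 1) (hu : 1 / 2 ≤ u) (huv : u ≤ v) :
    ∫ x in u..v, halfPow s x =
      ((v - 1 / 2) ^ (1 - s) - (u - 1 / 2) ^ (1 - s)) / (1 - s) := by
  rw [← intervalIntegral.integral_congr_ae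
    (Filter.Eventually.of_forall (halfPow_eqOn_right hu huv)),
    intervalIntegral.integral_comp_sub_right (fun x => x ^ (-s)) (1 / 2),
    integral_rpow (Or.inl (by linarith)), neg_add_eq_sub]

lemma intervalIntegrable_halfPow_left {s u : ℝ} (hu : u ≤ 1 / 2) :
    IntervalIntegrable (halfPow s) volume u (1 / 2) :=
  (intervalIntegrable_const (c := (1 : ℝ))).congr (halfPow_eqOn_left hu le_rfl)

lemma intervalIntegrable_halfPow_right {s v : ℝ} (hs : s < 1) (hv : 1 / 2 ≤ v) :
    IntervalIntegrable (halfPow s) volume (1 / 2) v := by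
  refine IntervalIntegrable.congr (halfPow_eqOn_right le_rfl hv) ?_
  have h := (intervalIntegral.intervalIntegrable_rpow' (a := 0) (b := v - 1 / 2)
    (show -1 < -s by linarith)).comp_sub_right (1 / 2)
  simpa using h

lemma integral_halfPow_across {s u v : ℝ} (hs : s < 1) (hu : u ≤ 1 / 2) (hv : 1 / 2 ≤ v) :
    ∫ x in u..v, halfPow s x = (1 / 2 - u) + (v - 1 / 2) ^ (1 - s) / (1 - s) := by
  rw [← intervalIntegral.integral_add_adjacent_intervals (intervalIntegrable_halfPow_left hu)
    (intervalIntegrable_halfPow_right hs hv), integral_halfPow_left hu le_rfl,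
    integral_halfPow_right hs le_rfl hv, sub_self, Real.zero_rpow (by linarith), sub_zero]

lemma setAverage_Ico_eq {f : ℝ → ℝ} {u v : ℝ} (huv : u < v) :
    ⨍ x in Ico u v, f x = (∫ x in u..v, f x) / (v - u) := by
  rw [setAverage_eq, Real.volume_real_Ico_of_le huv.le, integral_Ico_eq_integral_Ioc,
    intervalIntegral.integral_of_le huv.le, smul_eq_mul, div_eq_inv_mul]

lemma integrableOn_halfPow {s : ℝ} (hs : s < 1) : IntegrableOn (halfPow s) (Ico 0 1) := by
  rw [integrableOn_Ico_iff_integrableOn_Ioo, ← integrableOn_Ioc_iff_integrableOn_Ioo,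
    ← intervalIntegrable_iff_integrableOn_Ioc_of_le zero_le_one]
  exact (intervalIntegrable_halfPow_left (by norm_num)).trans
    (intervalIntegrable_halfPow_right hs (by norm_num))

lemma rpow_one_sub_eq {q s : ℝ} (hq : 0 < q) : q ^ (1 - s) = q * q ^ (-s) := by
  rw [sub_eq_add_neg, Real.rpow_add hq, Real.rpow_one]

lemma mul_rpow_neg_le {p q s : ℝ} (hs0 : 0 ≤ s) (hs : s < 1) (hp : 0 ≤ p) (hpq : p ≤ q) :
    p * q ^ (-s) ≤ p ^ (1 - s) := by
  rcases hp.eq_or_lt with rfl | hp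
  · simp [Real.zero_rpow (by linarith : 1 - s ≠ 0)]
  · rw [rpow_one_sub_eq hp]
    exact mul_le_mul_of_nonneg_left
      (Real.rpow_le_rpow_of_nonpos hp hpq (by linarith)) hp.le

/-- Upper bound for the averages of `halfPow` over intervals to the right of `1/2`, or symmetric
about `1/2`. -/
lemma average_halfPow_le {s u v : ℝ} (hs0 : 0 ≤ s) (hs : s < 1) (huv : u < v) (hv : 1 / 2 < v)
    (hv1 : v ≤ 1) (h : 1 / 2 ≤ u ∨ u + v = 1) :
    ⨍ x in Ico u v, halfPow s x ≤ (v - 1 / 2) ^ (-s) / (1 - s) := by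
  have hq : 0 < v - 1 / 2 := by linarith
  have h1s : 0 < 1 - s := by linarith
  rw [setAverage_Ico_eq huv, div_le_iff₀ (by linarith)]
  rcases h with h | h
  · rw [integral_halfPow_right hs h huv.le, div_mul_eq_mul_div]
    gcongr
    have := mul_rpow_neg_le hs0 hs (by linarith : 0 ≤ u - 1 / 2)
      (by linarith : u - 1 / 2 ≤ v - 1 / 2)
    rw [rpow_one_sub_eq hq]
    linarith
  · rw [integral_halfPow_across hs (by linarith) hv.le, rpow_one_sub_eq hq]
    have h1 : 1 ≤ (v - 1 / 2) ^ (-s) / (1 - s) := by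
      rw [le_div_iff₀ h1s]
      have := Real.one_le_rpow_of_pos_of_le_one_of_nonpos hq (by linarith)
        (by linarith : -s ≤ 0)
      linarith
    have h2 := mul_le_mul_of_nonneg_left h1 hq.le
    rw [show u = 1 - v by linarith, mul_div_assoc]
    linarith

/-- Lower bound for the averages of `halfPow` over intervals to the right of `1/2`, or symmetric
about `1/2`. -/
lemma le_average_halfPow {s u v : ℝ} (hs0 : 0 ≤ s) (hs : s < 1) (huv : u < v) (hv : 1 / 2 < v)
    (h : 1 / 2 ≤ u ∨ u + v = 1) :
    (v - 1 / 2) ^ (-s) / 2 ≤ ⨍ x in Ico u v, halfPow s x := by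
  have hq : 0 < v - 1 / 2 := by linarith
  have hqs : 0 < (v - 1 / 2) ^ (-s) := Real.rpow_pos_of_pos hq _
  have h1s : 0 < 1 - s := by linarith
  rw [setAverage_Ico_eq huv, le_div_iff₀ (by linarith)]
  rcases h with h | h
  · have hle : ∫ _ in u..v, (v - 1 / 2) ^ (-s) ≤ ∫ x in u..v, halfPow s x := by
      refine intervalIntegral.integral_mono_on_of_le_Ioo huv.le intervalIntegrable_const ?_ ?_
      · exact (intervalIntegrable_halfPow_right hs hv.le).mono_set
          (by rw [uIcc_of_le huv.le, uIcc_of_le hv.le]; exact Icc_subset_Icc_left h)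
      · intro x hx
        simp only [halfPow]
        rw [if_neg (by linarith [hx.1])]
        exact Real.rpow_le_rpow_of_nonpos (by linarith [hx.1]) (by linarith [hx.2])
          (by linarith)
    rw [intervalIntegral.integral_const, smul_eq_mul] at hle
    nlinarith
  · rw [integral_halfPow_across hs (by linarith) hv.le, rpow_one_sub_eq hq]
    have h2 : (v - 1 / 2) * (v - 1 / 2) ^ (-s) ≤
        (v - 1 / 2) * (v - 1 / 2) ^ (-s) / (1 - s) := by
      rw [le_div_iff₀ h1s]
      nlinarith [mul_pos hq hqs]
    rw [show u = 1 - v by linarith]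
    linarith

/-- An `n`-adic subinterval of `[0,1)` lies on one side of `1/2` or is symmetric about `1/2`. -/
lemma nadic_le_half_or_half_le_or_symm {n : ℕ} (hn : 2 ≤ n) {m k : ℤ}
    (hm : (k : ℝ) / (n : ℝ) ^ m - (k - 1 : ℝ) / (n : ℝ) ^ m ≤ 1) :
    (k : ℝ) / (n : ℝ) ^ m ≤ 1 / 2 ∨ 1 / 2 ≤ (k - 1 : ℝ) / (n : ℝ) ^ m ∨
      (k - 1 : ℝ) / (n : ℝ) ^ m + (k : ℝ) / (n : ℝ) ^ m = 1 := by
  have hn1 : (1 : ℝ) < n := by exact_mod_cast hn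
  have hpos : (0 : ℝ) < (n : ℝ) ^ m := by positivity
  have hm0 : 0 ≤ m := by
    rw [← sub_div, sub_sub_cancel, div_le_one hpos] at hm
    exact (one_le_zpow_iff_right₀ hn1).1 hm
  lift m to ℕ using hm0
  rw [zpow_natCast] at *
  rw [div_le_div_iff₀ hpos two_pos, div_le_div_iff₀ two_pos hpos, ← add_div,
    div_eq_one_iff_eq hpos.ne']
  have key : k * 2 ≤ 1 * (n : ℤ) ^ m ∨ 1 * (n : ℤ) ^ m ≤ (k - 1) * 2 ∨
      k - 1 + k = (n : ℤ) ^ m := by omega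
  exact_mod_cast key

/-- Theorem 5.2: for every `1 < r < ∞` there is a weight on `[0,1)`
satisfying the reverse Hölder-`r` inequality over every `n`-adic interval for every
`n ≥ 2`, but failing it over arbitrary intervals. -/
theorem exists_nadic_reverseHolder_not_reverseHolder (r : ℝ) (hr : 1 < r) :
    ∃ w : ℝ → ℝ, Measurable w ∧ (∀ x ∈ Set.Ico (0:ℝ) 1, 0 < w x) ∧
      IntegrableOn w (Set.Ico 0 1) ∧ IntegrableOn (fun x => w x ^ r) (Set.Ico 0 1) ∧
      (∀ n : ℕ, 2 ≤ n → ∃ C : ℝ, ∀ m k : ℤ, nadicI n m k ⊆ Set.Ico 0 1 →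
        (⨍ x in nadicI n m k, w x ^ r) ^ (1 / r) ≤ C * ⨍ x in nadicI n m k, w x) ∧
      ¬ ∃ C : ℝ, ∀ x y : ℝ, 0 ≤ x → x < y → y ≤ 1 →
        (⨍ t in Set.Ico x y, w t ^ r) ^ (1 / r) ≤ C * ⨍ t in Set.Ico x y, w t := by
  have hr0 : 0 < r := by linarith
  obtain ⟨a, ha⟩ : ∃ a : ℝ, a = 1 / (2 * r) := ⟨_, rfl⟩
  have ha0 : 0 < a := by rw [ha]; positivity
  have har : a * r = 1 / 2 := by rw [ha]; field_simp
  have ha1 : a < 1 / 2 := by nlinarith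
  refine ⟨halfPow a, measurable_halfPow a, fun x _ => halfPow_pos a x,
    integrableOn_halfPow (by linarith), ?_, ?_, ?_⟩
  all_goals simp only [halfPow_rpow, har]
  · exact integrableOn_halfPow (by norm_num)
  · intro n hn
    refine ⟨2 * 2 ^ (1 / r), fun m k hJ => ?_⟩
    have hn0 : (0 : ℝ) < n := by positivity
    have hC : (1 : ℝ) ≤ 2 ^ (1 / r) := Real.one_le_rpow one_le_two (by positivity)
    unfold nadicI at hJ ⊢
    have huv : ((k - 1 : ℝ) / (n : ℝ) ^ m) < ((k : ℝ) / (n : ℝ) ^ m) := by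
      gcongr
      linarith
    obtain ⟨hu, hv⟩ := (Ico_subset_Ico_iff huv).1 hJ
    have htri := nadic_le_half_or_half_le_or_symm hn (m := m) (k := k) (by linarith)
    generalize ((k - 1 : ℝ) / (n : ℝ) ^ m) = u at *
    generalize ((k : ℝ) / (n : ℝ) ^ m) = v at *
    rcases le_or_gt v (1 / 2) with hle | hgt
    · have huv' : v - u ≠ 0 := by linarith
      rw [setAverage_Ico_eq huv, setAverage_Ico_eq huv, integral_halfPow_left huv.le hle,
        integral_halfPow_left huv.le hle, div_self huv', Real.one_rpow]
      linarith
    · have h := htri.resolve_left hgt.not_ge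
      have h1 := average_halfPow_le (s := 1 / 2) (by norm_num) (by norm_num) huv hgt hv h
      have h2 := le_average_halfPow ha0.le (by linarith) huv hgt h
      have hq : 0 < v - 1 / 2 := by linarith
      have h0 : 0 ≤ ⨍ x in Ico u v, halfPow (1 / 2) x :=
        integral_nonneg fun x => (halfPow_pos _ x).le
      calc (⨍ x in Ico u v, halfPow (1 / 2) x) ^ (1 / r)
          ≤ ((v - 1 / 2) ^ (-(1 / 2) : ℝ) / (1 - 1 / 2)) ^ (1 / r) :=
            Real.rpow_le_rpow h0 h1 (by positivity)
        _ = (2 * (v - 1 / 2) ^ (-(1 / 2) : ℝ)) ^ (1 / r) := by congr 1; ring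
        _ = 2 ^ (1 / r) * (v - 1 / 2) ^ (-a) := by
            rw [Real.mul_rpow (by norm_num) (by positivity), ← Real.rpow_mul hq.le, ha]
            congr 2
            field_simp
        _ ≤ 2 * 2 ^ (1 / r) * ⨍ x in Ico u v, halfPow a x := by nlinarith
  · rintro ⟨C, hC⟩
    have ht : Filter.Tendsto (fun e : ℝ => e ^ (a - 1 / 2)) (nhdsWithin 0 (Ioi 0))
        Filter.atTop := tendsto_rpow_neg_nhdsGT_zero (by linarith)
    have ht' : Filter.Tendsto (fun e : ℝ => e ^ (1 - a)) (nhdsWithin 0 (Ioi 0))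
        (nhds 0) := by
      have := (Real.continuousAt_rpow_const 0 (1 - a) (Or.inr (by linarith))).tendsto
      rw [Real.zero_rpow (by linarith)] at this
      exact this.mono_left nhdsWithin_le_nhds
    obtain ⟨e, he1, he2, he0⟩ := ((ht.eventually_gt_atTop ((3 * |C|) ^ r)).and
      ((ht'.eventually_lt_const (by norm_num : (0 : ℝ) < 1 / 2)).and
        self_mem_nhdsWithin)).exists
    replace he0 : 0 < e := he0
    have hs0 : 0 < e ^ (1 - a) := Real.rpow_pos_of_pos he0 _
    have he' : e < 1 := by
      by_contra! h
      linarith [Real.one_le_rpow h (by linarith : 0 ≤ 1 - a)]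
    have hes : e ≤ e ^ (1 - a) := by
      conv_lhs => rw [← Real.rpow_one e]
      exact Real.rpow_le_rpow_of_exponent_ge he0 he'.le (by linarith)
    have hsplit : e ^ (1 - 1 / 2 : ℝ) = e ^ (a - 1 / 2) * e ^ (1 - a) := by
      rw [← Real.rpow_add he0]
      congr 1
      ring
    have hlt : 1 / 2 - e ^ (1 - a) < 1 / 2 + e := by linarith
    have key := hC (1 / 2 - e ^ (1 - a)) (1 / 2 + e) (by linarith) hlt (by linarith)
    have hE : 0 < e ^ (a - 1 / 2) := Real.rpow_pos_of_pos he0 _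
    have hlow : e ^ (a - 1 / 2) ≤
        ⨍ t in Ico (1 / 2 - e ^ (1 - a)) (1 / 2 + e), halfPow (1 / 2) t := by
      rw [setAverage_Ico_eq hlt, integral_halfPow_across (by norm_num) (by linarith)
        (by linarith), le_div_iff₀ (by linarith), add_sub_cancel_left, hsplit]
      have := mul_le_mul_of_nonneg_left hes hE.le
      rw [show (1 : ℝ) - 1 / 2 = 1 / 2 by norm_num]
      linarith
    have hup : ⨍ t in Ico (1 / 2 - e ^ (1 - a)) (1 / 2 + e), halfPow a t ≤ 3 := by
      rw [setAverage_Ico_eq hlt, integral_halfPow_across (by linarith) (by linarith)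
        (by linarith), div_le_iff₀ (by linarith), add_sub_cancel_left]
      have : e ^ (1 - a) / (1 - a) ≤ 2 * e ^ (1 - a) := by
        rw [div_le_iff₀ (by linarith)]
        nlinarith
      linarith
    have hnn : 0 ≤ ⨍ t in Ico (1 / 2 - e ^ (1 - a)) (1 / 2 + e), halfPow a t :=
      integral_nonneg fun x => (halfPow_pos _ x).le
    have h1 : 3 * |C| < (e ^ (a - 1 / 2)) ^ (1 / r) := by
      rw [one_div r, Real.lt_rpow_inv_iff_of_pos (by positivity) hE.le hr0]
      exact he1
    have h2 := Real.rpow_le_rpow hE.le hlow (by positivity : 0 ≤ 1 / r)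
    nlinarith [le_abs_self C, abs_nonneg C]
end
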